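/- arXiv:1109.3646 — 2 statements merged into one kernel-verified Lean document; each statement's English description precedes it below -/
import Mathlib

section
/- If all isotropy groups of points of Y in G are finite, then Y is G-saturated; if G acts freely on Y, then Y is G-reduced. -/
/-!
Common framework: a "compact Lie group / complex reductive group acting on a
finite-dimensional module" is modelled as a subgroup of invertible `n × n`
matrices over `𝕜 = ℝ` or `ℂ` acting on `Fin n → 𝕜` by `Matrix.mulVec`.
Polynomial functions on the module are `MvPolynomial (Fin n) 𝕜`.
-/

set_option synthInstance.maxHeartbeats 1000000
set_option maxHeartbeats 1000000

noncomputable section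

open MvPolynomial

namespace ZPaper

variable (𝕜 : Type) [RCLike 𝕜] (n : ℕ)

/-- The zero set of a family of polynomials. -/
def zeroSet (S : Set (MvPolynomial (Fin n) 𝕜)) : Set (Fin n → 𝕜) :=
  {v | ∀ p ∈ S, eval v p = 0}

/-- A subset of `𝕜ⁿ` is algebraic if it is the zero set of a family of polynomials. -/
def IsAlgebraicSet (X : Set (Fin n → 𝕜)) : Prop :=
  ∃ S : Set (MvPolynomial (Fin n) 𝕜), X = zeroSet 𝕜 n S

/-- The vanishing ideal `I(X)` of a subset `X ⊆ 𝕜ⁿ`. -/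
def vanishingIdeal (X : Set (Fin n → 𝕜)) : Ideal (MvPolynomial (Fin n) 𝕜) where
  carrier := {p | ∀ x ∈ X, eval x p = 0}
  zero_mem' := by intro x _; simp
  add_mem' := by intro a b ha hb x hx; simp [ha x hx, hb x hx]
  smul_mem' := by intro c p hp x hx; simp [smul_eq_mul, hp x hx]

/-- The Zariski closure of a subset of `𝕜ⁿ`. -/
def zclosure (A : Set (Fin n → 𝕜)) : Set (Fin n → 𝕜) :=
  zeroSet 𝕜 n (vanishingIdeal 𝕜 n A : Set (MvPolynomial (Fin n) 𝕜))

/-- `A` is Zariski dense in `X`: every polynomial vanishing on `A` vanishes on `X`. -/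
def ZDenseIn (A X : Set (Fin n → 𝕜)) : Prop :=
  ∀ p : MvPolynomial (Fin n) 𝕜, (∀ a ∈ A, eval a p = 0) → ∀ x ∈ X, eval x p = 0

/-- A set of matrices is a subgroup of `GL_n(𝕜)`. -/
def IsMatSubgroup (G : Set (Matrix (Fin n) (Fin n) 𝕜)) : Prop :=
  (1 : Matrix (Fin n) (Fin n) 𝕜) ∈ G ∧ (∀ a ∈ G, ∀ b ∈ G, a * b ∈ G) ∧
    ∀ a ∈ G, IsUnit a ∧ a⁻¹ ∈ G

/-- `X` is a `G`-stable subset of `𝕜ⁿ`. -/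
def Stabilizes (G : Set (Matrix (Fin n) (Fin n) 𝕜)) (X : Set (Fin n → 𝕜)) : Prop :=
  ∀ g ∈ G, ∀ x ∈ X, Matrix.mulVec g x ∈ X

/-- A polynomial is `G`-invariant. -/
def Invariant (G : Set (Matrix (Fin n) (Fin n) 𝕜)) (p : MvPolynomial (Fin n) 𝕜) : Prop :=
  ∀ g ∈ G, ∀ v : Fin n → 𝕜, eval (Matrix.mulVec g v) p = eval v p

/-- `I_G(X)`: the ideal generated by the `G`-invariant polynomials vanishing on `X`,
i.e. by `I(X)^G = I(X) ∩ 𝕜[V]^G`. -/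
def invariantIdeal (G : Set (Matrix (Fin n) (Fin n) 𝕜)) (X : Set (Fin n → 𝕜)) :
    Ideal (MvPolynomial (Fin n) 𝕜) :=
  Ideal.span {p | Invariant 𝕜 n G p ∧ ∀ x ∈ X, eval x p = 0}

/-- `X` is `G`-reduced: `I_G(X) = I(X)`. -/
def IsGReduced (G : Set (Matrix (Fin n) (Fin n) 𝕜)) (X : Set (Fin n → 𝕜)) : Prop :=
  invariantIdeal 𝕜 n G X = vanishingIdeal 𝕜 n X

/-- `X` is almost `G`-reduced: `√I_G(X) = I(X)`. -/
def IsAlmostGReduced (G : Set (Matrix (Fin n) (Fin n) 𝕜)) (X : Set (Fin n → 𝕜)) : Prop :=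
  (invariantIdeal 𝕜 n G X).radical = vanishingIdeal 𝕜 n X

/-- The orbit `G·v`. -/
def orbit (G : Set (Matrix (Fin n) (Fin n) 𝕜)) (v : Fin n → 𝕜) : Set (Fin n → 𝕜) :=
  (fun g => Matrix.mulVec g v) '' G

/-- The isotropy group `G_v`. -/
def isotropy (G : Set (Matrix (Fin n) (Fin n) 𝕜)) (v : Fin n → 𝕜) :
    Set (Matrix (Fin n) (Fin n) 𝕜) :=
  {g ∈ G | Matrix.mulVec g v = v}

/-- Matrix exponential. -/
def mexp (A : Matrix (Fin n) (Fin n) 𝕜) : Matrix (Fin n) (Fin n) 𝕜 :=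
  ∑' k : ℕ, ((k.factorial : 𝕜)⁻¹) • A ^ k

/-- The Lie algebra of a matrix group: matrices whose one-parameter subgroup lies in `G`. -/
def lieAlgebra (G : Set (Matrix (Fin n) (Fin n) 𝕜)) : Set (Matrix (Fin n) (Fin n) 𝕜) :=
  {A | ∀ t : 𝕜, mexp 𝕜 n (t • A) ∈ G}

/-- The tangent space `T_v(G·v)` to the orbit, i.e. `𝔤·v`. -/
def orbitTangent (G : Set (Matrix (Fin n) (Fin n) 𝕜)) (v : Fin n → 𝕜) :
    Submodule 𝕜 (Fin n → 𝕜) :=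
  Submodule.span 𝕜 ((fun A => Matrix.mulVec A v) '' lieAlgebra 𝕜 n G)

/-- `N` is a `G_v`-stable complement to `T_v(G·v)` in `𝕜ⁿ` (a slice at `v`). -/
def IsSliceComplement (G : Set (Matrix (Fin n) (Fin n) 𝕜)) (v : Fin n → 𝕜)
    (N : Submodule 𝕜 (Fin n → 𝕜)) : Prop :=
  IsCompl (orbitTangent 𝕜 n G v) N ∧
    ∀ g ∈ isotropy 𝕜 n G v, ∀ x ∈ N, Matrix.mulVec g x ∈ N

/-- The image of `H` in `GL(N)` is trivial. -/
def ActsTriviallyOn (H : Set (Matrix (Fin n) (Fin n) 𝕜))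
    (N : Submodule 𝕜 (Fin n → 𝕜)) : Prop :=
  ∀ g ∈ H, ∀ x ∈ N, Matrix.mulVec g x = x

/-- The image of `H` in `GL(N)` is finite. -/
def HasFiniteImageOn (H : Set (Matrix (Fin n) (Fin n) 𝕜))
    (N : Submodule 𝕜 (Fin n → 𝕜)) : Prop :=
  Set.Finite ((fun g => fun x : N => Matrix.mulVec g (x : Fin n → 𝕜)) '' H)

/-- The orbit `G·v` is (Zariski) closed. -/
def HasClosedOrbit (G : Set (Matrix (Fin n) (Fin n) 𝕜)) (v : Fin n → 𝕜) : Prop :=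
  zclosure 𝕜 n (orbit 𝕜 n G v) ⊆ orbit 𝕜 n G v

/-- `v` lies on a principal orbit: `G·v` is closed and the isotropy group acts trivially on
some (hence any) slice at `v`. -/
def IsPrincipalPt (G : Set (Matrix (Fin n) (Fin n) 𝕜)) (v : Fin n → 𝕜) : Prop :=
  HasClosedOrbit 𝕜 n G v ∧
    ∃ N, IsSliceComplement 𝕜 n G v N ∧ ActsTriviallyOn 𝕜 n (isotropy 𝕜 n G v) N

/-- `v` lies on an almost principal orbit. -/
def IsAlmostPrincipalPt (G : Set (Matrix (Fin n) (Fin n) 𝕜)) (v : Fin n → 𝕜) : Prop :=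
  HasClosedOrbit 𝕜 n G v ∧
    ∃ N, IsSliceComplement 𝕜 n G v N ∧ HasFiniteImageOn 𝕜 n (isotropy 𝕜 n G v) N

/-- The set of principal points `V_pr`. -/
def prPoints (G : Set (Matrix (Fin n) (Fin n) 𝕜)) : Set (Fin n → 𝕜) :=
  {v | IsPrincipalPt 𝕜 n G v}

/-- The set of almost principal points `V_apr`. -/
def aprPoints (G : Set (Matrix (Fin n) (Fin n) 𝕜)) : Set (Fin n → 𝕜) :=
  {v | IsAlmostPrincipalPt 𝕜 n G v}

/-- `π⁻¹(π(Y))`: all points that the invariants cannot separate from `Y`. -/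
def saturation (G : Set (Matrix (Fin n) (Fin n) 𝕜)) (Y : Set (Fin n → 𝕜)) :
    Set (Fin n → 𝕜) :=
  {v | ∃ y ∈ Y, ∀ p, Invariant 𝕜 n G p → eval v p = eval y p}

/-- `Y` is `G`-saturated: `Y = π⁻¹(π(Y))`. -/
def IsSaturated (G : Set (Matrix (Fin n) (Fin n) 𝕜)) (Y : Set (Fin n → 𝕜)) : Prop :=
  Y = saturation 𝕜 n G Y

/-- The fiber `π⁻¹(π(v))` of the quotient morphism. -/
def piFiber (G : Set (Matrix (Fin n) (Fin n) 𝕜)) (v : Fin n → 𝕜) : Set (Fin n → 𝕜) :=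
  {u | ∀ p, Invariant 𝕜 n G p → eval u p = eval v p}

/-- The invariant ring `𝕜[V]^G` as a subalgebra of `𝕜[V]`. -/
def invariantSubalgebra (G : Set (Matrix (Fin n) (Fin n) 𝕜)) :
    Subalgebra 𝕜 (MvPolynomial (Fin n) 𝕜) where
  carrier := {p | Invariant 𝕜 n G p}
  mul_mem' := by intro a b ha hb g hg v; simp [ha g hg v, hb g hg v]
  one_mem' := by intro g hg v; simp
  add_mem' := by intro a b ha hb g hg v; simp [ha g hg v, hb g hg v]
  zero_mem' := by intro g hg v; simp
  algebraMap_mem' := by intro r g hg v; simp [MvPolynomial.algebraMap_eq]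

/-- The representation is cofree: `𝕜[V]` is a free module over `𝕜[V]^G`. -/
def IsCofree (G : Set (Matrix (Fin n) (Fin n) 𝕜)) : Prop :=
  Module.Free ↥(invariantSubalgebra 𝕜 n G) (MvPolynomial (Fin n) 𝕜)

/-- The vanishing ideal of `π(Y)` in `𝕜[V//G] = 𝕜[V]^G`. -/
def quotVanishingIdeal (G : Set (Matrix (Fin n) (Fin n) 𝕜)) (Y : Set (Fin n → 𝕜)) :
    Ideal ↥(invariantSubalgebra 𝕜 n G) where
  carrier := {p | ∀ y ∈ Y, eval y (p : MvPolynomial (Fin n) 𝕜) = 0}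
  zero_mem' := by intro y hy; simp
  add_mem' := by intro a b ha hb y hy; simp [ha y hy, hb y hy]
  smul_mem' := by intro c p hp y hy; simp [smul_eq_mul, hp y hy]

/-- The module is stable: there is a nonempty Zariski-open set of points with closed orbit. -/
def IsStableModule (G : Set (Matrix (Fin n) (Fin n) 𝕜)) : Prop :=
  ∃ U : Set (Fin n → 𝕜), U.Nonempty ∧ IsAlgebraicSet 𝕜 n Uᶜ ∧
    ∀ v ∈ U, HasClosedOrbit 𝕜 n G v

/-- `G` is Zariski closed in `GL_n(𝕜)`. -/
def IsZClosedInGL (G : Set (Matrix (Fin n) (Fin n) 𝕜)) : Prop :=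
  ∃ P : Set (MvPolynomial (Fin n × Fin n) 𝕜),
    G = {g | IsUnit g ∧ ∀ p ∈ P, eval (fun ij => g ij.1 ij.2) p = 0}

/-- `G` is a (linearly) reductive algebraic group: a Zariski closed subgroup of `GL_n`
containing a Zariski-dense compact subgroup (the unitarian trick characterization). -/
def IsReductiveGroup (G : Set (Matrix (Fin n) (Fin n) 𝕜)) : Prop :=
  IsMatSubgroup 𝕜 n G ∧ IsZClosedInGL 𝕜 n G ∧
    ∃ K : Set (Matrix (Fin n) (Fin n) 𝕜), K ⊆ G ∧ IsCompact K ∧ IsMatSubgroup 𝕜 n K ∧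
      ∀ p : MvPolynomial (Fin n × Fin n) 𝕜,
        (∀ k ∈ K, eval (fun ij => k ij.1 ij.2) p = 0) →
          ∀ g ∈ G, eval (fun ij => g ij.1 ij.2) p = 0

/-- The isotropy groups of `v` and `w` are conjugate in `G`. -/
def ConjIsotropy (G : Set (Matrix (Fin n) (Fin n) 𝕜)) (v w : Fin n → 𝕜) : Prop :=
  ∃ g ∈ G, isotropy 𝕜 n G w = (fun h => g * h * g⁻¹) '' isotropy 𝕜 n G v

/-- The (Luna) stratum of `V` determined by a point `v` with closed orbit: the inverse image
under `π` of the set of closed orbits with isotropy group conjugate to `G_v`. -/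
def stratumOf (G : Set (Matrix (Fin n) (Fin n) 𝕜)) (v : Fin n → 𝕜) : Set (Fin n → 𝕜) :=
  {u | ∃ w, HasClosedOrbit 𝕜 n G w ∧ w ∈ zclosure 𝕜 n (orbit 𝕜 n G u) ∧
    ConjIsotropy 𝕜 n G v w}

/-- Dimension of (the Zariski closure of) a subset of `𝕜ⁿ`, as the Krull dimension of its
coordinate ring. -/
def adim (X : Set (Fin n → 𝕜)) : WithBot ℕ∞ :=
  ringKrullDim (MvPolynomial (Fin n) 𝕜 ⧸ vanishingIdeal 𝕜 n X)

/-- A nonempty algebraic set with prime vanishing ideal, i.e. an irreducible algebraic set. -/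
def IsIrredAlg (Z : Set (Fin n → 𝕜)) : Prop :=
  IsAlgebraicSet 𝕜 n Z ∧ Z.Nonempty ∧ (vanishingIdeal 𝕜 n Z).IsPrime

/-- `Z` is an irreducible component of `Y`. -/
def IsIrredComponentOf (Y Z : Set (Fin n → 𝕜)) : Prop :=
  IsIrredAlg 𝕜 n Z ∧ Z ⊆ Y ∧
    ∀ Z', IsIrredAlg 𝕜 n Z' → Z ⊆ Z' → Z' ⊆ Y → Z' = Z

/-- The rank at `v` of the differential of `f = (f_1, …, f_d) : V → 𝕜^d`. -/
def jacRank {d : ℕ} (f : Fin d → MvPolynomial (Fin n) 𝕜) (v : Fin n → 𝕜) : ℕ :=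
  (Matrix.of fun (i : Fin d) (j : Fin n) => eval v (pderiv j (f i))).rank

/-- A polynomial is `H`-invariant as a function on the submodule `N`. -/
def InvariantOn (H : Set (Matrix (Fin n) (Fin n) 𝕜)) (N : Submodule 𝕜 (Fin n → 𝕜))
    (p : MvPolynomial (Fin n) 𝕜) : Prop :=
  ∀ g ∈ H, ∀ x ∈ N, eval (Matrix.mulVec g x) p = eval x p

/-- The null cone of the `H`-module `N`: points of `N` which the `H`-invariant functions on `N`
cannot separate from `0`. -/
def sliceNullCone (H : Set (Matrix (Fin n) (Fin n) 𝕜)) (N : Submodule 𝕜 (Fin n → 𝕜)) :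
    Set (Fin n → 𝕜) :=
  {x | x ∈ N ∧ ∀ p, InvariantOn 𝕜 n H N p → eval x p = eval (0 : Fin n → 𝕜) p}

/-- The `H`-module `N` is coreduced: the vanishing ideal of its null cone in `𝕜[N]` is
generated by `H`-invariant functions.  (Stated in `𝕜[V]`: the vanishing ideal of the null
cone equals the ideal generated by the invariant functions vanishing on it together with the
vanishing ideal of `N`.) -/
def CoreducedOn (H : Set (Matrix (Fin n) (Fin n) 𝕜)) (N : Submodule 𝕜 (Fin n → 𝕜)) : Prop :=
  vanishingIdeal 𝕜 n (sliceNullCone 𝕜 n H N) =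
    Ideal.span ({p | InvariantOn 𝕜 n H N p ∧ ∀ x ∈ sliceNullCone 𝕜 n H N, eval x p = 0} ∪
      {p | ∀ x ∈ (N : Set (Fin n → 𝕜)), eval x p = 0})

/-- Complexification of a real vector. -/
def cVec (w : Fin n → ℝ) : Fin n → ℂ := fun i => (w i : ℂ)

/-- The complexification `G = K_ℂ` of a compact matrix group `K ⊆ GL_n(ℝ)`: the Zariski
closure of `K` in the complex matrices. -/
def complexifiedGroup (K : Set (Matrix (Fin n) (Fin n) ℝ)) :
    Set (Matrix (Fin n) (Fin n) ℂ) :=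
  {g | ∀ p : MvPolynomial (Fin n × Fin n) ℂ,
    (∀ k ∈ K, eval (fun ij => (k ij.1 ij.2 : ℂ)) p = 0) →
      eval (fun ij => g ij.1 ij.2) p = 0}

/-- The complexification `Y = X_ℂ ⊆ ℂⁿ` of `X ⊆ ℝⁿ`: the Zariski closure of `X` in `ℂⁿ`. -/
def complexification (X : Set (Fin n → ℝ)) : Set (Fin n → ℂ) :=
  zclosure ℂ n (cVec n '' X)

open TensorProduct

theorem exists_algHom_ker_eq {R : Type*} [CommRing R] [Algebra ℂ R] [Algebra.FiniteType ℂ R]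
    (m : Ideal R) [hm : m.IsMaximal] : ∃ χ : R →ₐ[ℂ] ℂ, RingHom.ker χ = m := by
  let _ := Ideal.Quotient.field m
  have : Module.Finite ℂ (R ⧸ m) := finite_of_finite_type_of_isJacobsonRing ℂ (R ⧸ m)
  have hbij : Function.Bijective (algebraMap ℂ (R ⧸ m)) :=
    IsAlgClosed.algebraMap_bijective_of_isIntegral
  let e : ℂ ≃ₐ[ℂ] (R ⧸ m) := AlgEquiv.ofBijective (Algebra.ofId ℂ (R ⧸ m)) hbij
  refine ⟨(e.symm : (R ⧸ m) →ₐ[ℂ] ℂ).comp (Ideal.Quotient.mkₐ ℂ m), ?_⟩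
  ext r
  simp [RingHom.mem_ker, Ideal.Quotient.eq_zero_iff_mem]

theorem mem_of_forall_algHom {R : Type*} [CommRing R] [Algebra ℂ R] [Algebra.FiniteType ℂ R]
    (I : Ideal R) (hI : I.IsRadical) (r : R)
    (h : ∀ χ : R →ₐ[ℂ] ℂ, (∀ a ∈ I, χ a = 0) → χ r = 0) : r ∈ I := by
  have : IsJacobsonRing R := isJacobsonRing_of_finiteType (A := ℂ)
  rw [← IsJacobsonRing.out ‹_› hI, Ideal.jacobson, Ideal.mem_sInf]
  rintro m ⟨hIm, hm⟩
  obtain ⟨χ, rfl⟩ := exists_algHom_ker_eq m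
  exact h χ fun a ha => hIm ha

theorem isNilpotent_of_forall_algHom {R : Type*} [CommRing R] [Algebra ℂ R]
    [Algebra.FiniteType ℂ R] (r : R) (h : ∀ χ : R →ₐ[ℂ] ℂ, χ r = 0) : IsNilpotent r := by
  rw [← mem_nilradical]
  exact mem_of_forall_algHom _ (Ideal.radical_isRadical _) r fun χ _ => h χ

theorem finiteType_tensorProduct (B R S : Type*) [CommRing B] [CommRing R] [CommRing S]
    [Algebra ℂ B] [Algebra ℂ R] [Algebra ℂ S] [Algebra B R] [Algebra B S] [IsScalarTower ℂ B R]
    [IsScalarTower ℂ B S] [Algebra.FiniteType ℂ R] [hS : Algebra.FiniteType ℂ S] :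
    Algebra.FiniteType ℂ (R ⊗[B] S) := by
  have : Algebra.FiniteType B S := .of_restrictScalars_finiteType ℂ B S
  exact .trans (S := R) ‹_› inferInstance

/-- Two maps with the same kernel into domains have a common point. -/
theorem exists_algHom_comp_eq {A R S : Type*} [CommRing A] [CommRing R] [CommRing S]
    [Algebra ℂ A] [Algebra ℂ R] [Algebra ℂ S] [Algebra.FiniteType ℂ R] [Algebra.FiniteType ℂ S]
    [IsDomain R] [IsDomain S] (f : A →ₐ[ℂ] R) (g : A →ₐ[ℂ] S)
    (h : RingHom.ker f = RingHom.ker g) :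
    ∃ (χ : R →ₐ[ℂ] ℂ) (ψ : S →ₐ[ℂ] ℂ), ∀ a, χ (f a) = ψ (g a) := by
  let f' : (A ⧸ RingHom.ker f) →ₐ[ℂ] R := Ideal.kerLiftAlg f
  let g' : (A ⧸ RingHom.ker f) →ₐ[ℂ] S := Ideal.Quotient.liftₐ _ g fun a ha => by
    rw [← RingHom.mem_ker, ← h]; exact ha
  have hf' : Function.Injective f' := Ideal.kerLiftAlg_injective f
  have hg' : Function.Injective g' := by
    rw [injective_iff_map_eq_zero]
    intro b hb
    obtain ⟨a, rfl⟩ := Ideal.Quotient.mk_surjective b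
    rw [Ideal.Quotient.eq_zero_iff_mem, h]
    exact hb
  let _ : Algebra (A ⧸ RingHom.ker f) R := f'.toRingHom.toAlgebra
  let _ : Algebra (A ⧸ RingHom.ker f) S := g'.toRingHom.toAlgebra
  have : IsScalarTower ℂ (A ⧸ RingHom.ker f) R := .of_algebraMap_eq fun x => (f'.commutes x).symm
  have : IsScalarTower ℂ (A ⧸ RingHom.ker f) S := .of_algebraMap_eq fun x => (g'.commutes x).symm
  have : Nontrivial (R ⊗[A ⧸ RingHom.ker f] S) :=
    Algebra.TensorProduct.nontrivial_of_algebraMap_injective_of_isDomain _ R S hf' hg'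
  have := finiteType_tensorProduct (A ⧸ RingHom.ker f) R S
  obtain ⟨m, hm⟩ := Ideal.exists_maximal (R ⊗[A ⧸ RingHom.ker f] S)
  obtain ⟨χ, -⟩ := exists_algHom_ker_eq m
  refine ⟨χ.comp (Algebra.TensorProduct.includeLeft),
    χ.comp (Algebra.TensorProduct.includeRight.restrictScalars ℂ), fun a => ?_⟩
  have : f a ⊗ₜ[A ⧸ RingHom.ker f] (1 : S) = 1 ⊗ₜ g a :=
    Algebra.TensorProduct.tmul_one_eq_one_tmul (A := R) (B := S)
      (Ideal.Quotient.mk (RingHom.ker f) a)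
  exact congrArg χ this

section
variable {K R : Type*} [Field K] [CommRing R] [Algebra K R]

theorem exists_linearMap_one_eq_one [Nontrivial R] : ∃ l : R →ₗ[K] K, l 1 = 1 := by
  obtain ⟨l, hl⟩ := (LinearMap.toSpanSingleton K R 1).exists_leftInverse_of_injective
    (LinearMap.ker_toSpanSingleton K one_ne_zero)
  exact ⟨l, by simpa using LinearMap.congr_fun hl 1⟩

theorem isIntegral_of_eval₂_tensor_eq_zero (x : R) (P : Polynomial R) (hP : P.Monic)
    (h : P.eval₂ (Algebra.TensorProduct.includeLeft : R →ₐ[K] R ⊗[K] R).toRingHom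
      (1 ⊗ₜ[K] x) = 0) : IsIntegral K x := by
  nontriviality R
  obtain ⟨l, hl⟩ := exists_linearMap_one_eq_one (K := K) (R := R)
  let L : R ⊗[K] R →ₗ[K] R := (TensorProduct.lid K R).toLinearMap ∘ₗ l.rTensor R
  have hL : ∀ a b, L (a ⊗ₜ b) = l a • b := fun a b => by simp [L]
  refine ⟨∑ i ∈ Finset.range (P.natDegree + 1), Polynomial.monomial i (l (P.coeff i)), ?_, ?_⟩
  · refine Polynomial.monic_of_natDegree_le_of_coeff_eq_one P.natDegree ?_ ?_
    · refine Polynomial.natDegree_sum_le_of_forall_le _ _ fun i hi => ?_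
      exact (Polynomial.natDegree_monomial_le _).trans (by simpa [Nat.lt_succ_iff] using hi)
    · simp [Polynomial.coeff_monomial, hP.coeff_natDegree, hl]
  · rw [Polynomial.eval₂_finsetSum]
    rw [Polynomial.eval₂_eq_sum_range] at h
    have := congrArg L h
    simpa [hL, Polynomial.eval₂_monomial, Algebra.smul_def, map_sum] using this

theorem mem_range_algebraMap_of_tmul_eq (x : R) (h : x ⊗ₜ[K] (1 : R) = 1 ⊗ₜ x) :
    x ∈ (algebraMap K R).range := by
  nontriviality R
  obtain ⟨l, hl⟩ := exists_linearMap_one_eq_one (K := K) (R := R)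
  have := congrArg ((TensorProduct.lid K R).toLinearMap ∘ₗ l.rTensor R) h
  exact ⟨l x, by simpa [hl, Algebra.smul_def] using this⟩

theorem eq_of_isNilpotent_sub_of_separable {S : Type*} [CommRing S] [Algebra K S]
    (m : Polynomial K) (hm : m.Separable) (a b : S) (ha : Polynomial.aeval a m = 0)
    (hb : Polynomial.aeval b m = 0) (h : IsNilpotent (a - b)) : a = b := by
  have hu : IsUnit (Polynomial.aeval b m.derivative) := by
    obtain ⟨u, v, huv⟩ := hm
    have := congrArg (Polynomial.aeval b) huv
    simp only [map_add, map_mul, hb, mul_zero, zero_add, map_one] at this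
    exact IsUnit.of_mul_eq_one_right _ this
  obtain ⟨r, -, hr⟩ := Polynomial.existsUnique_nilpotent_sub_and_aeval_eq_zero
    (x := b) (P := m) (by rw [hb]; exact IsNilpotent.zero) hu
  rw [hr a ⟨by rw [← neg_sub]; exact h.neg, ha⟩, hr b ⟨by simp, hb⟩]

theorem exists_separable_aeval_eq_zero [CharZero K] [IsReduced R] (x : R)
    (hx : IsIntegral K x) : ∃ m : Polynomial K, m.Separable ∧ Polynomial.aeval x m = 0 := by
  obtain ⟨p, hp, hpx⟩ := hx
  obtain ⟨g, k, sep, -, nil⟩ := exists_squarefree_dvd_pow_of_ne_zero hp.ne_zero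
  refine ⟨g, PerfectField.separable_iff_squarefree.mpr sep, ?_⟩
  obtain ⟨q, hq⟩ := nil
  refine eq_zero_of_pow_eq_zero (n := k) ?_
  rw [← map_pow, hq, map_mul, Polynomial.aeval_def, hpx, zero_mul]

/-- Over a field of characteristic zero, an element of a reduced algebra whose two images in the
tensor square differ by a nilpotent is a scalar. -/
theorem mem_range_algebraMap_of_isNilpotent [CharZero K] [IsReduced R] (x : R)
    (h : IsNilpotent (x ⊗ₜ[K] (1 : R) - 1 ⊗ₜ x)) : x ∈ (algebraMap K R).range := by
  have hx : IsIntegral K x := by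
    obtain ⟨N, hN⟩ := h
    refine isIntegral_of_eval₂_tensor_eq_zero x ((Polynomial.X - Polynomial.C x) ^ N)
      ((Polynomial.monic_X_sub_C x).pow N) ?_
    rw [Polynomial.eval₂_pow, Polynomial.eval₂_sub, Polynomial.eval₂_X, Polynomial.eval₂_C,
      ← neg_sub, neg_pow]
    simp [hN]
  obtain ⟨m, hm, hmx⟩ := exists_separable_aeval_eq_zero x hx
  refine mem_range_algebraMap_of_tmul_eq x
    (eq_of_isNilpotent_sub_of_separable m hm _ _ ?_ ?_ h)
  · have := Polynomial.aeval_algHom_apply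
      (Algebra.TensorProduct.includeLeft : R →ₐ[K] R ⊗[K] R) x m
    simpa [hmx] using this
  · have := Polynomial.aeval_algHom_apply
      (Algebra.TensorProduct.includeRight : R →ₐ[K] R ⊗[K] R) x m
    simpa [hmx] using this
end

theorem exists_notMem_mul_mem_range {B C : Type*} [CommRing B] [CommRing C] [Algebra ℂ B]
    [Algebra B C] [IsReduced B] [IsReduced C] (p : Ideal B) (hp : p ∈ minimalPrimes B) (x : C)
    (h : IsNilpotent (x ⊗ₜ[B] (1 : C) - 1 ⊗ₜ x)) :
    ∃ s ∉ p, algebraMap B C s * x ∈ (algebraMap B C).range := by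
  have hpp : p.IsPrime := hp.1.1
  let K := Localization.AtPrime p
  have : Ring.KrullDimLE 0 K := Ring.KrullDimLE.of_isLocalization p hp K
  let _ : Field K := (Ring.KrullDimLE.isField_of_isReduced (R := K)).toField
  have : CharZero K := charZero_of_injective_algebraMap (algebraMap ℂ K).injective
  let M := Algebra.algebraMapSubmonoid C p.primeCompl
  let C' := Localization M
  let _ : Algebra K C' := inferInstanceAs
    (Algebra (Localization p.primeCompl)
      (Localization (Algebra.algebraMapSubmonoid C p.primeCompl)))
  have : IsScalarTower B K C' := inferInstanceAs
    (IsScalarTower B (Localization p.primeCompl)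
      (Localization (Algebra.algebraMapSubmonoid C p.primeCompl)))
  have : IsReduced C' := isReduced_localizationPreserves M C' inferInstance
  let _ : CompatibleSMul K B C' C' := CompatibleSMul.isScalarTower
  let F : C ⊗[B] C →ₐ[B] C' ⊗[K] C' := (Algebra.TensorProduct.mapOfCompatibleSMul K B B C' C').comp
    (Algebra.TensorProduct.map (IsScalarTower.toAlgHom B C C') (IsScalarTower.toAlgHom B C C'))
  obtain ⟨k, hk⟩ := mem_range_algebraMap_of_isNilpotent (K := K) (algebraMap C C' x)
    (by simpa [F] using h.map F)
  obtain ⟨b, s, rfl⟩ := IsLocalization.exists_mk'_eq p.primeCompl k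
  have h1 : algebraMap C C' (algebraMap B C b) = algebraMap C C' (algebraMap B C s * x) := by
    rw [map_mul, ← hk, ← IsScalarTower.algebraMap_apply, ← IsScalarTower.algebraMap_apply,
      IsScalarTower.algebraMap_apply B K C', IsScalarTower.algebraMap_apply B K C' s, ← map_mul,
      IsLocalization.mk'_spec']
  obtain ⟨⟨_, t, ht, rfl⟩, h2⟩ := (IsLocalization.eq_iff_exists M C').1 h1
  refine ⟨t * s, p.primeCompl.mul_mem ht s.2, t * b, ?_⟩
  simpa [mul_assoc] using h2

theorem isAlgebraic_of_forall_algHom {B C : Type*} [CommRing B] [CommRing C] [IsDomain B]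
    [IsDomain C] [Algebra ℂ B] [Algebra ℂ C] [Algebra B C] [IsScalarTower ℂ B C]
    [FaithfulSMul B C] [Algebra.FiniteType ℂ C] (x : C) (S : Finset C)
    (h : ∀ χ ψ : C →ₐ[ℂ] ℂ, (∀ b, χ (algebraMap B C b) = ψ (algebraMap B C b)) →
      ∃ s ∈ S, χ s = ψ x) : IsAlgebraic B x := by
  have hN : IsNilpotent (∏ s ∈ S, ((1 : C) ⊗ₜ[B] x - s ⊗ₜ[B] (1 : C))) := by
    have := finiteType_tensorProduct B C C
    refine isNilpotent_of_forall_algHom _ fun χ => ?_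
    obtain ⟨s, hs, hsx⟩ := h (χ.comp Algebra.TensorProduct.includeLeft)
      (χ.comp (Algebra.TensorProduct.includeRight.restrictScalars ℂ)) fun b => by
        have := Algebra.TensorProduct.tmul_one_eq_one_tmul (A := C) (B := C) b
        exact congrArg χ this
    rw [map_prod]
    refine Finset.prod_eq_zero hs ?_
    rw [map_sub, sub_eq_zero]
    exact hsx.symm
  obtain ⟨N, hN⟩ := hN
  let K := FractionRing B
  let L := FractionRing C
  let _ : Algebra K L := FractionRing.liftAlgebra B L
  have : IsScalarTower B K L := FractionRing.isScalarTower_liftAlgebra B L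
  let _ : CompatibleSMul K B L L := CompatibleSMul.isScalarTower
  let F : C ⊗[B] C →ₐ[B] L ⊗[K] L := (Algebra.TensorProduct.mapOfCompatibleSMul K B B L L).comp
    (Algebra.TensorProduct.map (IsScalarTower.toAlgHom B C L) (IsScalarTower.toAlgHom B C L))
  have := isIntegral_of_eval₂_tensor_eq_zero (K := K) (algebraMap C L x)
    ((∏ s ∈ S, (Polynomial.X - Polynomial.C (algebraMap C L s))) ^ N)
    ((Polynomial.monic_prod_of_monic _ _ fun s _ => Polynomial.monic_X_sub_C _).pow N)
    (by
      have := congrArg F hN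
      rw [map_pow, map_prod, map_zero] at this
      rw [Polynomial.eval₂_pow, Polynomial.eval₂_finsetProd]
      simp only [Polynomial.eval₂_sub, Polynomial.eval₂_X, Polynomial.eval₂_C]
      simp only [F, map_sub, AlgHom.comp_apply, Algebra.TensorProduct.map_tmul, map_one,
        Algebra.TensorProduct.mapOfCompatibleSMul_tmul] at this
      exact this)
  have := (IsFractionRing.isAlgebraic_iff B K L).2 this.isAlgebraic
  exact (isAlgebraic_algebraMap_iff (IsFractionRing.injective C L)).1 this

universe u in
theorem injective_of_surjective_of_trdeg_le {k : Type*} {R S : Type u} [Field k] [CommRing R]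
    [IsDomain R] [CommRing S] [IsDomain S] [Algebra k R] [Algebra k S] (f : R →ₐ[k] S)
    (hf : Function.Surjective f) (hfin : Algebra.trdeg k R < Cardinal.aleph0)
    (h : Algebra.trdeg k R ≤ Algebra.trdeg k S) : Function.Injective f := by
  have : FaithfulSMul k R :=
    (faithfulSMul_iff_algebraMap_injective _ _).2 (algebraMap k R).injective
  have : FaithfulSMul k S :=
    (faithfulSMul_iff_algebraMap_injective _ _).2 (algebraMap k S).injective
  obtain ⟨s, hs⟩ := exists_isTranscendenceBasis k S
  choose a ha using fun i : s => hf i.1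
  have hsw : Cardinal.mk s = Algebra.trdeg k S := hs.cardinalMk_eq_trdeg
  have hind : AlgebraicIndependent k a := by
    refine AlgebraicIndependent.of_comp f ?_
    rw [show f ∘ a = Subtype.val from funext ha]
    exact hs.1
  have hsR : Cardinal.mk s ≤ Algebra.trdeg k R := hind.cardinalMk_le_trdeg
  have : Finite s := by
    rw [← Cardinal.lt_aleph0_iff_finite]; exact hsR.trans_lt hfin
  have hbas := hind.isTranscendenceBasis_of_trdeg_le_of_finite (h.trans hsw.ge)
  rw [injective_iff_map_eq_zero]
  intro r hr
  by_contra hr0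
  have := hbas.isAlgebraic
  obtain ⟨c, hc0, d, hd⟩ := (Algebra.IsAlgebraic.isAlgebraic (R := Algebra.adjoin k (Set.range a)) r
    ).exists_nonzero_dvd (mem_nonZeroDivisors_of_ne_zero hr0)
  obtain ⟨c, hc⟩ := c
  rw [Algebra.adjoin_range_eq_range_aeval] at hc
  obtain ⟨q, rfl⟩ := hc
  have h1 : f (MvPolynomial.aeval a q) = 0 := by
    rw [show MvPolynomial.aeval a q = r * d from hd, map_mul, hr, zero_mul]
  have h2 : MvPolynomial.aeval (Subtype.val : s → S) q = 0 := by
    rw [← show f ∘ a = Subtype.val from funext ha, ← h1]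
    exact (MvPolynomial.comp_aeval_apply a f q).symm
  have := (injective_iff_map_eq_zero _).1 hs.1 q h2
  subst this
  exact hc0 (Subtype.ext (map_zero (MvPolynomial.aeval a)))

theorem ker_eq_of_ker_le_of_isAlgebraic {A C : Type*} [CommRing A] [CommRing C] [IsDomain C]
    [Algebra ℂ A] [Algebra ℂ C] [Algebra.FiniteType ℂ C] (v w : A →ₐ[ℂ] C)
    (hle : RingHom.ker v ≤ RingHom.ker w) (h : ∀ x : C, IsAlgebraic w.range x) :
    RingHom.ker v = RingHom.ker w := by
  have hfin : Algebra.trdeg ℂ C < Cardinal.aleph0 := trdeg_lt_aleph0_of_finiteType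
  have hvC : Algebra.trdeg ℂ v.range ≤ Algebra.trdeg ℂ C :=
    trdeg_le_of_injective v.range.val Subtype.val_injective
  have hwC : Algebra.trdeg ℂ w.range = Algebra.trdeg ℂ C := by
    have : Algebra.IsAlgebraic w.range C := ⟨h⟩
    have : FaithfulSMul ℂ w.range :=
      (faithfulSMul_iff_algebraMap_injective _ _).2 (algebraMap ℂ w.range).injective
    have := trdeg_add_eq ℂ w.range (A := C)
    rwa [trdeg_eq_zero (R := w.range), add_zero] at this
  let f : v.range →ₐ[ℂ] w.range :=
    (Ideal.Quotient.liftₐ (RingHom.ker v) w.rangeRestrict fun a ha => Subtype.ext (hle ha)).comp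
      (Ideal.quotientKerEquivRange v).symm.toAlgHom
  have hf : ∀ a, f (v.rangeRestrict a) = w.rangeRestrict a := fun a => by
    have : (Ideal.quotientKerEquivRange v).symm (v.rangeRestrict a) =
        Ideal.Quotient.mk (RingHom.ker v) a := by
      rw [AlgEquiv.symm_apply_eq]; rfl
    simp only [f, AlgHom.comp_apply]
    exact (congrArg _ this).trans rfl
  have hinj := injective_of_surjective_of_trdeg_le f (fun x => by
    obtain ⟨a, rfl⟩ := w.rangeRestrict_surjective x
    exact ⟨_, hf a⟩) (hvC.trans_lt hfin) (hvC.trans hwC.ge)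
  refine le_antisymm hle fun a ha => ?_
  have : v.rangeRestrict a = 0 := hinj (by rw [hf, map_zero]; exact Subtype.ext ha)
  exact congrArg Subtype.val this

section CoordRing

variable {Γ Δ : Type*} [Group Γ] [Group Δ] {ι : Type*} [Fintype ι] [DecidableEq ι]

/-- The algebra of functions on a matrix group generated by the entries of `ρ g` and `ρ g⁻¹`. -/
def coordRing (ρ : Γ →* Matrix ι ι ℂ) : Subalgebra ℂ (Γ → ℂ) :=
  Algebra.adjoin ℂ (Set.range (fun (ij : ι × ι) (g : Γ) => ρ g ij.1 ij.2) ∪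
    Set.range (fun (ij : ι × ι) (g : Γ) => ρ g⁻¹ ij.1 ij.2))

variable (ρ : Γ →* Matrix ι ι ℂ) (σ : Δ →* Matrix ι ι ℂ)

theorem entry_mem_coordRing (i j : ι) : (fun g => ρ g i j) ∈ coordRing ρ :=
  Algebra.subset_adjoin (Or.inl ⟨(i, j), rfl⟩)

theorem entry_inv_mem_coordRing (i j : ι) : (fun g => ρ g⁻¹ i j) ∈ coordRing ρ :=
  Algebra.subset_adjoin (Or.inr ⟨(i, j), rfl⟩)

instance : Algebra.FiniteType ℂ (coordRing ρ) :=
  (Subalgebra.fg_iff_finiteType _).1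
    ⟨((Set.finite_range fun (ij : ι × ι) (g : Γ) => ρ g ij.1 ij.2).union
      (Set.finite_range fun (ij : ι × ι) (g : Γ) => ρ g⁻¹ ij.1 ij.2)).toFinset,
      by rw [Set.Finite.coe_toFinset, coordRing]⟩

instance : IsNoetherianRing (coordRing ρ) := Algebra.FiniteType.isNoetherianRing ℂ _

variable {ρ} in
theorem coordRing_induction {p : (Γ → ℂ) → Prop} (h1 : ∀ i j, p fun g => ρ g i j)
    (h2 : ∀ i j, p fun g => ρ g⁻¹ i j) (hC : ∀ c : ℂ, p fun _ => c)
    (hadd : ∀ f g, p f → p g → p (f + g)) (hmul : ∀ f g, p f → p g → p (f * g))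
    {f : Γ → ℂ} (hf : f ∈ coordRing ρ) : p f := by
  refine Algebra.adjoin_induction ?_ hC (fun f g _ _ => hadd f g) (fun f g _ _ => hmul f g) hf
  rintro _ (⟨ij, rfl⟩ | ⟨ij, rfl⟩)
  exacts [h1 _ _, h2 _ _]

variable {ρ σ} in
theorem comp_mem_coordRing (τ : Δ → Γ) (h1 : ∀ i j, (fun d => ρ (τ d) i j) ∈ coordRing σ)
    (h2 : ∀ i j, (fun d => ρ (τ d)⁻¹ i j) ∈ coordRing σ) {f : Γ → ℂ} (hf : f ∈ coordRing ρ) :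
    f ∘ τ ∈ coordRing σ :=
  coordRing_induction (p := fun f => f ∘ τ ∈ coordRing σ) h1 h2
    (fun c => (coordRing σ).algebraMap_mem c) (fun _ _ hf hg => add_mem hf hg)
    (fun _ _ hf hg => mul_mem hf hg) hf

theorem mulLeft_mem_coordRing (a : Γ) {f : Γ → ℂ} (hf : f ∈ coordRing ρ) :
    f ∘ (a * ·) ∈ coordRing ρ := by
  refine comp_mem_coordRing _ (fun i j => ?_) (fun i j => ?_) hf
  · simp only [map_mul, Matrix.mul_apply]
    convert sum_mem fun k (_ : k ∈ Finset.univ) =>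
      (coordRing ρ).smul_mem (entry_mem_coordRing ρ k j) (ρ a i k) using 1
    ext; simp
  · simp only [mul_inv_rev, map_mul, Matrix.mul_apply]
    convert sum_mem fun k (_ : k ∈ Finset.univ) =>
      (coordRing ρ).smul_mem (entry_inv_mem_coordRing ρ i k) (ρ a⁻¹ k j) using 1
    ext; simp [mul_comm]

theorem mulRight_mem_coordRing (a : Γ) {f : Γ → ℂ} (hf : f ∈ coordRing ρ) :
    f ∘ (· * a) ∈ coordRing ρ := by
  refine comp_mem_coordRing _ (fun i j => ?_) (fun i j => ?_) hf
  · simp only [map_mul, Matrix.mul_apply]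
    convert sum_mem fun k (_ : k ∈ Finset.univ) =>
      (coordRing ρ).smul_mem (entry_mem_coordRing ρ i k) (ρ a k j) using 1
    ext; simp [mul_comm]
  · simp only [mul_inv_rev, map_mul, Matrix.mul_apply]
    convert sum_mem fun k (_ : k ∈ Finset.univ) =>
      (coordRing ρ).smul_mem (entry_inv_mem_coordRing ρ k j) (ρ a⁻¹ i k) using 1
    ext; simp

theorem inv_mem_coordRing {f : Γ → ℂ} (hf : f ∈ coordRing ρ) : f ∘ (·⁻¹) ∈ coordRing ρ :=
  comp_mem_coordRing _ (entry_inv_mem_coordRing ρ)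
    (fun i j => by simpa using entry_mem_coordRing ρ i j) hf

/-- Left translation on the coordinate ring. -/
def leftTranslate (a : Γ) : coordRing ρ →ₐ[ℂ] coordRing ρ where
  toFun f := ⟨f.1 ∘ (a * ·), mulLeft_mem_coordRing ρ a f.2⟩
  map_one' := rfl
  map_mul' _ _ := rfl
  map_zero' := rfl
  map_add' _ _ := rfl
  commutes' _ := rfl

theorem leftTranslate_leftTranslate_inv (a : Γ) (f : coordRing ρ) :
    leftTranslate ρ a (leftTranslate ρ a⁻¹ f) = f :=
  Subtype.ext (_root_.funext fun g => congrArg f.1 (inv_mul_cancel_left a g))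

/-- Evaluation at a group element. -/
def evalAt (g : Γ) : coordRing ρ →ₐ[ℂ] ℂ := (Pi.evalAlgHom ℂ (fun _ => ℂ) g).comp (coordRing ρ).val

theorem evalAt_apply (g : Γ) (f : coordRing ρ) : evalAt ρ g f = f.1 g := rfl

/-- Every `ℂ`-point of the coordinate ring comes from a group element. -/
def HasPoints : Prop := ∀ χ : coordRing ρ →ₐ[ℂ] ℂ, ∃ g, χ = evalAt ρ g

variable {ρ} in
theorem HasPoints.mem_of_forall (hρ : HasPoints ρ) {I : Ideal (coordRing ρ)} (hI : I.IsRadical)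
    {f : coordRing ρ} (h : ∀ g, (∀ a ∈ I, a.1 g = 0) → f.1 g = 0) : f ∈ I :=
  mem_of_forall_algHom I hI f fun χ hχ => by
    obtain ⟨g, rfl⟩ := hρ χ
    exact h g hχ

/-- The orbit map of `v` on coordinate rings. -/
def orbitMap (v : ι → ℂ) : MvPolynomial ι ℂ →ₐ[ℂ] coordRing ρ :=
  aeval fun i => ⟨fun g => (ρ g).mulVec v i, by
    simp only [Matrix.mulVec, dotProduct]
    convert sum_mem fun k (_ : k ∈ Finset.univ) =>
      (coordRing ρ).smul_mem (entry_mem_coordRing ρ i k) (v k) using 1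
    ext; simp [mul_comm]⟩

theorem orbitMap_apply (v : ι → ℂ) (p : MvPolynomial ι ℂ) (g : Γ) :
    (orbitMap ρ v p).1 g = eval ((ρ g).mulVec v) p := by
  rw [← evalAt_apply, orbitMap, comp_aeval_apply]
  rfl

theorem mem_ker_orbitMap {v : ι → ℂ} {p : MvPolynomial ι ℂ} :
    p ∈ RingHom.ker (orbitMap ρ v) ↔ ∀ g, eval ((ρ g).mulVec v) p = 0 := by
  simp_rw [RingHom.mem_ker, ← orbitMap_apply, Subtype.ext_iff, funext_iff]
  rfl

theorem hasPoints_of_isZClosed {P : Set (MvPolynomial (ι × ι) ℂ)}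
    (h : ∀ a b : Matrix ι ι ℂ, a * b = 1 → (∀ p ∈ P, eval (fun ij => a ij.1 ij.2) p = 0) →
      ∃ g, ρ g = a) (hP : ∀ p ∈ P, ∀ g, eval (fun ij => ρ g ij.1 ij.2) p = 0) :
    HasPoints ρ := by
  intro χ
  let x : ι × ι → coordRing ρ := fun ij => ⟨fun g => ρ g ij.1 ij.2, entry_mem_coordRing ρ ij.1 ij.2⟩
  let y : ι × ι → coordRing ρ :=
    fun ij => ⟨fun g => ρ g⁻¹ ij.1 ij.2, entry_inv_mem_coordRing ρ ij.1 ij.2⟩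
  let a : Matrix ι ι ℂ := fun i j => χ (x (i, j))
  let b : Matrix ι ι ℂ := fun i j => χ (y (i, j))
  have hab : a * b = 1 := by
    ext i j
    have : ∑ k, x (i, k) * y (k, j) = algebraMap ℂ _ ((1 : Matrix ι ι ℂ) i j) := by
      refine Subtype.ext (_root_.funext fun g => ?_)
      have := congrFun (congrFun (map_mul ρ g g⁻¹) i) j
      simpa [x, y, Matrix.mul_apply, Finset.sum_apply] using this.symm
    have := congrArg χ this
    rw [map_sum, AlgHom.commutes] at this
    simp only [map_mul] at this
    exact (Matrix.mul_apply ..).trans this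
  obtain ⟨g, hg⟩ := h a b hab fun p hp => by
    have h0 : aeval x p = 0 := Subtype.ext (_root_.funext fun g => by
      rw [← evalAt_apply, comp_aeval_apply]
      exact hP p hp g)
    have := congrArg χ h0
    rwa [comp_aeval_apply, map_zero] at this
  have hb : b = ρ g⁻¹ := by
    have h1 : ρ g⁻¹ * ρ g = 1 := by rw [← map_mul]; simp
    rw [hg] at h1
    exact (left_inv_eq_right_inv h1 hab).symm
  refine ⟨g, AlgHom.ext fun f => ?_⟩
  obtain ⟨f, hf⟩ := f
  rw [evalAt_apply]
  induction hf using Algebra.adjoin_induction with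
  | mem f hf' =>
    obtain ⟨ij, rfl⟩ | ⟨ij, rfl⟩ := hf'
    · exact (congrFun (congrFun hg ij.1) ij.2).symm
    · exact congrFun (congrFun hb ij.1) ij.2
  | algebraMap c => exact χ.commutes c
  | add f g hf hg h1 h2 =>
    exact (map_add χ ⟨f, hf⟩ ⟨g, hg⟩).trans (congrArg₂ _ h1 h2)
  | mul f g hf hg h1 h2 =>
    exact (map_mul χ ⟨f, hf⟩ ⟨g, hg⟩).trans (congrArg₂ _ h1 h2)

end CoordRing

section IdentityComponent

variable {Γ : Type*} [Group Γ] {ι : Type*} [Fintype ι] [DecidableEq ι]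
  {ρ : Γ →* Matrix ι ι ℂ}

theorem comap_leftTranslate_mem_minimalPrimes (a : Γ) {P : Ideal (coordRing ρ)}
    (hP : P ∈ minimalPrimes (coordRing ρ)) :
    P.comap (leftTranslate ρ a) ∈ minimalPrimes (coordRing ρ) := by
  have := hP.1.1
  refine ⟨⟨inferInstance, bot_le⟩, fun Q hQ hle f hf => ?_⟩
  have := hQ.1
  have h1 : P ≤ Q.comap (leftTranslate ρ a⁻¹) :=
    hP.2 ⟨inferInstance, bot_le⟩ fun g hg => by
      have := hle hg
      rwa [Ideal.mem_comap, leftTranslate_leftTranslate_inv] at this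
  have h2 := h1 hf
  have h3 := leftTranslate_leftTranslate_inv ρ a⁻¹ f
  rw [inv_inv] at h3
  rwa [Ideal.mem_comap, h3] at h2

theorem exists_mem_minimalPrimes_forall_apply_eq_zero (g : Γ) :
    ∃ P ∈ minimalPrimes (coordRing ρ), ∀ f ∈ P, f.1 g = 0 := by
  have : (RingHom.ker (evalAt ρ g)).IsPrime := RingHom.ker_isPrime _
  obtain ⟨P, hP, hle⟩ := Ideal.exists_minimalPrimes_le (bot_le : ⊥ ≤ RingHom.ker (evalAt ρ g))
  exact ⟨P, hP, fun f hf => hle hf⟩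

theorem comap_leftTranslate_apply_eq_zero {P : Ideal (coordRing ρ)} {a g : Γ}
    (h : ∀ f ∈ P, f.1 g = 0) : ∀ f ∈ P.comap (leftTranslate ρ a), f.1 (a * g) = 0 :=
  fun _ hf => h _ hf

theorem HasPoints.exists_apply_ne_zero (hρ : HasPoints ρ) {P : Ideal (coordRing ρ)}
    (hP : P.IsPrime) {f : coordRing ρ} (hf : f ∉ P) : ∃ g, (∀ a ∈ P, a.1 g = 0) ∧ f.1 g ≠ 0 := by
  by_contra! h
  exact hf (hρ.mem_of_forall hP.isRadical h)

theorem HasPoints.minimalPrimes_unique (hρ : HasPoints ρ) {g : Γ} {P Q : Ideal (coordRing ρ)}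
    (hP : P ∈ minimalPrimes (coordRing ρ)) (hQ : Q ∈ minimalPrimes (coordRing ρ))
    (hPg : ∀ f ∈ P, f.1 g = 0) (hQg : ∀ f ∈ Q, f.1 g = 0) : P = Q := by
  classical
  have hfin := minimalPrimes.finite_of_isNoetherianRing (coordRing ρ)
  have hPp := hP.1.1
  have h1 : ¬ (hfin.toFinset.erase P).inf id ≤ P := by
    rw [Ideal.IsPrime.inf_le' hPp]
    rintro ⟨R, hR, hle⟩
    simp only [Finset.mem_erase, Set.Finite.mem_toFinset] at hR
    exact hR.1 (le_antisymm hle (hP.2 hR.2.1 hle))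
  obtain ⟨f, hf, hfP⟩ := Set.not_subset.1 h1
  obtain ⟨g₀, hg₀, hfg₀⟩ := hρ.exists_apply_ne_zero hPp hfP
  have key : ∀ R ∈ minimalPrimes (coordRing ρ), (∀ a ∈ R, a.1 g₀ = 0) → R = P := by
    intro R hR hRg
    by_contra hne
    refine hfg₀ (hRg f ?_)
    exact (Finset.inf_le (f := id) (by simp [hne, hR]) : _ ≤ R) hf
  have e1 := key _ (comap_leftTranslate_mem_minimalPrimes (g₀ * g⁻¹) hP)
    (by simpa using comap_leftTranslate_apply_eq_zero (a := g₀ * g⁻¹) hPg)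
  have e2 := key _ (comap_leftTranslate_mem_minimalPrimes (g₀ * g⁻¹) hQ)
    (by simpa using comap_leftTranslate_apply_eq_zero (a := g₀ * g⁻¹) hQg)
  have hinj : Function.Injective (Ideal.comap (leftTranslate ρ (g₀ * g⁻¹))) :=
    Ideal.comap_injective_of_surjective _ fun f => ⟨_, leftTranslate_leftTranslate_inv ρ _ f⟩
  exact hinj (e1.trans e2.symm)

/-- The subgroup cut out by a minimal prime of the coordinate ring vanishing at `1`. -/
def HasPoints.component {ρ : Γ →* Matrix ι ι ℂ} (hρ : HasPoints ρ) (P : Ideal (coordRing ρ))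
    (hP : P ∈ minimalPrimes (coordRing ρ)) (hP1 : ∀ f ∈ P, f.1 1 = 0) : Subgroup Γ :=
  have key : ∀ a, (∀ f ∈ P, f.1 a = 0) → P.comap (leftTranslate ρ a) = P := fun a ha =>
    hρ.minimalPrimes_unique (g := a) (comap_leftTranslate_mem_minimalPrimes a hP) hP
      (by simpa using comap_leftTranslate_apply_eq_zero (a := a) hP1) ha
  { carrier := {g | ∀ f ∈ P, f.1 g = 0}
    one_mem' := hP1
    mul_mem' := fun {a b} ha hb f hf => by
      rw [← key a ha] at hf
      exact hb _ hf
    inv_mem' := fun {a} ha f hf => by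
      have : leftTranslate ρ a⁻¹ f ∈ P.comap (leftTranslate ρ a) := by
        rwa [Ideal.mem_comap, leftTranslate_leftTranslate_inv]
      rw [key a ha] at this
      exact (congrArg f.1 (mul_one a⁻¹)).symm.trans (hP1 _ this) }

/-- Restriction of functions to a subgroup. -/
def restrictHom (ρ : Γ →* Matrix ι ι ℂ) (H : Subgroup Γ) :
    coordRing ρ →ₐ[ℂ] coordRing (ρ.comp H.subtype) where
  toFun f := ⟨f.1 ∘ H.subtype, comp_mem_coordRing H.subtype
    (entry_mem_coordRing (ρ.comp H.subtype)) (entry_inv_mem_coordRing (ρ.comp H.subtype)) f.2⟩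
  map_one' := rfl
  map_mul' _ _ := rfl
  map_zero' := rfl
  map_add' _ _ := rfl
  commutes' _ := rfl

theorem restrictHom_surjective (H : Subgroup Γ) : Function.Surjective (restrictHom ρ H) := by
  rintro ⟨f, hf⟩
  suffices ∃ g ∈ coordRing ρ, g ∘ H.subtype = f by
    obtain ⟨g, hg, rfl⟩ := this
    exact ⟨⟨g, hg⟩, rfl⟩
  refine coordRing_induction (p := fun f => ∃ g ∈ coordRing ρ, g ∘ H.subtype = f)
    (fun i j => ⟨_, entry_mem_coordRing ρ i j, rfl⟩)
    (fun i j => ⟨_, entry_inv_mem_coordRing ρ i j, rfl⟩)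
    (fun c => ⟨_, (coordRing ρ).algebraMap_mem c, rfl⟩) ?_ ?_ hf
  · rintro _ _ ⟨f, hf, rfl⟩ ⟨g, hg, rfl⟩
    exact ⟨f + g, add_mem hf hg, rfl⟩
  · rintro _ _ ⟨f, hf, rfl⟩ ⟨g, hg, rfl⟩
    exact ⟨f * g, mul_mem hf hg, rfl⟩

theorem HasPoints.exists_irreducible_subgroup (hρ : HasPoints ρ) : ∃ H : Subgroup Γ,
    HasPoints (ρ.comp H.subtype) ∧ IsDomain (coordRing (ρ.comp H.subtype)) ∧
      ∃ T : Set Γ, T.Finite ∧ ∀ g, ∃ t ∈ T, ∃ h ∈ H, g = h * t := by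
  obtain ⟨P, hP, hP1⟩ := exists_mem_minimalPrimes_forall_apply_eq_zero (ρ := ρ) 1
  have hPp := hP.1.1
  let H := hρ.component P hP hP1
  have hker : ∀ f, restrictHom ρ H f = 0 ↔ f ∈ P := fun f => by
    refine ⟨fun h => hρ.mem_of_forall hPp.isRadical fun g hg => ?_, fun h => ?_⟩
    · exact congrFun (congrArg Subtype.val h) ⟨g, hg⟩
    · exact Subtype.ext (_root_.funext fun g => g.2 f h)
  refine ⟨H, fun χ => ?_, ?_, ?_⟩
  · obtain ⟨g, hg⟩ := hρ (χ.comp (restrictHom ρ H))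
    refine ⟨⟨g, fun f hf => ?_⟩, AlgHom.ext fun f => ?_⟩
    · rw [← evalAt_apply, ← hg, AlgHom.comp_apply, (hker f).2 hf, map_zero]
    · obtain ⟨f, rfl⟩ := restrictHom_surjective H f
      exact DFunLike.congr_fun hg f
  · have : RingHom.ker (restrictHom ρ H) = P := Ideal.ext hker
    have hq : (RingHom.ker (restrictHom ρ H)).IsPrime := this ▸ hPp
    exact (Ideal.quotientKerAlgEquivOfSurjective
      (restrictHom_surjective (ρ := ρ) H)).toMulEquiv.symm.isDomain _
  · have hne : ∀ Q : minimalPrimes (coordRing ρ), ∃ g, ∀ f ∈ Q.1, f.1 g = 0 := fun Q => by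
      obtain ⟨g, hg, -⟩ := hρ.exists_apply_ne_zero Q.2.1.1 (f := 1)
        ((Ideal.ne_top_iff_one _).1 Q.2.1.1.ne_top)
      exact ⟨g, hg⟩
    choose x hx using hne
    have hfin := (minimalPrimes.finite_of_isNoetherianRing (coordRing ρ)).to_subtype
    refine ⟨Set.range fun Q => (x Q)⁻¹, Set.finite_range _, fun g => ?_⟩
    obtain ⟨Q, hQ, hQg⟩ := exists_mem_minimalPrimes_forall_apply_eq_zero (ρ := ρ) g⁻¹
    refine ⟨_, ⟨⟨Q, hQ⟩, rfl⟩, ((x ⟨Q, hQ⟩)⁻¹ * g⁻¹)⁻¹, H.inv_mem ?_, by simp⟩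
    intro f hf
    have e : P.comap (leftTranslate ρ (x ⟨Q, hQ⟩)) = Q :=
      hρ.minimalPrimes_unique (g := x ⟨Q, hQ⟩) (comap_leftTranslate_mem_minimalPrimes _ hP) hQ
        (by simpa using comap_leftTranslate_apply_eq_zero (a := x ⟨Q, hQ⟩) hP1) (hx ⟨Q, hQ⟩)
    have : leftTranslate ρ (x ⟨Q, hQ⟩)⁻¹ f ∈ Q := by
      refine e.le ?_
      rwa [Ideal.mem_comap, leftTranslate_leftTranslate_inv]
    exact hQg _ this

end IdentityComponent

section Orbits

variable {Γ : Type*} [Group Γ] {ι : Type*} [Fintype ι] [DecidableEq ι]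
  {ρ : Γ →* Matrix ι ι ℂ}

/-- The linear substitution in polynomials given by a matrix. -/
def linearSubst (M : Matrix ι ι ℂ) : MvPolynomial ι ℂ →ₐ[ℂ] MvPolynomial ι ℂ :=
  aeval fun i => ∑ j, C (M i j) * X j

omit [DecidableEq ι] in
theorem eval_linearSubst (M : Matrix ι ι ℂ) (p : MvPolynomial ι ℂ) (v : ι → ℂ) :
    eval v (linearSubst M p) = eval (M.mulVec v) p := by
  have := comp_aeval_apply (fun i => ∑ j, C (M i j) * X j) (aeval v : MvPolynomial ι ℂ →ₐ[ℂ] ℂ) p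
  rw [← coe_aeval_eq_eval, ← coe_aeval_eq_eval]
  refine this.trans (congrArg (fun u => aeval u p) (funext fun i => ?_))
  simp [Matrix.mulVec, dotProduct]

omit [Fintype ι] [DecidableEq ι] in
theorem eq_of_forall_eval_eq {v w : ι → ℂ} (h : ∀ p : MvPolynomial ι ℂ, eval v p = eval w p) :
    v = w :=
  funext fun i => by simpa using h (X i)

theorem mulVec_inv_mulVec (g : Γ) (v : ι → ℂ) : (ρ g⁻¹).mulVec ((ρ g).mulVec v) = v := by
  rw [Matrix.mulVec_mulVec, ← map_mul, inv_mul_cancel, map_one, Matrix.one_mulVec]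

theorem HasPoints.isAlgebraic_orbitMap_range (hρ : HasPoints ρ) [IsDomain (coordRing ρ)]
    {w : ι → ℂ} (hfin : {g | (ρ g).mulVec w = w}.Finite) (x : coordRing ρ) :
    IsAlgebraic (orbitMap ρ w).range x := by
  classical
  refine isAlgebraic_of_forall_algHom x
    (hfin.toFinset.image fun h => ⟨x.1 ∘ (· * h), mulRight_mem_coordRing ρ h x.2⟩) fun χ ψ h => ?_
  obtain ⟨a, rfl⟩ := hρ χ
  obtain ⟨b, rfl⟩ := hρ ψ
  have hab : (ρ a).mulVec w = (ρ b).mulVec w := eq_of_forall_eval_eq fun p => by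
    rw [← orbitMap_apply, ← orbitMap_apply]
    exact h ⟨orbitMap ρ w p, p, rfl⟩
  refine ⟨_, Finset.mem_image_of_mem _ (a := a⁻¹ * b) ?_, ?_⟩
  · rw [Set.Finite.mem_toFinset]
    change (ρ (a⁻¹ * b)).mulVec w = w
    rw [map_mul, ← Matrix.mulVec_mulVec, ← hab, mulVec_inv_mulVec]
  · exact congrArg x.1 (mul_inv_cancel_left a b)

theorem HasPoints.exists_mulVec_eq_of_isDomain (hρ : HasPoints ρ) [IsDomain (coordRing ρ)]
    {v w : ι → ℂ} (hfin : {g | (ρ g).mulVec w = w}.Finite)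
    (hcl : ∀ p : MvPolynomial ι ℂ, (∀ g, eval ((ρ g).mulVec v) p = 0) → eval w p = 0) :
    ∃ g, (ρ g).mulVec v = w := by
  have hle : RingHom.ker (orbitMap ρ v) ≤ RingHom.ker (orbitMap ρ w) := fun p hp => by
    rw [mem_ker_orbitMap] at hp ⊢
    intro g
    rw [← eval_linearSubst]
    refine hcl _ fun h => ?_
    rw [eval_linearSubst, Matrix.mulVec_mulVec, ← map_mul]
    exact hp _
  obtain ⟨χ, ψ, h⟩ := exists_algHom_comp_eq _ _
    (ker_eq_of_ker_le_of_isAlgebraic _ _ hle (hρ.isAlgebraic_orbitMap_range hfin))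
  obtain ⟨a, rfl⟩ := hρ χ
  obtain ⟨b, rfl⟩ := hρ ψ
  have hab : (ρ a).mulVec v = (ρ b).mulVec w := eq_of_forall_eval_eq fun p => by
    rw [← orbitMap_apply, ← orbitMap_apply]
    exact h p
  refine ⟨b⁻¹ * a, ?_⟩
  rw [map_mul, ← Matrix.mulVec_mulVec, hab, mulVec_inv_mulVec]

/-- A point with finite isotropy group in the closure of an orbit lies on that orbit. -/
theorem HasPoints.exists_mulVec_eq (hρ : HasPoints ρ)
    {v w : ι → ℂ} (hfin : {g | (ρ g).mulVec w = w}.Finite)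
    (hcl : ∀ p : MvPolynomial ι ℂ, (∀ g, eval ((ρ g).mulVec v) p = 0) → eval w p = 0) :
    ∃ g, (ρ g).mulVec v = w := by
  obtain ⟨H, hH, hdom, T, hT, hcov⟩ := hρ.exists_irreducible_subgroup
  suffices ∃ t ∈ T, ∀ p : MvPolynomial ι ℂ,
      (∀ g : H, eval ((ρ g).mulVec ((ρ t).mulVec v)) p = 0) → eval w p = 0 by
    obtain ⟨t, -, ht⟩ := this
    obtain ⟨g, hg⟩ := hH.exists_mulVec_eq_of_isDomain (v := (ρ t).mulVec v) (w := w)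
      (hfin.preimage Subtype.val_injective.injOn) ht
    refine ⟨g * t, ?_⟩
    rw [map_mul, ← Matrix.mulVec_mulVec]
    exact hg
  by_contra! hcon
  choose! p hp hpw using hcon
  refine Finset.prod_ne_zero_iff.2 (fun t ht => hpw t (hT.mem_toFinset.1 ht)) ?_
  rw [← map_prod]
  refine hcl _ fun g => ?_
  obtain ⟨t, ht, h, hh, rfl⟩ := hcov g
  rw [map_prod]
  refine Finset.prod_eq_zero (hT.mem_toFinset.2 ht) ?_
  have := hp t ht ⟨h, hh⟩
  rwa [Matrix.mulVec_mulVec, ← map_mul] at this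

end Orbits

theorem isNilpotent_tmul_sub {B R : Type*} [CommRing B] [CommRing R] [Algebra ℂ B]
    [Algebra ℂ R] [Algebra B R] [IsScalarTower ℂ B R] [Algebra.FiniteType ℂ R] (x : R)
    (h : ∀ χ ψ : R →ₐ[ℂ] ℂ, (∀ b, χ (algebraMap B R b) = ψ (algebraMap B R b)) → χ x = ψ x) :
    IsNilpotent (x ⊗ₜ[B] (1 : R) - 1 ⊗ₜ x) := by
  have := finiteType_tensorProduct B R R
  refine isNilpotent_of_forall_algHom (R := R ⊗[B] R) _ fun χ => ?_
  rw [map_sub, sub_eq_zero]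
  exact h (χ.comp Algebra.TensorProduct.includeLeft)
    (χ.comp (Algebra.TensorProduct.includeRight.restrictScalars ℂ))
    fun b => congrArg χ (Algebra.TensorProduct.tmul_one_eq_one_tmul b)

theorem exists_forall_mem_span_mul_mem_range {A R : Type*} [CommRing A] [CommRing R] [Algebra ℂ A]
    [Algebra ℂ R] [Algebra.FiniteType ℂ R] [Nontrivial R] [IsReduced R] (f : A →ₐ[ℂ] R) {T : Set R}
    (hfin : T.Finite) (h : ∀ χ ψ : R →ₐ[ℂ] ℂ, (∀ a, χ (f a) = ψ (f a)) → χ = ψ) :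
    ∃ a, f a ≠ 0 ∧ ∀ x ∈ Submodule.span ℂ T, f a * x ∈ f.range := by
  have : IsReduced f.range := isReduced_of_injective f.range.val Subtype.val_injective
  obtain ⟨p, hp⟩ : (minimalPrimes f.range).Nonempty :=
    Set.nonempty_coe_sort.1 (Ideal.nonempty_minimalPrimes (bot_ne_top (α := Ideal f.range)))
  have hpp : p.IsPrime := hp.1.1
  choose s hs hsx using fun x => exists_notMem_mul_mem_range p hp x
    (isNilpotent_tmul_sub x fun χ ψ hχ =>
      DFunLike.congr_fun (h χ ψ fun a => hχ ⟨f a, a, rfl⟩) x)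
  obtain ⟨a, ha⟩ := (∏ x ∈ hfin.toFinset, s x).2
  replace ha : f a = ((∏ x ∈ hfin.toFinset, s x : f.range) : R) := ha
  refine ⟨a, fun h => ?_, fun x hx => ?_⟩
  · have h0 : ∏ x ∈ hfin.toFinset, s x = 0 := Subtype.ext (ha.symm.trans h)
    have : ∏ x ∈ hfin.toFinset, s x ∈ p := h0 ▸ p.zero_mem
    obtain ⟨x, -, hx⟩ := hpp.prod_mem_iff.1 this
    exact hs x hx
  · induction hx using Submodule.span_induction with
    | zero => rw [mul_zero]; exact zero_mem _
    | add x y _ _ hx hy => rw [mul_add]; exact add_mem hx hy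
    | smul c x _ hx => rw [mul_smul_comm]; exact Subalgebra.smul_mem _ hx c
    | mem x hx =>
      classical
      rw [ha, ← Finset.prod_erase_mul _ _ (hfin.mem_toFinset.2 hx), MulMemClass.coe_mul, mul_assoc]
      obtain ⟨b, hb⟩ := hsx x
      exact mul_mem (SetLike.coe_mem _) (hb ▸ b.2)

section FreeOrbits

variable {Γ : Type*} [Group Γ] {ι : Type*} [Fintype ι] [DecidableEq ι]
  {ρ : Γ →* Matrix ι ι ℂ}

instance : IsReduced (coordRing ρ) :=
  isReduced_of_injective (coordRing ρ).val Subtype.val_injective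

theorem leftTranslate_orbitMap (g : Γ) (y : ι → ℂ) (p : MvPolynomial ι ℂ) :
    leftTranslate ρ g (orbitMap ρ y p) = orbitMap ρ y (linearSubst (ρ g) p) := by
  refine Subtype.ext (_root_.funext fun h => ?_)
  change (orbitMap ρ y p).1 (g * h) = _
  rw [orbitMap_apply, orbitMap_apply, eval_linearSubst, Matrix.mulVec_mulVec, map_mul]

variable (ρ) in
/-- The generators of the coordinate ring. -/
def coordGenerators : Set (coordRing ρ) :=
  Set.range (fun ij : ι × ι => ⟨_, entry_mem_coordRing ρ ij.1 ij.2⟩) ∪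
    Set.range (fun ij : ι × ι => ⟨_, entry_inv_mem_coordRing ρ ij.1 ij.2⟩)

variable (ρ) in
theorem coordGenerators_finite : (coordGenerators ρ).Finite :=
  (Set.finite_range _).union (Set.finite_range _)

theorem leftTranslate_mem_span_coordGenerators (a : Γ) {x : coordRing ρ}
    (hx : x ∈ Submodule.span ℂ (coordGenerators ρ)) :
    leftTranslate ρ a x ∈ Submodule.span ℂ (coordGenerators ρ) := by
  induction hx using Submodule.span_induction with
  | zero => rw [map_zero]; exact zero_mem _
  | add x y _ _ hx hy => rw [map_add]; exact add_mem hx hy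
  | smul c x _ hx => rw [map_smul]; exact Submodule.smul_mem _ c hx
  | mem x hx =>
    obtain ⟨⟨i, j⟩, rfl⟩ | ⟨⟨i, j⟩, rfl⟩ := hx
    · have hmem (k) : (⟨_, entry_mem_coordRing ρ k j⟩ : coordRing ρ) ∈
          Submodule.span ℂ (coordGenerators ρ) := Submodule.subset_span (Or.inl ⟨(k, j), rfl⟩)
      convert sum_mem fun k (_ : k ∈ Finset.univ) => Submodule.smul_mem _ (ρ a i k) (hmem k) using 1
      refine Subtype.ext (_root_.funext fun g => ?_)
      change ρ (a * g) i j = _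
      simp [Matrix.mul_apply]
    · have hmem (k) : (⟨_, entry_inv_mem_coordRing ρ i k⟩ : coordRing ρ) ∈
          Submodule.span ℂ (coordGenerators ρ) := Submodule.subset_span (Or.inr ⟨(i, k), rfl⟩)
      convert sum_mem fun k (_ : k ∈ Finset.univ) => Submodule.smul_mem _ (ρ a⁻¹ k j) (hmem k)
        using 1
      refine Subtype.ext (_root_.funext fun g => ?_)
      change ρ (a * g)⁻¹ i j = _
      simp [Matrix.mul_apply, mul_comm]

theorem coordRing_subalgebra_eq_top (S : Subalgebra ℂ (coordRing ρ))
    (h : ∀ x ∈ coordGenerators ρ, x ∈ S) : S = ⊤ := by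
  refine eq_top_iff.2 fun f _ => ?_
  suffices ∃ x ∈ S, x.1 = f.1 by
    obtain ⟨x, hx, hxf⟩ := this
    rwa [← Subtype.ext hxf]
  refine coordRing_induction (p := fun f => ∃ x ∈ S, x.1 = f)
    (fun i j => ⟨_, h _ (Or.inl ⟨(i, j), rfl⟩), rfl⟩)
    (fun i j => ⟨_, h _ (Or.inr ⟨(i, j), rfl⟩), rfl⟩)
    (fun c => ⟨_, S.algebraMap_mem c, rfl⟩) ?_ ?_ f.2
  · rintro _ _ ⟨f, hf, rfl⟩ ⟨g, hg, rfl⟩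
    exact ⟨f + g, add_mem hf hg, rfl⟩
  · rintro _ _ ⟨f, hf, rfl⟩ ⟨g, hg, rfl⟩
    exact ⟨f * g, mul_mem hf hg, rfl⟩

/-- The ideal of denominators of the orbit map. -/
def orbitConductor (ρ : Γ →* Matrix ι ι ℂ) (y : ι → ℂ) : Ideal (MvPolynomial ι ℂ) where
  carrier := {a | ∀ x ∈ Submodule.span ℂ (coordGenerators ρ),
    orbitMap ρ y a * x ∈ (orbitMap ρ y).range}
  zero_mem' x _ := by rw [map_zero, zero_mul]; exact zero_mem _
  add_mem' ha hb x hx := by rw [map_add, add_mul]; exact add_mem (ha x hx) (hb x hx)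
  smul_mem' c a ha x hx := by
    rw [smul_eq_mul, map_mul, mul_assoc]
    exact mul_mem ⟨c, rfl⟩ (ha x hx)

theorem linearSubst_mem_orbitConductor {y : ι → ℂ} (g : Γ) {a : MvPolynomial ι ℂ}
    (ha : a ∈ orbitConductor ρ y) : linearSubst (ρ g) a ∈ orbitConductor ρ y := by
  intro x hx
  obtain ⟨p, hp⟩ := ha _ (leftTranslate_mem_span_coordGenerators g⁻¹ hx)
  refine ⟨linearSubst (ρ g) p, ?_⟩
  have := congrArg (leftTranslate ρ g) hp
  rw [map_mul, leftTranslate_leftTranslate_inv, leftTranslate_orbitMap] at this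
  rw [← this]
  exact (leftTranslate_orbitMap g y p).symm

theorem HasPoints.exists_mem_orbitConductor (hρ : HasPoints ρ) {y : ι → ℂ}
    (hfree : ∀ g, (ρ g).mulVec y = y → g = 1) :
    ∃ a ∈ orbitConductor ρ y, orbitMap ρ y a ≠ 0 := by
  have : Nontrivial (coordRing ρ) := (evalAt ρ 1).toRingHom.domain_nontrivial
  obtain ⟨a, ha, h⟩ := exists_forall_mem_span_mul_mem_range (orbitMap ρ y)
    (coordGenerators_finite ρ) fun χ ψ h => by
      obtain ⟨a, rfl⟩ := hρ χ
      obtain ⟨b, rfl⟩ := hρ ψ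
      have hab : (ρ a).mulVec y = (ρ b).mulVec y := eq_of_forall_eval_eq fun p => by
        rw [← orbitMap_apply, ← orbitMap_apply]
        exact h p
      have hba : b⁻¹ * a = 1 := hfree _ (by
        rw [map_mul, ← Matrix.mulVec_mulVec, hab, mulVec_inv_mulVec])
      rw [inv_mul_eq_one.1 hba]
  exact ⟨a, h, ha⟩

/-- The orbit map of a closed orbit with trivial isotropy group is a closed embedding. -/
theorem HasPoints.orbitMap_surjective (hρ : HasPoints ρ) {y : ι → ℂ}
    (hfree : ∀ g, (ρ g).mulVec y = y → g = 1)
    (hcl : ∀ w, (∀ p : MvPolynomial ι ℂ, (∀ g, eval ((ρ g).mulVec y) p = 0) → eval w p = 0) →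
      ∃ g, (ρ g).mulVec y = w) : Function.Surjective (orbitMap ρ y) := by
  suffices h : orbitConductor ρ y = ⊤ by
    rw [← AlgHom.range_eq_top]
    refine coordRing_subalgebra_eq_top _ fun x hx => ?_
    have := ((Ideal.eq_top_iff_one _).1 h) x (Submodule.subset_span hx)
    rwa [map_one, one_mul] at this
  by_contra hne
  obtain ⟨m, hm, hle⟩ := Ideal.exists_le_maximal _ hne
  obtain ⟨χ, rfl⟩ := exists_algHom_ker_eq m
  have hχ : ∀ p, χ p = eval (fun i => χ (X i)) p := fun p =>
    DFunLike.congr_fun (aeval_unique χ) p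
  obtain ⟨g, hg⟩ := hcl (fun i => χ (X i)) fun p hp => by
    rw [← hχ]
    refine hle fun x _ => ?_
    rw [RingHom.mem_ker.1 ((mem_ker_orbitMap ρ).2 hp), zero_mul]
    exact zero_mem _
  obtain ⟨a, ha, ha0⟩ := hρ.exists_mem_orbitConductor hfree
  refine ha0 ((mem_ker_orbitMap ρ).2 fun h => ?_)
  have := hle (linearSubst_mem_orbitConductor (h * g⁻¹) ha)
  rwa [RingHom.mem_ker, hχ, eval_linearSubst, ← hg, Matrix.mulVec_mulVec, ← map_mul,
    inv_mul_cancel_right] at this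

end FreeOrbits

section Reynolds

variable {Γ : Type*} [Group Γ] {ι : Type*} [Fintype ι] [DecidableEq ι]
  {ρ : Γ →* Matrix ι ι ℂ}

/-- A normalized linear functional on the coordinate ring which is invariant under right
translation by a Zariski dense set `K`. -/
structure IsInvariantMean (ρ : Γ →* Matrix ι ι ℂ) (K : Set Γ) (L : coordRing ρ →ₗ[ℂ] ℂ) : Prop where
  apply_one : L 1 = 1
  invariant : ∀ k ∈ K, ∀ f f' : coordRing ρ, (∀ g, f'.1 g = f.1 (g * k)) → L f' = L f
  dense : ∀ f : coordRing ρ, (∀ k ∈ K, f.1 k = 0) → f = 0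

omit [Fintype ι] [DecidableEq ι] in
theorem exists_eval_eq_map {A : Type*} [CommRing A] [Algebra ℂ A] (L : A →ₗ[ℂ] ℂ)
    (Q : MvPolynomial ι A) : ∃ q : MvPolynomial ι ℂ, ∀ v,
      eval v q = L (eval (fun i => algebraMap ℂ A (v i)) Q) := by
  refine ⟨∑ m ∈ Q.support, monomial m (L (coeff m Q)), fun v => ?_⟩
  rw [map_sum, eval_eq _ Q, map_sum]
  refine Finset.sum_congr rfl fun m _ => ?_
  simp_rw [eval_monomial, Finsupp.prod, ← map_pow, ← map_prod]
  rw [mul_comm (coeff m Q), ← Algebra.smul_def, map_smul, smul_eq_mul, mul_comm]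

variable (ρ) in
/-- The polynomial `v ↦ p (g v)` with coefficients in the coordinate ring. -/
def actionPoly : MvPolynomial ι ℂ →ₐ[ℂ] MvPolynomial ι (coordRing ρ) :=
  aeval fun i => ∑ j, C ⟨_, entry_mem_coordRing ρ i j⟩ * X j

theorem eval_actionPoly (v : ι → ℂ) (p : MvPolynomial ι ℂ) :
    eval (fun i => algebraMap ℂ (coordRing ρ) (v i)) (actionPoly ρ p) = orbitMap ρ v p := by
  refine Subtype.ext (_root_.funext fun g => ?_)
  rw [orbitMap_apply]
  induction p using MvPolynomial.induction_on with
  | C a => simp [actionPoly, MvPolynomial.algebraMap_apply]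
  | add p q hp hq => simp [hp, hq]
  | mul_X p i hp =>
    simp only [map_mul, MulMemClass.coe_mul, Pi.mul_apply, hp, eval_X]
    congr 1
    simp [actionPoly, Matrix.mulVec, dotProduct]

theorem map_actionPoly (g : Γ) (p : MvPolynomial ι ℂ) :
    map (evalAt ρ g : coordRing ρ →+* ℂ) (actionPoly ρ p) = linearSubst (ρ g) p := by
  induction p using MvPolynomial.induction_on with
  | C a => simp [actionPoly, linearSubst, MvPolynomial.algebraMap_apply]
  | add p q hp hq => simp [hp, hq]
  | mul_X p i hp =>
    simp only [map_mul, hp]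
    congr 1
    simp [actionPoly, linearSubst, evalAt_apply]

theorem IsInvariantMean.exists_invariant {K : Set Γ} {L : coordRing ρ →ₗ[ℂ] ℂ}
    (hL : IsInvariantMean ρ K L) (p : MvPolynomial ι ℂ) : ∃ q : MvPolynomial ι ℂ,
      (∀ g v, eval ((ρ g).mulVec v) q = eval v q) ∧ ∀ v, eval v q = L (orbitMap ρ v p) := by
  obtain ⟨q, hq⟩ := exists_eval_eq_map L (actionPoly ρ p)
  simp_rw [eval_actionPoly] at hq
  refine ⟨q, fun g v => ?_, hq⟩
  have := hL.dense (orbitMap ρ v q - algebraMap ℂ _ (eval v q)) fun k hk => by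
    change (orbitMap ρ v q).1 k - eval v q = 0
    rw [orbitMap_apply, sub_eq_zero, hq, hq]
    refine hL.invariant k hk _ _ fun g => ?_
    rw [orbitMap_apply, orbitMap_apply, Matrix.mulVec_mulVec, map_mul]
  rw [← orbitMap_apply, sub_eq_zero.1 this]
  rfl

/-- Disjoint invariant Zariski closed sets, one of which is the closure of an orbit, are separated
by an invariant polynomial. -/
theorem IsInvariantMean.exists_separating {K : Set Γ} {L : coordRing ρ →ₗ[ℂ] ℂ}
    (hL : IsInvariantMean ρ K L) {Y : Set (ι → ℂ)}
    (hY : ∀ w, (∀ p : MvPolynomial ι ℂ, (∀ y ∈ Y, eval y p = 0) → eval w p = 0) → w ∈ Y)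
    (hst : ∀ g, ∀ y ∈ Y, (ρ g).mulVec y ∈ Y) {v : ι → ℂ}
    (hv : ∀ w ∈ Y, ∃ p : MvPolynomial ι ℂ, (∀ g, eval ((ρ g).mulVec v) p = 0) ∧ eval w p ≠ 0) :
    ∃ f : MvPolynomial ι ℂ, (∀ g v, eval ((ρ g).mulVec v) f = eval v f) ∧
      (∀ y ∈ Y, eval y f = 0) ∧ eval v f = 1 := by
  let I : Ideal (MvPolynomial ι ℂ) := ⨅ y ∈ Y, RingHom.ker (eval y)
  have hI (p) : p ∈ I ↔ ∀ y ∈ Y, eval y p = 0 := by simp [I]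
  have htop : I ⊔ RingHom.ker (orbitMap ρ v) = ⊤ := by
    by_contra hne
    obtain ⟨m, hm, hle⟩ := Ideal.exists_le_maximal _ hne
    obtain ⟨χ, rfl⟩ := exists_algHom_ker_eq m
    have hχ : ∀ p, χ p = eval (fun i => χ (X i)) p := fun p => DFunLike.congr_fun (aeval_unique χ) p
    obtain ⟨p, hp, hp0⟩ := hv (fun i => χ (X i)) <| hY _ fun p hp => by
      rw [← hχ]
      exact hle (Ideal.mem_sup_left ((hI p).2 hp))
    refine hp0 ?_
    rw [← hχ]
    exact hle (Ideal.mem_sup_right ((mem_ker_orbitMap ρ).2 hp))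
  obtain ⟨a, ha, b, hb, hab⟩ := Submodule.mem_sup.1 ((Ideal.eq_top_iff_one _).1 htop)
  obtain ⟨q, hq, hqv⟩ := hL.exists_invariant a
  refine ⟨q, hq, fun y hy => ?_, ?_⟩
  · rw [hqv, RingHom.mem_ker.1 ((mem_ker_orbitMap ρ).2 fun g => (hI a).1 ha _ (hst g y hy)),
      map_zero]
  · rw [hqv, eq_sub_of_add_eq hab, map_sub, RingHom.mem_ker.1 hb, sub_zero, map_one, hL.apply_one]

/-- A point which invariants do not separate from an invariant closed set with finite isotropy
groups belongs to this set. -/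
theorem IsInvariantMean.mem_of_forall_invariant (hρ : HasPoints ρ) {K : Set Γ}
    {L : coordRing ρ →ₗ[ℂ] ℂ} (hL : IsInvariantMean ρ K L) {Y : Set (ι → ℂ)}
    (hY : ∀ w, (∀ p : MvPolynomial ι ℂ, (∀ y ∈ Y, eval y p = 0) → eval w p = 0) → w ∈ Y)
    (hst : ∀ g, ∀ y ∈ Y, (ρ g).mulVec y ∈ Y)
    (hfin : ∀ y ∈ Y, {g | (ρ g).mulVec y = y}.Finite) {v : ι → ℂ}
    (hv : ∀ f : MvPolynomial ι ℂ, (∀ g v, eval ((ρ g).mulVec v) f = eval v f) →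
      (∀ y ∈ Y, eval y f = 0) → eval v f = 0) : v ∈ Y := by
  by_contra hvY
  obtain ⟨f, hf, hfY, hfv⟩ := hL.exists_separating (v := v) hY hst fun w hw => by
    by_contra! hcl
    obtain ⟨g, rfl⟩ := hρ.exists_mulVec_eq (v := v) (hfin w hw) hcl
    refine hvY ?_
    have := hst g⁻¹ _ hw
    rwa [mulVec_inv_mulVec] at this
  exact one_ne_zero (hfv.symm.trans (hv f hf hfY))

end Reynolds

section Reduced

variable {Γ : Type*} [Group Γ] {ι : Type*} [Fintype ι] [DecidableEq ι]
  {ρ : Γ →* Matrix ι ι ℂ}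

theorem exists_coordRing_apply_eq (l : MvPolynomial ι ℂ →ₗ[ℂ] ℂ) (p : MvPolynomial ι ℂ) :
    ∃ f : coordRing ρ, ∀ g, f.1 g = l (linearSubst (ρ g) p) := by
  refine ⟨∑ m ∈ (actionPoly ρ p).support, l (monomial m 1) • coeff m (actionPoly ρ p),
    fun g => ?_⟩
  rw [← map_actionPoly, ← evalAt_apply]
  conv_rhs => rw [as_sum (actionPoly ρ p)]
  rw [map_sum, map_sum, map_sum]
  refine Finset.sum_congr rfl fun m _ => ?_
  have h (c : ℂ) : monomial m c = c • monomial m 1 := by rw [smul_monomial, smul_eq_mul, mul_one]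
  rw [map_monomial, map_smul, h ((evalAt ρ g : coordRing ρ →+* ℂ) _), map_smul, smul_eq_mul,
    smul_eq_mul, mul_comm]
  rfl

omit [DecidableEq ι] in
theorem linearSubst_linearSubst (M N : Matrix ι ι ℂ) (p : MvPolynomial ι ℂ) :
    linearSubst N (linearSubst M p) = linearSubst (M * N) p :=
  MvPolynomial.funext fun v => by
    simp_rw [eval_linearSubst, Matrix.mulVec_mulVec]

theorem linearSubst_one (p : MvPolynomial ι ℂ) : linearSubst 1 p = p :=
  MvPolynomial.funext fun v => by rw [eval_linearSubst, Matrix.one_mulVec]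

omit [DecidableEq ι] in
theorem totalDegree_linearSubst_le (M : Matrix ι ι ℂ) (p : MvPolynomial ι ℂ) :
    (linearSubst M p).totalDegree ≤ p.totalDegree := by
  rw [linearSubst, aeval_def, eval₂_eq']
  refine totalDegree_finsetSum_le fun d hd => (totalDegree_mul _ _).trans ?_
  rw [algebraMap_eq, totalDegree_C, zero_add]
  refine (totalDegree_finsetProd _ _).trans ?_
  refine le_trans (Finset.sum_le_sum fun i _ => (totalDegree_pow _ _).trans
    (Nat.mul_le_mul_left (d i) (?_ : _ ≤ 1))) ?_
  · refine totalDegree_finsetSum_le fun j _ => (totalDegree_mul _ _).trans ?_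
    rw [totalDegree_C, totalDegree_X]
  · simp_rw [mul_one]
    rw [← Finsupp.degree_eq_sum]
    exact le_totalDegree hd

/-- A polynomial lies in a finite-dimensional invariant space of polynomials, on which the group
acts by a matrix representation with entries in the coordinate ring. -/
theorem exists_matrix_coefficients (I : Submodule ℂ (MvPolynomial ι ℂ))
    (hI : ∀ g, ∀ p ∈ I, linearSubst (ρ g) p ∈ I) {p : MvPolynomial ι ℂ} (hp : p ∈ I) :
    ∃ (m : ℕ) (b : Fin m → MvPolynomial ι ℂ) (s : Fin m → Fin m → coordRing ρ),
      (∀ j, b j ∈ I) ∧ p ∈ Submodule.span ℂ (Set.range b) ∧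
      (∀ g j, linearSubst (ρ g) (b j) = ∑ l, (s j l).1 g • b l) ∧
      ∀ g i l, ∑ j, (s i j).1 g⁻¹ * (s j l).1 g = (1 : Matrix (Fin m) (Fin m) ℂ) i l := by
  let W := I ⊓ restrictTotalDegree ι ℂ p.totalDegree
  have hW (g) : ∀ q ∈ W, linearSubst (ρ g) q ∈ W := fun q hq =>
    ⟨hI g q hq.1, (mem_restrictTotalDegree ..).2 ((totalDegree_linearSubst_le _ _).trans
      ((mem_restrictTotalDegree ..).1 hq.2))⟩
  have : Module.Finite ℂ (restrictTotalDegree ι ℂ p.totalDegree) := inferInstance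
  have : Module.Finite ℂ W := Submodule.finiteDimensional_of_le inf_le_right
  let b := Module.finBasis ℂ W
  have hl (l) := (b.coord l).exists_extend
  choose e he using hl
  have he' (l) (w : W) : e l w = b.repr w l := LinearMap.congr_fun (he l) w
  choose s hs using fun j l => exists_coordRing_apply_eq (ρ := ρ) (e l) (b j).1
  have hsum (g j) : linearSubst (ρ g) (b j).1 = ∑ l, (s j l).1 g • (b l).1 := by
    have := congrArg Subtype.val (b.sum_repr ⟨_, hW g _ (b j).2⟩)
    refine this.symm.trans ?_
    rw [AddSubmonoidClass.coe_finsetSum]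
    refine Finset.sum_congr rfl fun l _ => ?_
    rw [hs, he' l ⟨_, hW g _ (b j).2⟩]
    rfl
  refine ⟨_, fun j => (b j).1, s, fun j => (b j).2.1, ?_, hsum, fun g i l => ?_⟩
  · have hpW : p ∈ W := ⟨hp, (mem_restrictTotalDegree ..).2 le_rfl⟩
    have := congrArg Subtype.val (b.sum_repr ⟨p, hpW⟩)
    change _ = p at this
    rw [← this, AddSubmonoidClass.coe_finsetSum]
    exact sum_mem fun j _ => Submodule.smul_mem _ _ (Submodule.subset_span ⟨j, rfl⟩)
  · have h1 : linearSubst (ρ g) (linearSubst (ρ g⁻¹) (b i).1) = b i := by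
      rw [linearSubst_linearSubst, ← map_mul, inv_mul_cancel, map_one, linearSubst_one]
    rw [hsum] at h1
    have := congrArg (e l) h1
    simp only [map_sum, map_smul, ← hs, he', smul_eq_mul] at this
    rw [this, b.repr_self, Matrix.one_apply, Finsupp.single_apply]

theorem IsInvariantMean.exists_mul_mem {K : Set Γ} {L : coordRing ρ →ₗ[ℂ] ℂ}
    (hL : IsInvariantMean ρ K L) {Y : Set (ι → ℂ)} (hst : ∀ g, ∀ y ∈ Y, (ρ g).mulVec y ∈ Y)
    {y : ι → ℂ} (hy : Function.Surjective (orbitMap ρ y)) {J : Ideal (MvPolynomial ι ℂ)}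
    (hJ : ∀ f : MvPolynomial ι ℂ, (∀ g v, eval ((ρ g).mulVec v) f = eval v f) →
      (∀ y ∈ Y, eval y f = 0) → f ∈ J) {p : MvPolynomial ι ℂ} (hp : ∀ y ∈ Y, eval y p = 0) :
    ∃ d, eval y d = 1 ∧ d * p ∈ J := by
  let I : Submodule ℂ (MvPolynomial ι ℂ) := ⨅ y ∈ Y, LinearMap.ker (aeval y).toLinearMap
  have hI (p) : p ∈ I ↔ ∀ y ∈ Y, eval y p = 0 := by simp [I]
  obtain ⟨m, b, s, hb, hpb, hs, hinv⟩ := exists_matrix_coefficients (ρ := ρ) I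
    (fun g p hp => (hI _).2 fun y hy => by
      rw [eval_linearSubst]; exact (hI p).1 hp _ (hst g y hy)) ((hI p).2 hp)
  choose H hH using fun i j =>
    hy ⟨(s i j).1 ∘ (·⁻¹), inv_mem_coordRing ρ (s i j).2⟩
  have hH' (i j g) : (orbitMap ρ y (H i j)).1 g = (s i j).1 g⁻¹ := by rw [hH]; rfl
  choose q hq hqv using fun i => hL.exists_invariant (∑ j, H i j * b j)
  choose Ψ hΨ using fun i l => exists_eval_eq_map L (∑ j, actionPoly ρ (H i j) * C (s j l))
  have hΨ' (i l v) : eval v (Ψ i l) = L (∑ j, orbitMap ρ v (H i j) * s j l) := by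
    rw [hΨ, map_sum]
    simp [eval_actionPoly]
  have hob (v j) : orbitMap ρ v (b j) = ∑ l, eval v (b l) • s j l := by
    refine Subtype.ext (_root_.funext fun g => ?_)
    rw [orbitMap_apply, ← eval_linearSubst, hs, map_sum]
    simp [smul_eval, mul_comm]
  have hqΨ (i) : q i = ∑ l, Ψ i l * b l := by
    refine MvPolynomial.funext fun v => ?_
    have h (l) : eval v (Ψ i l * b l) =
        L (eval v (b l) • ∑ j, orbitMap ρ v (H i j) * s j l) := by
      rw [map_mul, hΨ', map_smul, smul_eq_mul, mul_comm]
    rw [hqv, map_sum (eval v), Finset.sum_congr rfl fun l _ => h l, ← map_sum,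
      map_sum (orbitMap ρ v)]
    simp only [map_mul, hob, Finset.mul_sum, Finset.smul_sum, mul_smul_comm]
    rw [Finset.sum_comm]
  have hqJ (i) : q i ∈ J := hJ _ (hq i) fun z hz => by
    rw [hqv, map_sum]
    refine (congrArg L (Finset.sum_eq_zero fun j _ => ?_)).trans (map_zero L)
    rw [map_mul, RingHom.mem_ker.1 ((mem_ker_orbitMap ρ).2 fun g => (hI _).1 (hb j) _ (hst g z hz)),
      mul_zero]
  have hone : (eval y).mapMatrix (Matrix.of Ψ) = 1 := by
    ext i l
    rw [RingHom.mapMatrix_apply, Matrix.map_apply, Matrix.of_apply, hΨ']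
    have : ∑ j, orbitMap ρ y (H i j) * s j l =
        ((1 : Matrix (Fin m) (Fin m) ℂ) i l) • (1 : coordRing ρ) := by
      refine Subtype.ext (_root_.funext fun g => ?_)
      have := hinv g i l
      simp only [← hH'] at this
      simpa using this
    rw [this, map_smul, hL.apply_one, smul_eq_mul, mul_one]
  refine ⟨(Matrix.of Ψ).det, by rw [RingHom.map_det, hone, Matrix.det_one], ?_⟩
  have hvec : (Matrix.of Ψ).mulVec b = q := _root_.funext fun i => (hqΨ i).symm
  have hdet (j) : (Matrix.of Ψ).det * b j ∈ J := by
    have : (Matrix.of Ψ).adjugate.mulVec q = (Matrix.of Ψ).det • b := by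
      rw [← hvec, Matrix.mulVec_mulVec, Matrix.adjugate_mul, Matrix.smul_mulVec, Matrix.one_mulVec]
    rw [← smul_eq_mul, ← Pi.smul_apply, ← this]
    exact sum_mem (t := Finset.univ) fun i _ => J.mul_mem_left _ (hqJ i)
  clear hp
  induction hpb using Submodule.span_induction with
  | zero => rw [mul_zero]; exact zero_mem _
  | add x y _ _ hx hy => rw [mul_add]; exact add_mem hx hy
  | smul c x _ hx => rw [mul_smul_comm]; exact Submodule.smul_of_tower_mem _ c hx
  | mem x hx => obtain ⟨j, rfl⟩ := hx; exact hdet j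

/-- A polynomial vanishing on a closed invariant set with trivial isotropy groups lies in the ideal
generated by the invariants vanishing on this set. -/
theorem IsInvariantMean.mem_ideal (hρ : HasPoints ρ) {K : Set Γ} {L : coordRing ρ →ₗ[ℂ] ℂ}
    (hL : IsInvariantMean ρ K L) {Y : Set (ι → ℂ)}
    (hY : ∀ w, (∀ p : MvPolynomial ι ℂ, (∀ y ∈ Y, eval y p = 0) → eval w p = 0) → w ∈ Y)
    (hst : ∀ g, ∀ y ∈ Y, (ρ g).mulVec y ∈ Y)
    (hfree : ∀ y ∈ Y, ∀ g, (ρ g).mulVec y = y → g = 1) {J : Ideal (MvPolynomial ι ℂ)}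
    (hJ : ∀ f : MvPolynomial ι ℂ, (∀ g v, eval ((ρ g).mulVec v) f = eval v f) →
      (∀ y ∈ Y, eval y f = 0) → f ∈ J) {p : MvPolynomial ι ℂ} (hp : ∀ y ∈ Y, eval y p = 0) :
    p ∈ J := by
  have hfin : ∀ y ∈ Y, {g | (ρ g).mulVec y = y}.Finite := fun y hy =>
    (Set.finite_singleton 1).subset fun g hg => hfree y hy g hg
  suffices h : J.colon {p} = ⊤ by
    have := (Ideal.eq_top_iff_one _).1 h
    simpa [Submodule.mem_colon_singleton] using this
  by_contra hne
  obtain ⟨m, hm, hle⟩ := Ideal.exists_le_maximal _ hne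
  obtain ⟨χ, rfl⟩ := exists_algHom_ker_eq m
  have hχ : ∀ p, χ p = eval (fun i => χ (X i)) p := fun p => DFunLike.congr_fun (aeval_unique χ) p
  have hw : (fun i => χ (X i)) ∈ Y := hL.mem_of_forall_invariant hρ hY hst hfin fun f hf hfY => by
    rw [← hχ]
    refine hle ?_
    rw [Submodule.mem_colon_singleton]
    exact J.mul_mem_right _ (hJ f hf hfY)
  obtain ⟨d, hd1, hd⟩ := hL.exists_mul_mem hst (hρ.orbitMap_surjective (hfree _ hw) fun w hcl =>
    hρ.exists_mulVec_eq (hfin w (hY w fun q hq => hcl q fun g => hq _ (hst g _ hw))) hcl) hJ hp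
  rw [← hχ] at hd1
  exact one_ne_zero (hd1.symm.trans (hle (Submodule.mem_colon_singleton.2 hd)))

end Reduced

section Haar

variable {Γ : Type*} [Group Γ] {ι : Type*} [Fintype ι] [DecidableEq ι]
  {ρ : Γ →* Matrix ι ι ℂ}

theorem continuous_coordRing_comp {K : Type*} [Group K] [TopologicalSpace K] [ContinuousInv K]
    (κ : K →* Γ) (hκ : Continuous fun k => ρ (κ k)) (f : coordRing ρ) :
    Continuous fun k => f.1 (κ k) := by
  refine coordRing_induction (p := fun f => Continuous fun k => f (κ k))
    (fun i j => hκ.matrix_elem i j) (fun i j => ?_) (fun c => continuous_const)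
    (fun _ _ hf hg => hf.add hg) (fun _ _ hf hg => hf.mul hg) f.2
  simp_rw [← map_inv]
  exact (hκ.comp continuous_inv).matrix_elem i j

open MeasureTheory in
theorem exists_isInvariantMean {K : Type*} [Group K] [TopologicalSpace K] [IsTopologicalGroup K]
    [CompactSpace K] (κ : K →* Γ) (hκ : Continuous fun k => ρ (κ k))
    (hdense : ∀ f : coordRing ρ, (∀ k, f.1 (κ k) = 0) → f = 0) :
    ∃ L, IsInvariantMean ρ (Set.range κ) L := by
  let _ : MeasurableSpace K := borel K
  have : BorelSpace K := ⟨rfl⟩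
  let μ : Measure K := Measure.haarMeasure ⊤
  have hμ : μ Set.univ = 1 := Measure.haarMeasure_self (K₀ := ⊤)
  have hc (f : coordRing ρ) : Continuous fun k => f.1 (κ k⁻¹) :=
    (continuous_coordRing_comp κ hκ f).comp continuous_inv
  have hint (f : coordRing ρ) : Integrable (fun k => f.1 (κ k⁻¹)) μ :=
    (hc f).integrable_of_hasCompactSupport (.of_compactSpace _)
  refine ⟨{ toFun := fun f => ∫ k, f.1 (κ k⁻¹) ∂μ
            map_add' := fun f g => integral_add (hint f) (hint g)
            map_smul' := fun c f => integral_const_mul c _ }, ?_, ?_, fun f hf => ?_⟩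
  · change ∫ k, (1 : ℂ) ∂μ = 1
    simp [Measure.real, hμ]
  · rintro _ ⟨k, rfl⟩ f f' h
    change ∫ x, f'.1 (κ x⁻¹) ∂μ = ∫ x, f.1 (κ x⁻¹) ∂μ
    rw [← integral_mul_left_eq_self _ k]
    refine integral_congr_ae (.of_forall fun x => ?_)
    simp [h]
  · exact hdense f fun k => hf _ ⟨k, rfl⟩

theorem isCompact_preimage_units_val {M : Type*} [Monoid M] [TopologicalSpace M] [ContinuousMul M]
    [T2Space M] {K : Set M} (hK : IsCompact K) (hinv : ∀ u : Mˣ, u.1 ∈ K → (u⁻¹).1 ∈ K) :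
    IsCompact {u : Mˣ | u.1 ∈ K} := by
  rw [Units.isEmbedding_embedProduct.isCompact_iff]
  have : Units.embedProduct M '' {u : Mˣ | u.1 ∈ K} = K ×ˢ (MulOpposite.op '' K) ∩
      ({x | x.1 * x.2.unop = 1} ∩ {x | x.2.unop * x.1 = 1}) := by
    ext ⟨a, b⟩
    constructor
    · rintro ⟨u, hu, hab⟩
      obtain ⟨rfl, rfl⟩ := Prod.ext_iff.1 hab
      exact ⟨⟨hu, _, hinv u hu, rfl⟩, u.mul_inv, u.inv_mul⟩
    · rintro ⟨⟨ha, -⟩, h1, h2⟩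
      exact ⟨⟨a, b.unop, h1, h2⟩, ha, rfl⟩
  rw [this]
  refine (hK.prod (hK.image MulOpposite.continuous_op)).inter_right ?_
  have h : Continuous fun x : M × Mᵐᵒᵖ => x.2.unop :=
    MulOpposite.continuous_unop.comp continuous_snd
  exact (isClosed_eq (continuous_fst.mul h) continuous_const).inter
    (isClosed_eq (h.mul continuous_fst) continuous_const)

end Haar

theorem exists_det_pow_mul_eq {Γ : Type*} [Group Γ] {ι : Type*} [Fintype ι] [DecidableEq ι]
    {ρ : Γ →* Matrix ι ι ℂ} (f : coordRing ρ) : ∃ (N : ℕ) (q : MvPolynomial (ι × ι) ℂ),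
      ∀ g, (ρ g).det ^ N * f.1 g = eval (fun ij => ρ g ij.1 ij.2) q := by
  have hX (g) : (eval fun ij : ι × ι => ρ g ij.1 ij.2).mapMatrix (Matrix.mvPolynomialX ι ι ℂ) =
      ρ g := by
    ext i j
    simp
  refine coordRing_induction (p := fun f => ∃ (N : ℕ) (q : MvPolynomial (ι × ι) ℂ),
    ∀ g, (ρ g).det ^ N * f g = eval (fun ij => ρ g ij.1 ij.2) q)
    (fun i j => ⟨0, X (i, j), fun g => by simp⟩)
    (fun i j => ⟨1, (Matrix.mvPolynomialX ι ι ℂ).adjugate i j, fun g => ?_⟩)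
    (fun c => ⟨0, C c, fun g => by simp⟩) ?_ ?_ f.2
  · have h : (ρ g).det • ρ g⁻¹ = (ρ g).adjugate := by
      rw [← Matrix.mul_one (ρ g).adjugate, ← map_one ρ, ← mul_inv_cancel g, map_mul,
        ← Matrix.mul_assoc, Matrix.adjugate_mul, Matrix.smul_mul, Matrix.one_mul]
    have h' := RingHom.map_adjugate (eval fun ij : ι × ι => ρ g ij.1 ij.2)
      (Matrix.mvPolynomialX ι ι ℂ)
    rw [hX, ← h] at h'
    rw [pow_one]
    exact (congrFun (congrFun h' i) j).symm
  · rintro f₁ f₂ ⟨N₁, q₁, h₁⟩ ⟨N₂, q₂, h₂⟩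
    let d := (Matrix.mvPolynomialX ι ι ℂ).det
    refine ⟨N₁ + N₂, d ^ N₂ * q₁ + d ^ N₁ * q₂, fun g => ?_⟩
    simp only [d, map_add, map_mul, map_pow, RingHom.map_det, hX, ← h₁, ← h₂, Pi.add_apply]
    ring
  · rintro f₁ f₂ ⟨N₁, q₁, h₁⟩ ⟨N₂, q₂, h₂⟩
    refine ⟨N₁ + N₂, q₁ * q₂, fun g => ?_⟩
    rw [map_mul, ← h₁, ← h₂, Pi.mul_apply]
    ring

variable {n} in
/-- A matrix group as a group of units. -/
def unitGroup {G : Set (Matrix (Fin n) (Fin n) ℂ)} (hG : IsMatSubgroup ℂ n G) :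
    Subgroup (Matrix (Fin n) (Fin n) ℂ)ˣ where
  carrier := {u | u.1 ∈ G}
  one_mem' := hG.1
  mul_mem' ha hb := hG.2.1 _ ha _ hb
  inv_mem' {u} hu := by
    have := (hG.2.2 _ hu).2
    rwa [← Matrix.coe_units_inv] at this

variable {n} in
/-- The tautological representation of a matrix group. -/
def unitRep {G : Set (Matrix (Fin n) (Fin n) ℂ)} (hG : IsMatSubgroup ℂ n G) :
    unitGroup hG →* Matrix (Fin n) (Fin n) ℂ :=
  (Units.coeHom _).comp (unitGroup hG).subtype

variable {n} in
theorem exists_unitRep_eq {G : Set (Matrix (Fin n) (Fin n) ℂ)} (hG : IsMatSubgroup ℂ n G)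
    {a : Matrix (Fin n) (Fin n) ℂ} (ha : a ∈ G) : ∃ g, unitRep hG g = a := by
  obtain ⟨u, rfl⟩ := (hG.2.2 a ha).1
  exact ⟨⟨u, ha⟩, rfl⟩

variable {n} in
theorem hasPoints_unitRep {G : Set (Matrix (Fin n) (Fin n) ℂ)} (hG : IsMatSubgroup ℂ n G)
    (hcl : IsZClosedInGL ℂ n G) : HasPoints (unitRep hG) := by
  obtain ⟨P, hP⟩ := hcl
  refine hasPoints_of_isZClosed (P := P) _ (fun a b hab ha => exists_unitRep_eq hG ?_)
    fun p hp g => ?_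
  · rw [hP]
    exact ⟨.of_mul_eq_one _ hab, ha⟩
  · exact (hP.subset g.2).2 p hp

variable {n} in
theorem exists_isInvariantMean_unitRep {G : Set (Matrix (Fin n) (Fin n) ℂ)}
    (hG : IsReductiveGroup ℂ n G) : ∃ K L, IsInvariantMean (unitRep hG.1) K L := by
  obtain ⟨hG, -, K, hKG, hK, hKm, hdense⟩ := hG
  have : CompactSpace (unitGroup hKm) := isCompact_iff_compactSpace.1 <|
    isCompact_preimage_units_val hK fun u hu => (unitGroup hKm).inv_mem hu
  let κ : unitGroup hKm →* unitGroup hG := Subgroup.inclusion fun u hu => hKG hu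
  refine ⟨_, exists_isInvariantMean (ρ := unitRep hG) κ
    (Units.continuous_val.comp continuous_subtype_val) fun f hf => ?_⟩
  obtain ⟨N, q, hq⟩ := exists_det_pow_mul_eq f
  have hq0 := hdense q fun a ha => by
    obtain ⟨k, rfl⟩ := exists_unitRep_eq hKm ha
    exact (hq (κ k)).symm.trans (by rw [hf, mul_zero])
  refine Subtype.ext (_root_.funext fun g => ?_)
  refine (mul_eq_zero.1 ((hq g).trans (hq0 _ g.2))).resolve_left (pow_ne_zero _ ?_)
  exact ((Matrix.isUnit_iff_isUnit_det _).1 g.1.isUnit).ne_zero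

/-- **Corollary 3.2.** Let `G` be a complex reductive group, `V = ℂⁿ` a stable `G`-module
and `Y ⊆ V` a `G`-stable algebraic subset.  If all isotropy groups of points of `Y` are
finite, then `Y` is `G`-saturated, and if `G` acts freely on `Y`, then `Y` is `G`-reduced. -/
theorem saturated_of_finite_isotropy_and_reduced_of_free
    (n : ℕ) (G : Set (Matrix (Fin n) (Fin n) ℂ)) (hG : IsReductiveGroup ℂ n G)
    (hstab : IsStableModule ℂ n G)
    (Y : Set (Fin n → ℂ)) (hYalg : IsAlgebraicSet ℂ n Y) (hYstab : Stabilizes ℂ n G Y) :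
    ((∀ y ∈ Y, (isotropy ℂ n G y).Finite) → IsSaturated ℂ n G Y) ∧
    ((∀ y ∈ Y, ∀ g ∈ G, Matrix.mulVec g y = y → g = 1) → IsGReduced ℂ n G Y) := by
  obtain ⟨K, L, hL⟩ := exists_isInvariantMean_unitRep hG
  have hρ := hasPoints_unitRep hG.1 hG.2.1
  have hY : ∀ w, (∀ p : MvPolynomial (Fin n) ℂ, (∀ y ∈ Y, eval y p = 0) → eval w p = 0) →
      w ∈ Y := by
    obtain ⟨S, rfl⟩ := hYalg
    exact fun w hw p hp => hw p fun y hy => hy p hp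
  have hst : ∀ g, ∀ y ∈ Y, (unitRep hG.1 g).mulVec y ∈ Y := fun g => hYstab _ g.2
  have hinv {f : MvPolynomial (Fin n) ℂ}
      (hf : ∀ g v, eval ((unitRep hG.1 g).mulVec v) f = eval v f) : Invariant ℂ n G f := by
    intro a ha
    obtain ⟨g, rfl⟩ := exists_unitRep_eq hG.1 ha
    exact hf g
  refine ⟨fun hfin => (Set.Subset.antisymm (fun y hy => ⟨y, hy, fun _ _ => rfl⟩) ?_ :
      Y = saturation ℂ n G Y),
    fun hfree => le_antisymm (Ideal.span_le.2 fun p hp => hp.2) fun p hp => ?_⟩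
  · rintro v ⟨y, hy, hv⟩
    refine hL.mem_of_forall_invariant hρ hY hst (fun y hy => ?_) fun f hf hfY =>
      (hv f (hinv hf)).trans (hfY y hy)
    have hinj : Set.InjOn (unitRep hG.1) (unitRep hG.1 ⁻¹' isotropy ℂ n G y) :=
      fun a _ b _ hab => Subtype.ext (Units.ext hab)
    exact ((hfin y hy).preimage hinj).subset fun g hg => ⟨g.2, hg⟩
  · refine hL.mem_ideal (J := invariantIdeal ℂ n G Y) hρ hY hst (fun y hy g hg => ?_)
      (fun f hf hfY => Ideal.subset_span ⟨hinv hf, hfY⟩) hp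
    exact Subtype.ext (Units.ext (hfree y hy _ g.2 hg))

end ZPaper
end
end

section
/- Suppose V is a cofree G-module and Y ⊆ V is a G-stable algebraic subset such that Y_apr is Zariski dense in Y. Then Y is G-saturated. -/
/-!
Common framework: a "compact Lie group / complex reductive group acting on a
finite-dimensional module" is modelled as a subgroup of invertible `n × n`
matrices over `𝕜 = ℝ` or `ℂ` acting on `Fin n → 𝕜` by `Matrix.mulVec`.
Polynomial functions on the module are `MvPolynomial (Fin n) 𝕜`.
-/

set_option synthInstance.maxHeartbeats 1000000
set_option maxHeartbeats 1000000

noncomputable section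

open MvPolynomial

namespace ZPaper

variable (𝕜 : Type) [RCLike 𝕜] (n : ℕ)

open scoped IntermediateField.algebraAdjoinAdjoin in
theorem exists_derivation_of_isTranscendenceBasis {k L ι : Type} [Field k] [CharZero k] [Field L]
    [Algebra k L] {x : ι → L} (hx : IsTranscendenceBasis k x) (c : ι → L) :
    ∃ D : Derivation k L L, ∀ i, D (x i) = c i := by
  have hal : Algebra.IsAlgebraic (IntermediateField.adjoin k (Set.range x)) L :=
    hx.isAlgebraic_field
  have : CharZero L := charZero_of_injective_algebraMap (algebraMap k L).injective
  have := Algebra.FormallyEtale.of_isSeparable (IntermediateField.adjoin k (Set.range x)) L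
  have : Algebra.FormallyEtale (Algebra.adjoin k (Set.range x))
      (IntermediateField.adjoin k (Set.range x)) := .of_isLocalization (nonZeroDivisors _)
  have : Algebra.FormallyEtale (Algebra.adjoin k (Set.range x)) L :=
    .comp _ (IntermediateField.adjoin k (Set.range x)) _
  let e := hx.1.aevalEquiv
  let : Algebra (MvPolynomial ι k) (Algebra.adjoin k (Set.range x)) := e.toRingHom.toAlgebra
  let : Algebra (MvPolynomial ι k) L := (aeval x).toRingHom.toAlgebra
  have : IsScalarTower (MvPolynomial ι k) (Algebra.adjoin k (Set.range x)) L :=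
    .of_algebraMap_eq fun p ↦ (hx.1.algebraMap_aevalEquiv p).symm
  let e' : MvPolynomial ι k ≃ₐ[MvPolynomial ι k] Algebra.adjoin k (Set.range x) :=
    { e with commutes' := fun _ ↦ rfl }
  have : Algebra.FormallyEtale (MvPolynomial ι k) (Algebra.adjoin k (Set.range x)) := .of_equiv e'
  have : Algebra.FormallyEtale (MvPolynomial ι k) L := .comp _ (Algebra.adjoin k (Set.range x)) _
  let ψ : MvPolynomial ι k →ₐ[k] TrivSqZeroExt L L :=
    aeval fun i ↦ TrivSqZeroExt.inl (x i) + TrivSqZeroExt.inr (c i)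
  let g₀ : TrivSqZeroExt L L →ₐ[k] L := TrivSqZeroExt.fstHom k L L
  have hψ : g₀.comp ψ = aeval x := by ext; simp [ψ, g₀]
  let : Algebra (MvPolynomial ι k) (TrivSqZeroExt L L) := ψ.toRingHom.toAlgebra
  let g : TrivSqZeroExt L L →ₐ[MvPolynomial ι k] L :=
    { g₀ with commutes' := fun p ↦ DFunLike.congr_fun hψ p }
  have hker : IsNilpotent (RingHom.ker (g : TrivSqZeroExt L L →+* L)) := by
    refine ⟨2, ?_⟩
    refine (pow_two (RingHom.ker (g : TrivSqZeroExt L L →+* L))).trans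
      (eq_bot_iff.2 (Ideal.mul_le.2 ?_))
    intro a ha b hb
    have ha' : a.fst = 0 := ha
    have hb' : b.fst = 0 := hb
    rw [Ideal.mem_bot]
    ext <;> simp [ha', hb']
  let φ := Algebra.FormallySmooth.liftOfSurjective (AlgHom.id (MvPolynomial ι k) L) g
    (fun y ↦ ⟨.inl y, rfl⟩) hker
  have hfst (y : L) : (φ y).fst = y :=
    Algebra.FormallySmooth.liftOfSurjective_apply (AlgHom.id (MvPolynomial ι k) L) g
      (fun y ↦ ⟨.inl y, rfl⟩) hker y
  have hpoly (p : MvPolynomial ι k) : φ (aeval x p) = ψ p := φ.commutes p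
  have hk (a : k) : (φ (algebraMap k L a)).snd = 0 := by
    have := hpoly (C a)
    rw [aeval_C] at this
    rw [this]
    simp [ψ, TrivSqZeroExt.algebraMap_eq_inl']
  refine ⟨Derivation.mk' ⟨⟨fun y ↦ (φ y).snd, fun a b ↦ by simp⟩, fun a b ↦ ?_⟩ fun a b ↦ ?_,
    fun i ↦ ?_⟩
  · have := congrArg TrivSqZeroExt.snd (map_mul φ (algebraMap k L a) b)
    rw [TrivSqZeroExt.snd_mul, hk, hfst] at this
    simpa [Algebra.smul_def] using this
  · simp [hfst, mul_comm]
  · have := hpoly (X i)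
    rw [aeval_X] at this
    change (φ (x i)).snd = c i
    rw [this]
    simp [ψ]

theorem exists_derivation_of_algebraicIndependent {k L ι : Type} [Field k] [CharZero k] [Field L]
    [Algebra k L] {x : ι → L} (hx : AlgebraicIndependent k x) (c : ι → L) :
    ∃ D : Derivation k L L, ∀ i, D (x i) = c i := by
  obtain ⟨t, hst, ht⟩ := exists_isTranscendenceBasis_superset hx.to_subtype_range
  obtain ⟨D, hD⟩ := exists_derivation_of_isTranscendenceBasis ht
    (fun y ↦ Function.extend x c 0 (y : L))
  exact ⟨D, fun i ↦ (hD ⟨x i, hst ⟨i, rfl⟩⟩).trans (hx.injective.extend_apply c 0 i)⟩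

theorem derivation_apply_aeval {k A σ : Type} [CommRing k] [CommRing A] [Algebra k A] [Fintype σ]
    (D : Derivation k A A) (y : σ → A) (Q : MvPolynomial σ k) :
    D (aeval y Q) = ∑ i, aeval y (pderiv i Q) * D (y i) := by
  classical
  induction Q using MvPolynomial.induction_on with
  | C a => simp
  | add p q hp hq => simp [hp, hq, add_mul, Finset.sum_add_distrib]
  | mul_X p i hp =>
    simp only [map_mul, aeval_X, Derivation.leibniz, hp, smul_eq_mul, map_add, add_mul,
      Finset.sum_add_distrib, pderiv_X, Finset.mul_sum]
    congr 1
    · simp [Pi.single_apply]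
    · exact Finset.sum_congr rfl fun j _ ↦ by ring

theorem eval_aeval {k σ τ : Type} [CommRing k] (x : τ → k) (y : σ → MvPolynomial τ k)
    (P : MvPolynomial σ k) : eval x (aeval y P) = eval (fun i ↦ eval x (y i)) P := by
  induction P using MvPolynomial.induction_on <;> simp_all

/-- The polynomials on matrix space that vanish on a set of matrices. -/
def matIdeal {n : ℕ} (G : Set (Matrix (Fin n) (Fin n) ℂ)) :
    Ideal (MvPolynomial (Fin n × Fin n) ℂ) where
  carrier := {Q | ∀ g ∈ G, eval (fun ij ↦ g ij.1 ij.2) Q = 0}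
  zero_mem' := by intro g _; simp
  add_mem' := by intro a b ha hb g hg; simp [ha g hg, hb g hg]
  smul_mem' := by intro c p hp g hg; simp [smul_eq_mul, hp g hg]

/-- The derivative of `Q` along the left-invariant vector field `g ↦ g * A`. -/
def leftInvDeriv {n : ℕ} (A : Matrix (Fin n) (Fin n) ℂ) (Q : MvPolynomial (Fin n × Fin n) ℂ) :
    MvPolynomial (Fin n × Fin n) ℂ :=
  ∑ ij : Fin n × Fin n, pderiv ij Q * ∑ k, X (ij.1, k) * C (A k ij.2)

theorem eval_leftInvDeriv {n : ℕ} (A g : Matrix (Fin n) (Fin n) ℂ)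
    (Q : MvPolynomial (Fin n × Fin n) ℂ) :
    eval (fun ij ↦ g ij.1 ij.2) (leftInvDeriv A Q) =
      ∑ ij : Fin n × Fin n, eval (fun ij ↦ g ij.1 ij.2) (pderiv ij Q) * (g * A) ij.1 ij.2 := by
  simp [leftInvDeriv, Matrix.mul_apply]

theorem aeval_leftInvDeriv {n : ℕ} {L : Type} [CommRing L] [Algebra ℂ L]
    (A : Matrix (Fin n) (Fin n) ℂ) (g : Matrix (Fin n) (Fin n) L)
    (Q : MvPolynomial (Fin n × Fin n) ℂ) :
    aeval (fun ij ↦ g ij.1 ij.2) (leftInvDeriv A Q) =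
      ∑ ij : Fin n × Fin n, aeval (fun ij ↦ g ij.1 ij.2) (pderiv ij Q) *
        (g * A.map (algebraMap ℂ L)) ij.1 ij.2 := by
  simp [leftInvDeriv, Matrix.mul_apply]

theorem leftInvDeriv_add_left {n : ℕ} (A B : Matrix (Fin n) (Fin n) ℂ)
    (Q : MvPolynomial (Fin n × Fin n) ℂ) :
    leftInvDeriv (A + B) Q = leftInvDeriv A Q + leftInvDeriv B Q := by
  simp [leftInvDeriv, mul_add, Finset.sum_add_distrib]

theorem leftInvDeriv_smul_left {n : ℕ} (c : ℂ) (A : Matrix (Fin n) (Fin n) ℂ)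
    (Q : MvPolynomial (Fin n × Fin n) ℂ) :
    leftInvDeriv (c • A) Q = C c * leftInvDeriv A Q := by
  simp only [leftInvDeriv, Matrix.smul_apply, smul_eq_mul, C_mul, Finset.mul_sum]
  exact Finset.sum_congr rfl fun i _ ↦ Finset.sum_congr rfl fun j _ ↦ by ring

theorem leftInvDeriv_add_right {n : ℕ} (A : Matrix (Fin n) (Fin n) ℂ)
    (Q R : MvPolynomial (Fin n × Fin n) ℂ) :
    leftInvDeriv A (Q + R) = leftInvDeriv A Q + leftInvDeriv A R := by
  simp [leftInvDeriv, add_mul, Finset.sum_add_distrib]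

theorem leftInvDeriv_smul_right {n : ℕ} (c : ℂ) (A : Matrix (Fin n) (Fin n) ℂ)
    (Q : MvPolynomial (Fin n × Fin n) ℂ) :
    leftInvDeriv A (c • Q) = c • leftInvDeriv A Q := by
  simp [leftInvDeriv, Finset.smul_sum]

/-- The Lie algebra of `G`, described by derivations preserving the ideal of `G`. -/
def derivLieAlgebra {n : ℕ} (G : Set (Matrix (Fin n) (Fin n) ℂ)) :
    Submodule ℂ (Matrix (Fin n) (Fin n) ℂ) where
  carrier := {A | ∀ Q ∈ matIdeal G, leftInvDeriv A Q ∈ matIdeal G}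
  zero_mem' := by intro Q _; simp [leftInvDeriv]
  add_mem' := by
    intro A B hA hB Q hQ
    rw [leftInvDeriv_add_left]
    exact add_mem (hA Q hQ) (hB Q hQ)
  smul_mem' := by
    intro c A hA Q hQ
    rw [leftInvDeriv_smul_left]
    exact Ideal.mul_mem_left _ _ (hA Q hQ)

/-- Evaluation at `h` intertwines derivatives at `g` of a polynomial and of its left translate. -/
theorem exists_leftTranslate {n : ℕ} (h : Matrix (Fin n) (Fin n) ℂ)
    (Q : MvPolynomial (Fin n × Fin n) ℂ) :
    ∃ Q' : MvPolynomial (Fin n × Fin n) ℂ,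
      (∀ g : Matrix (Fin n) (Fin n) ℂ, eval (fun ij ↦ g ij.1 ij.2) Q' =
        eval (fun ij ↦ (h * g) ij.1 ij.2) Q) ∧
      ∀ A g : Matrix (Fin n) (Fin n) ℂ, eval (fun ij ↦ g ij.1 ij.2) (leftInvDeriv A Q') =
        eval (fun ij ↦ (h * g) ij.1 ij.2) (leftInvDeriv A Q) := by
  set y : Fin n × Fin n → MvPolynomial (Fin n × Fin n) ℂ :=
    fun ij ↦ ∑ k, C (h ij.1 k) * X (k, ij.2) with hy
  have hev (g : Matrix (Fin n) (Fin n) ℂ) (P : MvPolynomial (Fin n × Fin n) ℂ) :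
      eval (fun ij ↦ g ij.1 ij.2) (aeval y P) = eval (fun ij ↦ (h * g) ij.1 ij.2) P := by
    rw [eval_aeval]
    congr 2
    ext ij
    simp [hy, Matrix.mul_apply]
  refine ⟨aeval y Q, fun g ↦ hev g Q, fun A g ↦ ?_⟩
  rw [eval_leftInvDeriv, eval_leftInvDeriv]
  have hD (ij : Fin n × Fin n) : pderiv ij (aeval y Q) =
      ∑ ab, aeval y (pderiv ab Q) * pderiv ij (y ab) :=
    derivation_apply_aeval (pderiv ij) y Q
  simp only [hD, map_sum, map_mul, hev, Finset.sum_mul]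
  rw [Finset.sum_comm]
  refine Finset.sum_congr rfl fun ab _ ↦ ?_
  simp only [mul_assoc, ← Finset.mul_sum]
  congr 1
  have (ij : Fin n × Fin n) : eval (fun ij ↦ g ij.1 ij.2) (pderiv ij (y ab)) =
      if ij.2 = ab.2 then h ab.1 ij.1 else 0 := by
    classical
    simp only [hy, map_sum, Derivation.leibniz, pderiv_C, pderiv_X, smul_eq_mul, mul_zero,
      add_zero, map_mul, eval_C, Pi.single_apply]
    rcases ij with ⟨i, j⟩
    rcases ab with ⟨a, b⟩
    by_cases hjb : j = b
    · simp [hjb]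
    · simp [hjb, Ne.symm hjb]
  simp only [this]
  have hmul : (h * (g * A)) ab.1 ab.2 = ∑ k, h ab.1 k * (g * A) k ab.2 := Matrix.mul_apply
  rw [hmul, Fintype.sum_prod_type]
  simp

theorem mem_derivLieAlgebra_of_eval {n : ℕ} {G : Set (Matrix (Fin n) (Fin n) ℂ)}
    (hG : IsMatSubgroup ℂ n G) {g₀ : Matrix (Fin n) (Fin n) ℂ} (hg₀ : g₀ ∈ G)
    {A : Matrix (Fin n) (Fin n) ℂ}
    (hA : ∀ Q ∈ matIdeal G, eval (fun ij ↦ g₀ ij.1 ij.2) (leftInvDeriv A Q) = 0) :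
    A ∈ derivLieAlgebra G := by
  intro Q hQ g hg
  obtain ⟨Q', h1, h2⟩ := exists_leftTranslate (g * g₀⁻¹) Q
  have hgg : g * g₀⁻¹ * g₀ = g := by
    rw [Matrix.mul_assoc, Matrix.nonsing_inv_mul _ ((Matrix.isUnit_iff_isUnit_det _).1
      (hG.2.2 g₀ hg₀).1), Matrix.mul_one]
  have := hA Q' fun k hk ↦ by
    rw [h1]
    exact hQ _ (hG.2.1 _ (hG.2.1 _ hg _ (hG.2.2 _ hg₀).2) _ hk)
  rwa [h2, hgg] at this

theorem exists_transversal {n : ℕ} {G : Set (Matrix (Fin n) (Fin n) ℂ)}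
    (hG : IsMatSubgroup ℂ n G) {g₀ : Matrix (Fin n) (Fin n) ℂ} (hg₀ : g₀ ∈ G) :
    ∃ (m : ℕ) (c : Fin m → Matrix (Fin n) (Fin n) ℂ)
      (Q : Fin m → MvPolynomial (Fin n × Fin n) ℂ), (∀ k, Q k ∈ matIdeal G) ∧
      (∀ j k, eval (fun ij ↦ g₀ ij.1 ij.2) (leftInvDeriv (c j) (Q k)) = if j = k then 1 else 0) ∧
      ∀ A, ∃ t ∈ derivLieAlgebra G, ∃ a : Fin m → ℂ, A = t + ∑ j, a j • c j := by
  obtain ⟨U, hU⟩ := Submodule.exists_isCompl (derivLieAlgebra G)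
  let b := Module.finBasis ℂ U
  let Λ : (matIdeal G).restrictScalars ℂ →ₗ[ℂ] Module.Dual ℂ U :=
    { toFun := fun Q ↦
        { toFun := fun A ↦ eval (fun ij ↦ g₀ ij.1 ij.2) (leftInvDeriv (A : Matrix _ _ ℂ) Q)
          map_add' := fun A B ↦ by simp [leftInvDeriv_add_left]
          map_smul' := fun c A ↦ by simp [leftInvDeriv_smul_left] }
      map_add' := fun Q R ↦ by ext; simp [leftInvDeriv_add_right]
      map_smul' := fun c Q ↦ by ext; simp [leftInvDeriv_smul_right] }
  have hco : (LinearMap.range Λ).dualCoannihilator = ⊥ := by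
    rw [eq_bot_iff]
    intro A hA
    rw [Submodule.mem_dualCoannihilator] at hA
    have h1 : (A : Matrix _ _ ℂ) ∈ derivLieAlgebra G := mem_derivLieAlgebra_of_eval hG hg₀
      fun Q hQ ↦ hA (Λ ⟨Q, hQ⟩) ⟨_, rfl⟩
    have h2 := hU.disjoint.le_bot (Submodule.mem_inf.2 ⟨h1, A.2⟩)
    simpa using h2
  have hrange : LinearMap.range Λ = ⊤ := by
    rw [← Subspace.dualCoannihilator_dualAnnihilator_eq (W := LinearMap.range Λ), hco]
    simp
  have hQ (k) : ∃ Q, Λ Q = b.coord k := by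
    have : b.coord k ∈ LinearMap.range Λ := hrange ▸ trivial
    exact this
  choose Q hQ using hQ
  refine ⟨_, fun j ↦ b j, fun k ↦ Q k, fun k ↦ (Q k).2, fun j k ↦ ?_, fun A ↦ ?_⟩
  · have := LinearMap.congr_fun (hQ k) (b j)
    rw [Module.Basis.coord_apply, Module.Basis.repr_self, Finsupp.single_apply] at this
    exact this
  · obtain ⟨t, ht, u, hu, rfl⟩ := Submodule.mem_sup.1 (hU.sup_eq_top ▸ Submodule.mem_top (x := A))
    refine ⟨t, ht, fun j ↦ b.repr ⟨u, hu⟩ j, ?_⟩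
    have := congrArg U.subtype (b.sum_repr ⟨u, hu⟩)
    rw [map_sum] at this
    rw [add_right_inj]
    exact this.symm

/-- Pullback of polynomials along the orbit map `g ↦ g u`. -/
def orbitPullback {n : ℕ} (u : Fin n → ℂ) :
    MvPolynomial (Fin n) ℂ →ₐ[ℂ] MvPolynomial (Fin n × Fin n) ℂ :=
  aeval fun i ↦ ∑ j, X (i, j) * C (u j)

theorem eval_orbitPullback {n : ℕ} (u : Fin n → ℂ) (P : MvPolynomial (Fin n) ℂ)
    (g : Matrix (Fin n) (Fin n) ℂ) :
    eval (fun ij ↦ g ij.1 ij.2) (orbitPullback u P) = eval (Matrix.mulVec g u) P := by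
  rw [orbitPullback, eval_aeval]
  congr 2
  ext i
  simp [Matrix.mulVec, dotProduct]

theorem map_derivation_mem_span {n : ℕ} {G : Set (Matrix (Fin n) (Fin n) ℂ)}
    (hG : IsMatSubgroup ℂ n G) {g₀ : Matrix (Fin n) (Fin n) ℂ} (hg₀ : g₀ ∈ G)
    {L : Type} [Field L] [Algebra ℂ L] (φ : MvPolynomial (Fin n × Fin n) ℂ →ₐ[ℂ] L)
    (hφ : ∀ Q ∈ matIdeal G, φ Q = 0)
    (hφ₀ : ∀ Q, φ Q = 0 → eval (fun ij ↦ g₀ ij.1 ij.2) Q = 0)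
    {g : Matrix (Fin n) (Fin n) L} (hg : ∀ i j, g i j = φ (X (i, j)))
    (A : Matrix (Fin n) (Fin n) L)
    (hA : ∀ Q ∈ matIdeal G, ∑ ij : Fin n × Fin n, φ (pderiv ij Q) * (g * A) ij.1 ij.2 = 0) :
    A ∈ Submodule.span L ((fun t ↦ t.map (algebraMap ℂ L)) ''
      (derivLieAlgebra G : Set (Matrix (Fin n) (Fin n) ℂ))) := by
  obtain ⟨m, c, Q, hQ, hcQ, hdec⟩ := exists_transversal hG hg₀
  have hφe : φ = aeval fun ij : Fin n × Fin n ↦ g ij.1 ij.2 := by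
    ext ij
    simp [hg]
  have hmap (t : Matrix (Fin n) (Fin n) ℂ) (R : MvPolynomial (Fin n × Fin n) ℂ) :
      φ (leftInvDeriv t R) = ∑ ij : Fin n × Fin n, φ (pderiv ij R) *
        (g * t.map (algebraMap ℂ L)) ij.1 ij.2 := by
    rw [hφe]
    exact aeval_leftInvDeriv t g R
  choose t ht a ha using fun i j : Fin n ↦ hdec (Matrix.single i j 1)
  set κ : Fin m → L := fun l ↦ ∑ i, ∑ j, A i j * algebraMap ℂ L (a i j l) with hκ
  have hsum : A = ∑ i, ∑ j, A i j • (t i j).map (algebraMap ℂ L) +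
      ∑ l, κ l • (c l).map (algebraMap ℂ L) := by
    have h1 (i j : Fin n) : A i j • (Matrix.single i j (1 : L)) =
        A i j • (t i j).map (algebraMap ℂ L) +
          ∑ l, (A i j * algebraMap ℂ L (a i j l)) • (c l).map (algebraMap ℂ L) := by
      have h2 : (Matrix.single i j (1 : L)) =
          (Matrix.single i j (1 : ℂ)).map (algebraMap ℂ L) := by
        simp
      rw [h2, ha i j]
      ext p q
      simp [Matrix.sum_apply, Finset.mul_sum, mul_add, mul_assoc]
    conv_lhs => rw [Matrix.matrix_eq_sum_single A]
    have h3 (i j : Fin n) : Matrix.single i j (A i j) = A i j • Matrix.single i j (1 : L) := by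
      simp
    simp only [h3, h1, Finset.sum_add_distrib]
    congr 1
    simp only [hκ, Finset.sum_smul]
    rw [Finset.sum_comm]
    rw [Finset.sum_congr rfl fun j _ ↦ Finset.sum_comm]
    rw [Finset.sum_comm]
    exact Finset.sum_congr rfl fun l _ ↦ Finset.sum_comm
  let M : Matrix (Fin m) (Fin m) (MvPolynomial (Fin n × Fin n) ℂ) :=
    Matrix.of fun j k ↦ leftInvDeriv (c j) (Q k)
  have hM : (M.map φ).det ≠ 0 := by
    intro h0
    have h1 : φ M.det = 0 := by rw [AlgHom.map_det]; exact h0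
    have h2 := hφ₀ _ h1
    rw [RingHom.map_det] at h2
    have h3 : (eval fun ij : Fin n × Fin n ↦ g₀ ij.1 ij.2).mapMatrix M = 1 := by
      ext j k
      simp only [RingHom.mapMatrix_apply, Matrix.map_apply, M, Matrix.of_apply, Matrix.one_apply]
      exact hcQ j k
    rw [h3, Matrix.det_one] at h2
    exact one_ne_zero h2
  have hκ0 : κ = 0 := by
    refine Matrix.eq_zero_of_vecMul_eq_zero hM ?_
    ext k
    have h1 := hA (Q k) (hQ k)
    let F : Matrix (Fin n) (Fin n) L →ₗ[L] L :=
      { toFun := fun B ↦ ∑ ij : Fin n × Fin n, φ (pderiv ij (Q k)) * (g * B) ij.1 ij.2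
        map_add' := fun B C ↦ by
          simp [mul_add, Finset.sum_add_distrib]
        map_smul' := fun c B ↦ by
          simp only [Matrix.mul_smul, Matrix.smul_apply, smul_eq_mul, RingHom.id_apply,
            Finset.mul_sum]
          exact Finset.sum_congr rfl fun _ _ ↦ by ring }
    have hF (s : Matrix (Fin n) (Fin n) ℂ) : F (s.map (algebraMap ℂ L)) =
      φ (leftInvDeriv s (Q k)) := (hmap s (Q k)).symm
    have h2 : F A = 0 := h1
    rw [hsum, map_add, map_sum, map_sum] at h2
    simp only [map_sum, map_smul, hF] at h2
    simp only [hφ _ (ht _ _ _ (hQ k)), smul_zero, Finset.sum_const_zero, zero_add] at h2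
    exact h2
  rw [hsum, hκ0]
  simp only [Pi.zero_apply, zero_smul, Finset.sum_const_zero, add_zero]
  exact sum_mem fun i _ ↦ sum_mem fun j _ ↦
    Submodule.smul_mem _ _ (Submodule.subset_span ⟨_, ht i j, rfl⟩)

theorem not_algebraicIndependent_orbitPullback {n : ℕ} {G : Set (Matrix (Fin n) (Fin n) ℂ)}
    (hG : IsMatSubgroup ℂ n G) {g₀ : Matrix (Fin n) (Fin n) ℂ} (hg₀ : g₀ ∈ G)
    {L : Type} [Field L] [Algebra ℂ L] (φ : MvPolynomial (Fin n × Fin n) ℂ →ₐ[ℂ] L)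
    (hφ : ∀ Q ∈ matIdeal G, φ Q = 0)
    (hφ₀ : ∀ Q, φ Q = 0 → eval (fun ij ↦ g₀ ij.1 ij.2) Q = 0)
    (u : Fin n → ℂ) {r : ℕ} (e : Fin r → Fin n → ℂ)
    (he : ∀ A ∈ derivLieAlgebra G, Matrix.mulVec A u ∈ Submodule.span ℂ (Set.range e))
    (P : Fin (r + 1) → MvPolynomial (Fin n) ℂ) :
    ¬ AlgebraicIndependent ℂ fun i ↦ φ (orbitPullback u (P i)) := by
  intro hP
  set g : Matrix (Fin n) (Fin n) L := Matrix.of fun i j ↦ φ (X (i, j)) with hg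
  have hφe (Q) : φ Q = aeval (fun ij : Fin n × Fin n ↦ g ij.1 ij.2) Q := by
    congr 1
    ext ij
    simp [hg]
  have hdet : IsUnit g.det := by
    rw [isUnit_iff_ne_zero]
    intro h0
    let M : Matrix (Fin n) (Fin n) (MvPolynomial (Fin n × Fin n) ℂ) :=
      Matrix.of fun i j ↦ X (i, j)
    have h1 : φ M.det = 0 := by rw [AlgHom.map_det]; exact h0
    have h2 := hφ₀ _ h1
    rw [RingHom.map_det] at h2
    have h3 : (eval fun ij : Fin n × Fin n ↦ g₀ ij.1 ij.2).mapMatrix M = g₀ := by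
      ext j k
      simp [M]
    rw [h3] at h2
    exact ((Matrix.isUnit_iff_isUnit_det _).1 (hG.2.2 g₀ hg₀).1).ne_zero h2
  let ι : ℂ → L := algebraMap ℂ L
  let y : Fin n → L := g.mulVec (ι ∘ u)
  have hy (p : MvPolynomial (Fin n) ℂ) : φ (orbitPullback u p) = aeval y p := by
    rw [orbitPullback, ← AlgHom.comp_apply]
    congr 1
    ext i
    simp [y, ι, Matrix.mulVec, dotProduct, hg, ← algebraMap_eq]
  let T : (Fin n → L) →ₗ[L] (Fin (r + 1) → L) :=
    ((Matrix.of fun i k ↦ aeval y (pderiv k (P i))) * g).mulVecLin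
  have key (c : Fin (r + 1) → L) :
      c ∈ Submodule.span L (Set.range fun k ↦ T (ι ∘ e k)) := by
    obtain ⟨D, hD⟩ := exists_derivation_of_algebraicIndependent hP c
    set A : Matrix (Fin n) (Fin n) L := g⁻¹ * g.map D with hAdef
    have hgA : g * A = g.map D := by
      rw [hAdef, ← Matrix.mul_assoc, Matrix.mul_nonsing_inv _ hdet, Matrix.one_mul]
    have hA := map_derivation_mem_span hG hg₀ φ hφ hφ₀ (g := g) (fun _ _ ↦ rfl) A fun Q hQ ↦ by
      have h1 := derivation_apply_aeval D (fun ij : Fin n × Fin n ↦ g ij.1 ij.2) Q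
      rw [← hφe, hφ Q hQ, map_zero] at h1
      simp only [hgA, hφe, Matrix.map_apply]
      exact h1.symm
    have hc : c = T (A.mulVec (ι ∘ u)) := by
      have hDy : (fun k ↦ D (y k)) = g.mulVec (A.mulVec (ι ∘ u)) := by
        rw [Matrix.mulVec_mulVec, hgA]
        ext k
        simp [y, ι, Matrix.mulVec, dotProduct, mul_comm]
      ext i
      rw [← hD i, hy, derivation_apply_aeval]
      simp only [T, Matrix.mulVecLin_apply]
      rw [← Matrix.mulVec_mulVec, ← hDy]
      rfl
    let E : Matrix (Fin n) (Fin n) L →ₗ[L] (Fin (r + 1) → L) :=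
      { toFun := fun B ↦ T (B.mulVec (ι ∘ u))
        map_add' := fun B C ↦ by rw [Matrix.add_mulVec, map_add]
        map_smul' := fun a B ↦ by rw [Matrix.smul_mulVec, map_smul]; rfl }
    rw [hc]
    change A ∈ (Submodule.span L (Set.range fun k ↦ T (ι ∘ e k))).comap E
    refine Submodule.span_le.2 ?_ hA
    rintro _ ⟨t, ht, rfl⟩
    obtain ⟨a, ha⟩ := (Submodule.mem_span_range_iff_exists_fun ℂ).1 (he t ht)
    have h1 : (t.map (algebraMap ℂ L)).mulVec (ι ∘ u) = ∑ k, ι (a k) • (ι ∘ e k) := by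
      have h2 : (t.map (algebraMap ℂ L)).mulVec (ι ∘ u) = ι ∘ (t.mulVec u) := by
        ext i
        simp [ι, Matrix.mulVec, dotProduct]
      rw [h2, ← ha]
      ext i
      simp [ι, Algebra.smul_def]
    change T ((t.map (algebraMap ℂ L)).mulVec (ι ∘ u)) ∈
      Submodule.span L (Set.range fun k ↦ T (ι ∘ e k))
    rw [h1, map_sum]
    exact sum_mem fun k _ ↦ by
      rw [map_smul]
      exact Submodule.smul_mem _ _ (Submodule.subset_span ⟨k, rfl⟩)
  have htop : Submodule.span L (Set.range fun k ↦ T (ι ∘ e k)) = ⊤ :=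
    eq_top_iff.2 fun c _ ↦ key c
  have := finrank_range_le_card (R := L) fun k ↦ T (ι ∘ e k)
  rw [Set.finrank, htop, finrank_top] at this
  simp at this

/-- The linear map `A ↦ A v`. -/
def applyAt {n : ℕ} (v : Fin n → ℂ) : Matrix (Fin n) (Fin n) ℂ →ₗ[ℂ] (Fin n → ℂ) where
  toFun A := A.mulVec v
  map_add' A B := Matrix.add_mulVec A B v
  map_smul' c A := Matrix.smul_mulVec c A v

theorem hasDerivAt_eval {σ : Type} [Fintype σ] {x : ℂ → σ → ℂ} {x' : σ → ℂ} {t : ℂ}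
    (hx : ∀ i, HasDerivAt (fun s ↦ x s i) (x' i) t) (Q : MvPolynomial σ ℂ) :
    HasDerivAt (fun s ↦ eval (x s) Q) (∑ i, eval (x t) (pderiv i Q) * x' i) t := by
  classical
  induction Q using MvPolynomial.induction_on with
  | C a => simpa using hasDerivAt_const t a
  | add p q hp hq =>
    simp only [map_add, add_mul, Finset.sum_add_distrib]
    exact hp.add hq
  | mul_X p i hp =>
    simp only [map_mul, eval_X]
    refine (hp.mul (hx i)).congr_deriv ?_
    simp only [Derivation.leibniz, smul_eq_mul, map_add, map_mul, eval_X, pderiv_X, add_mul,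
      Finset.sum_add_distrib, Finset.sum_mul]
    rw [add_comm]
    congr 1
    · simp [Pi.single_apply]
    · exact Finset.sum_congr rfl fun j _ ↦ by ring

section Exponential

open scoped Matrix.Norms.Operator

theorem mexp_eq_exp {n : ℕ} (A : Matrix (Fin n) (Fin n) ℂ) : mexp ℂ n A = NormedSpace.exp A := by
  rw [NormedSpace.exp_eq_tsum ℂ]
  rfl

theorem hasSum_exp_mulVec {n : ℕ} (A : Matrix (Fin n) (Fin n) ℂ) (v : Fin n → ℂ) :
    HasSum (fun k : ℕ ↦ ((k.factorial : ℂ)⁻¹ • A ^ k).mulVec v)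
      ((NormedSpace.exp A).mulVec v) := by
  have h := NormedSpace.exp_series_hasSum_exp' (𝕂 := ℂ) A
  exact h.map (applyAt v) (applyAt v).continuous_of_finiteDimensional

theorem exp_mulVec_of_mulVec_eq_zero {n : ℕ} {A : Matrix (Fin n) (Fin n) ℂ} {v : Fin n → ℂ}
    (h : A.mulVec v = 0) : (NormedSpace.exp A).mulVec v = v := by
  refine (hasSum_exp_mulVec A v).unique ?_
  have h1 : HasSum (fun k : ℕ ↦ ((k.factorial : ℂ)⁻¹ • A ^ k).mulVec v) _ :=
    hasSum_single 0 fun k hk ↦ by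
      obtain ⟨k, rfl⟩ := Nat.exists_eq_succ_of_ne_zero hk
      rw [Matrix.smul_mulVec, pow_succ, ← Matrix.mulVec_mulVec, h, Matrix.mulVec_zero, smul_zero]
  simpa using h1

theorem hasDerivAt_exp_smul_apply {n : ℕ} (A : Matrix (Fin n) (Fin n) ℂ) (t : ℂ) (i j : Fin n) :
    HasDerivAt (fun s : ℂ ↦ NormedSpace.exp (s • A) i j) ((NormedSpace.exp (t • A) * A) i j) t := by
  have h := hasDerivAt_exp_smul_const (𝕂 := ℂ) A t
  let F : Matrix (Fin n) (Fin n) ℂ →ₗ[ℂ] ℂ := Matrix.entryLinearMap ℂ ℂ i j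
  exact (LinearMap.toContinuousLinearMap F).hasFDerivAt.comp_hasDerivAt t h

theorem hasDerivAt_exp_smul_mulVec {n : ℕ} (A : Matrix (Fin n) (Fin n) ℂ) (x : Fin n → ℂ) (t : ℂ) :
    HasDerivAt (fun s : ℂ ↦ (NormedSpace.exp (s • A)).mulVec x)
      ((NormedSpace.exp (t • A) * A).mulVec x) t := by
  rw [hasDerivAt_pi]
  intro i
  simp only [Matrix.mulVec, dotProduct]
  exact HasDerivAt.fun_sum fun j _ ↦ (hasDerivAt_exp_smul_apply A t i j).mul_const (x j)

theorem hasDerivAt_eval_exp {n : ℕ} (A : Matrix (Fin n) (Fin n) ℂ)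
    (Q : MvPolynomial (Fin n × Fin n) ℂ) (t : ℂ) :
    HasDerivAt (fun s : ℂ ↦ eval (fun ij ↦ NormedSpace.exp (s • A) ij.1 ij.2) Q)
      (eval (fun ij ↦ NormedSpace.exp (t • A) ij.1 ij.2) (leftInvDeriv A Q)) t := by
  have h := hasDerivAt_eval (t := t)
    (x := fun s (ij : Fin n × Fin n) ↦ NormedSpace.exp (s • A) ij.1 ij.2)
    (x' := fun ij ↦ (NormedSpace.exp (t • A) * A) ij.1 ij.2)
    (fun ij ↦ hasDerivAt_exp_smul_apply A t ij.1 ij.2) Q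
  exact h.congr_deriv (eval_leftInvDeriv A (NormedSpace.exp (t • A)) Q).symm

theorem iteratedDeriv_eval_exp {n : ℕ} (A : Matrix (Fin n) (Fin n) ℂ)
    (Q : MvPolynomial (Fin n × Fin n) ℂ) (k : ℕ) :
    iteratedDeriv k (fun s : ℂ ↦ eval (fun ij ↦ NormedSpace.exp (s • A) ij.1 ij.2) Q) =
      fun s : ℂ ↦ eval (fun ij ↦ NormedSpace.exp (s • A) ij.1 ij.2) ((leftInvDeriv A)^[k] Q) := by
  induction k with
  | zero => exact iteratedDeriv_zero
  | succ k ih =>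
    rw [iteratedDeriv_succ, ih, Function.iterate_succ_apply']
    exact funext fun s ↦ (hasDerivAt_eval_exp A _ s).deriv

theorem eval_exp_eq_zero {n : ℕ} {A : Matrix (Fin n) (Fin n) ℂ}
    {Q : MvPolynomial (Fin n × Fin n) ℂ}
    (h : ∀ k : ℕ, eval (fun ij : Fin n × Fin n ↦ (1 : Matrix (Fin n) (Fin n) ℂ) ij.1 ij.2)
      ((leftInvDeriv A)^[k] Q) = 0) :
    eval (fun ij ↦ NormedSpace.exp A ij.1 ij.2) Q = 0 := by
  have hd : Differentiable ℂ
      fun s : ℂ ↦ eval (fun ij : Fin n × Fin n ↦ NormedSpace.exp (s • A) ij.1 ij.2) Q :=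
    fun s ↦ (hasDerivAt_eval_exp A Q s).differentiableAt
  have h1 := Complex.taylorSeries_eq_of_entire' 0 1 hd
  simp only [iteratedDeriv_eval_exp, one_smul, zero_smul, NormedSpace.exp_zero] at h1
  rw [← h1]
  refine (tsum_congr fun k ↦ ?_).trans tsum_zero
  rw [h k, mul_zero, zero_mul]

theorem exp_mem_of_mem_derivLieAlgebra {n : ℕ} {G : Set (Matrix (Fin n) (Fin n) ℂ)}
    (hG : IsMatSubgroup ℂ n G) (hGc : IsZClosedInGL ℂ n G) {A : Matrix (Fin n) (Fin n) ℂ}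
    (hA : A ∈ derivLieAlgebra G) : NormedSpace.exp A ∈ G := by
  obtain ⟨P, hP⟩ := hGc
  have hvan (p) (hp : p ∈ P) : p ∈ matIdeal G := fun g hg ↦ by
    rw [hP] at hg
    exact hg.2 p hp
  have hiter (p) (hp : p ∈ P) (k : ℕ) : (leftInvDeriv A)^[k] p ∈ matIdeal G := by
    induction k with
    | zero => exact hvan p hp
    | succ k ih =>
      rw [Function.iterate_succ_apply']
      exact hA _ ih
  have h1 : NormedSpace.exp A ∈
      {g | IsUnit g ∧ ∀ p ∈ P, eval (fun ij : Fin n × Fin n ↦ g ij.1 ij.2) p = 0} :=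
    ⟨Matrix.isUnit_exp A, fun p hp ↦ eval_exp_eq_zero fun k ↦ hiter p hp k 1 hG.1⟩
  exact hP.symm ▸ h1

theorem lieAlgebra_eq {n : ℕ} {G : Set (Matrix (Fin n) (Fin n) ℂ)}
    (hG : IsMatSubgroup ℂ n G) (hGc : IsZClosedInGL ℂ n G) :
    lieAlgebra ℂ n G = derivLieAlgebra G := by
  ext A
  refine ⟨fun hA ↦ mem_derivLieAlgebra_of_eval hG hG.1 fun Q hQ ↦ ?_, fun hA t ↦ ?_⟩
  · have h1 := hasDerivAt_eval_exp A Q 0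
    have h2 : (fun s : ℂ ↦ eval (fun ij ↦ NormedSpace.exp (s • A) ij.1 ij.2) Q) = fun _ ↦ 0 := by
      ext s
      refine hQ _ ?_
      rw [← mexp_eq_exp]
      exact hA s
    rw [h2] at h1
    have h3 := h1.unique (hasDerivAt_const _ _)
    simpa only [zero_smul, NormedSpace.exp_zero] using h3
  · rw [mexp_eq_exp]
    exact exp_mem_of_mem_derivLieAlgebra hG hGc (Submodule.smul_mem _ t hA)

theorem conj_mem_derivLieAlgebra {n : ℕ} {G : Set (Matrix (Fin n) (Fin n) ℂ)}
    (hG : IsMatSubgroup ℂ n G) (hGc : IsZClosedInGL ℂ n G) {A g : Matrix (Fin n) (Fin n) ℂ}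
    (hA : A ∈ derivLieAlgebra G) (hg : g ∈ G) : g⁻¹ * A * g ∈ derivLieAlgebra G := by
  rw [← SetLike.mem_coe, ← lieAlgebra_eq hG hGc]
  intro t
  have h : t • (g⁻¹ * A * g) = g⁻¹ * (t • A) * g := by simp
  rw [mexp_eq_exp, h, Matrix.exp_conj' _ _ (hG.2.2 g hg).1]
  exact hG.2.1 _ (hG.2.1 _ (hG.2.2 g hg).2 _
    (exp_mem_of_mem_derivLieAlgebra hG hGc (Submodule.smul_mem _ t hA))) _ hg

theorem orbitTangent_eq {n : ℕ} {G : Set (Matrix (Fin n) (Fin n) ℂ)}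
    (hG : IsMatSubgroup ℂ n G) (hGc : IsZClosedInGL ℂ n G) (v : Fin n → ℂ) :
    orbitTangent ℂ n G v = (derivLieAlgebra G).map (applyAt v) := by
  rw [orbitTangent, lieAlgebra_eq hG hGc]
  change Submodule.span ℂ (applyAt v '' (derivLieAlgebra G)) = _
  rw [Submodule.span_image, Submodule.span_eq]

/-- A polynomial vanishing on the image of a submersion vanishes identically. -/
theorem eq_zero_of_hasStrictFDerivAt {E : Type} [NormedAddCommGroup E] [NormedSpace ℂ E]
    [CompleteSpace E] {m : ℕ} {f : E → Fin m → ℂ} {f' : E →L[ℂ] (Fin m → ℂ)} {a : E}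
    (hf : HasStrictFDerivAt f f' a) (hf' : Function.Surjective f') {p : MvPolynomial (Fin m) ℂ}
    (hp : ∀ e, eval (f e) p = 0) : p = 0 := by
  have h1 := hf.map_nhds_eq_of_surj (LinearMap.range_eq_top.2 hf')
  have h2 : Set.range f ∈ nhds (f a) := h1 ▸ Filter.mem_map.2 (by simp)
  obtain ⟨ε, hε, hball⟩ := Metric.mem_nhds_iff.1 h2
  refine MvPolynomial.funext_set (fun i ↦ Metric.ball (f a i) ε)
    (fun i ↦ infinite_of_mem_nhds (f a i) (Metric.ball_mem_nhds _ hε)) fun x hx ↦ ?_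
  have hx' : x ∈ Metric.ball (f a) ε := (dist_pi_lt_iff hε).2 fun i ↦ hx i trivial
  obtain ⟨e, rfl⟩ := hball hx'
  rw [hp, map_zero]

/-- Matrix-vector multiplication as a continuous bilinear map. -/
def mulVecCLM (n : ℕ) :
    Matrix (Fin n) (Fin n) ℂ →L[ℂ] (Fin n → ℂ) →L[ℂ] (Fin n → ℂ) :=
  LinearMap.toContinuousLinearMap
    (LinearMap.toContinuousLinearMap.toLinearMap ∘ₗ
      (Matrix.toLin' : Matrix (Fin n) (Fin n) ℂ ≃ₗ[ℂ] _).toLinearMap)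

/-- The map `(A, x) ↦ exp(A)(v + x)` is submersive at the origin when `N` is a complement
to the tangent space of the orbit of `v`. -/
theorem eq_zero_of_eval_exp_mulVec_add {n m : ℕ} (𝔤 : Submodule ℂ (Matrix (Fin n) (Fin n) ℂ))
    (N : Submodule ℂ (Fin n → ℂ)) (v : Fin n → ℂ) (ℓ : (Fin n → ℂ) →ₗ[ℂ] (Fin m → ℂ))
    (hℓ : ∀ z, ∃ A ∈ 𝔤, ∃ x ∈ N, ℓ (Matrix.mulVec A v + x) = z) (p : MvPolynomial (Fin m) ℂ)
    (hp : ∀ A ∈ 𝔤, ∀ x ∈ N, eval (ℓ ((NormedSpace.exp A).mulVec (v + x))) p = 0) : p = 0 := by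
  let f : 𝔤 × N → Fin m → ℂ := fun e ↦
    ℓ ((NormedSpace.exp (e.1 : Matrix (Fin n) (Fin n) ℂ)).mulVec (v + (e.2 : Fin n → ℂ)))
  let fst' : 𝔤 × N →L[ℂ] Matrix (Fin n) (Fin n) ℂ :=
    𝔤.subtypeL.comp (ContinuousLinearMap.fst ℂ 𝔤 N)
  let snd' : 𝔤 × N →L[ℂ] (Fin n → ℂ) := N.subtypeL.comp (ContinuousLinearMap.snd ℂ 𝔤 N)
  have hexp : HasStrictFDerivAt (fun e ↦ NormedSpace.exp (fst' e)) fst' 0 := by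
    have h : HasStrictFDerivAt NormedSpace.exp
        (1 : Matrix (Fin n) (Fin n) ℂ →L[ℂ] Matrix (Fin n) (Fin n) ℂ) (fst' 0) := by
      rw [map_zero]
      exact hasStrictFDerivAt_exp_zero
    exact h.comp 0 fst'.hasStrictFDerivAt
  have hsnd : HasStrictFDerivAt (fun e ↦ v + snd' e) snd' 0 :=
    snd'.hasStrictFDerivAt.const_add v
  have hf := (LinearMap.toContinuousLinearMap ℓ).hasStrictFDerivAt.comp 0
    (((mulVecCLM n).hasStrictFDerivAt.comp 0 hexp).clm_apply hsnd)
  refine eq_zero_of_hasStrictFDerivAt hf (fun z ↦ ?_) (fun e ↦ hp e.1 e.1.2 e.2 e.2.2)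
  obtain ⟨A, hA, x, hx, rfl⟩ := hℓ z
  refine ⟨(⟨A, hA⟩, ⟨x, hx⟩), ?_⟩
  change ℓ ((NormedSpace.exp (fst' 0)).mulVec x + A.mulVec (v + snd' 0)) = _
  rw [map_zero, map_zero, NormedSpace.exp_zero, Matrix.one_mulVec, add_zero, add_comm]

/-- The isotropy Lie algebra acts trivially on a slice on which the isotropy group acts through
a finite group. -/
theorem mulVec_eq_zero_of_hasFiniteImageOn {n : ℕ} {G : Set (Matrix (Fin n) (Fin n) ℂ)}
    (hG : IsMatSubgroup ℂ n G) (hGc : IsZClosedInGL ℂ n G) {v : Fin n → ℂ}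
    {N : Submodule ℂ (Fin n → ℂ)} (hN : HasFiniteImageOn ℂ n (isotropy ℂ n G v) N)
    {A : Matrix (Fin n) (Fin n) ℂ} (hA : A ∈ derivLieAlgebra G) (hAv : A.mulVec v = 0)
    {x : Fin n → ℂ} (hx : x ∈ N) : A.mulVec x = 0 := by
  let f : ℂ → Fin n → ℂ := fun t ↦ (NormedSpace.exp (t • A)).mulVec x
  have hfin : (Set.range f).Finite := by
    refine (hN.image fun F ↦ F ⟨x, hx⟩).subset ?_
    rintro _ ⟨t, rfl⟩
    refine ⟨_, ⟨NormedSpace.exp (t • A), ⟨exp_mem_of_mem_derivLieAlgebra hG hGc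
      (Submodule.smul_mem _ t hA), exp_mulVec_of_mulVec_eq_zero ?_⟩, rfl⟩, rfl⟩
    rw [Matrix.smul_mulVec, hAv, smul_zero]
  have hcont : Continuous f :=
    continuous_iff_continuousAt.2 fun t ↦ (hasDerivAt_exp_smul_mulVec A x t).continuousAt
  have hsub := hfin.countable.isTotallyDisconnected _ subset_rfl (isPreconnected_range hcont)
  have hconst : f = fun _ ↦ f 0 := funext fun t ↦ hsub ⟨t, rfl⟩ ⟨0, rfl⟩
  have h1 : HasDerivAt f _ 0 := hasDerivAt_exp_smul_mulVec A x 0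
  rw [hconst] at h1
  have h2 := h1.unique (hasDerivAt_const _ _)
  simpa using h2

end Exponential

section Averaging

open scoped Matrix.Norms.Operator

theorem continuousOn_inv_of_isMatSubgroup {n : ℕ} {K : Set (Matrix (Fin n) (Fin n) ℂ)}
    (hK : IsMatSubgroup ℂ n K) : ContinuousOn (fun A : Matrix (Fin n) (Fin n) ℂ ↦ A⁻¹) K := by
  intro A hA
  obtain ⟨U, rfl⟩ := (hK.2.2 A hA).1
  have h := NormedRing.inverse_continuousAt U
  simp only [Matrix.nonsing_inv_eq_ringInverse]
  exact h.continuousWithinAt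

/-- Averaging of continuous functions over a compact matrix group. -/
theorem exists_average {n : ℕ} {K : Set (Matrix (Fin n) (Fin n) ℂ)} (hK : IsMatSubgroup ℂ n K)
    (hKc : IsCompact K) : ∃ I : C(K, ℂ) →ₗ[ℂ] ℂ, I 1 = 1 ∧
      ∀ k₀ ∈ K, ∀ f f' : C(K, ℂ),
        (∀ k l : K, (l : Matrix (Fin n) (Fin n) ℂ) = k * k₀ → f' k = f l) → I f' = I f := by
  have hdet (a : K) : IsUnit (a : Matrix (Fin n) (Fin n) ℂ).det :=
    (Matrix.isUnit_iff_isUnit_det _).1 (hK.2.2 a a.2).1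
  let : Group K :=
    { mul := fun a b ↦ ⟨a * b, hK.2.1 a a.2 b b.2⟩
      one := ⟨1, hK.1⟩
      inv := fun a ↦ ⟨(a : Matrix (Fin n) (Fin n) ℂ)⁻¹, (hK.2.2 a a.2).2⟩
      mul_assoc := fun a b c ↦ Subtype.ext (mul_assoc _ _ _)
      one_mul := fun a ↦ Subtype.ext (one_mul _)
      mul_one := fun a ↦ Subtype.ext (mul_one _)
      inv_mul_cancel := fun a ↦ Subtype.ext (Matrix.nonsing_inv_mul _ (hdet a)) }
  have : IsTopologicalGroup K :=
    { continuous_mul := Continuous.subtype_mk ((continuous_subtype_val.comp continuous_fst).mul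
        (continuous_subtype_val.comp continuous_snd)) _
      continuous_inv := Continuous.subtype_mk
        (continuousOn_iff_continuous_domRestrict.1 (continuousOn_inv_of_isMatSubgroup hK)) _ }
  have : CompactSpace K := isCompact_iff_compactSpace.1 hKc
  let : MeasurableSpace K := borel K
  have : BorelSpace K := ⟨rfl⟩
  let μ : MeasureTheory.Measure K := MeasureTheory.Measure.haarMeasure ⊤
  have hμ : MeasureTheory.IsProbabilityMeasure μ :=
    ⟨MeasureTheory.Measure.haarMeasure_self (K₀ := ⊤)⟩
  have hInt (f : C(K, ℂ)) : MeasureTheory.Integrable (fun k ↦ f k⁻¹) μ :=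
    (f.continuous.comp continuous_inv).integrable_of_hasCompactSupport
      (HasCompactSupport.of_compactSpace _)
  refine ⟨{ toFun := fun f ↦ ∫ k, f k⁻¹ ∂μ, map_add' := fun f g ↦ ?_, map_smul' := fun c f ↦ ?_ },
    ?_, fun k₀ hk₀ f f' h ↦ ?_⟩
  · exact MeasureTheory.integral_add (hInt f) (hInt g)
  · exact MeasureTheory.integral_const_mul c _
  · change ∫ k : K, (1 : ℂ) ∂μ = 1
    simp
  · change ∫ k, f' k⁻¹ ∂μ = ∫ k, f k⁻¹ ∂μ
    rw [← MeasureTheory.integral_mul_left_eq_self (fun k ↦ f k⁻¹) (⟨k₀, hk₀⟩ : K)⁻¹]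
    refine MeasureTheory.integral_congr_ae (.of_forall fun k ↦ ?_)
    refine h _ _ ?_
    rw [mul_inv_rev, inv_inv]
    rfl

end Averaging

theorem exists_eval_mulVec_eq_sum {n : ℕ} (b : MvPolynomial (Fin n) ℂ) :
    ∃ (S : Finset (Fin n →₀ ℕ)) (c : (Fin n →₀ ℕ) → MvPolynomial (Fin n × Fin n) ℂ),
      ∀ (g : Matrix (Fin n) (Fin n) ℂ) (v : Fin n → ℂ), eval (Matrix.mulVec g v) b =
        ∑ m ∈ S, eval (fun ij ↦ g ij.1 ij.2) (c m) * ∏ i, v i ^ m i := by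
  let B : MvPolynomial (Fin n) (MvPolynomial (Fin n × Fin n) ℂ) :=
    aeval (fun i ↦ ∑ j, C (X (i, j)) * X j) b
  refine ⟨B.support, fun m ↦ B.coeff m, fun g v ↦ ?_⟩
  rw [← eval₂_eq' (eval fun ij : Fin n × Fin n ↦ g ij.1 ij.2) v B]
  change _ = eval₂Hom _ v (aeval _ b)
  clear B
  induction b using MvPolynomial.induction_on with
  | C a => simp [MvPolynomial.algebraMap_apply]
  | add p q hp hq => simp only [map_add, hp, hq]
  | mul_X p i hp =>
    rw [map_mul, hp, map_mul, map_mul, aeval_X, eval_X]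
    simp [Matrix.mulVec, dotProduct]

/-- The Reynolds operator. -/
theorem exists_invariant_average {n : ℕ} {G : Set (Matrix (Fin n) (Fin n) ℂ)}
    (hG : IsReductiveGroup ℂ n G) (b : MvPolynomial (Fin n) ℂ) :
    ∃ R : MvPolynomial (Fin n) ℂ, Invariant ℂ n G R ∧
      ∀ v c, (∀ g ∈ G, eval (Matrix.mulVec g v) b = c) → eval v R = c := by
  obtain ⟨-, -, K, hKG, hKc, hK, hKd⟩ := hG
  obtain ⟨I, hI1, hI⟩ := exists_average hK hKc
  obtain ⟨S, c, hSc⟩ := exists_eval_mulVec_eq_sum b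
  have hcont (Q : MvPolynomial (Fin n × Fin n) ℂ) :
      Continuous fun k : K ↦ eval (fun ij ↦ (k : Matrix (Fin n) (Fin n) ℂ) ij.1 ij.2) Q :=
    (MvPolynomial.continuous_eval Q).comp
      (continuous_pi fun ij ↦ continuous_subtype_val.matrix_elem ij.1 ij.2)
  let F (Q : MvPolynomial (Fin n × Fin n) ℂ) : C(K, ℂ) := ⟨_, hcont Q⟩
  let R : MvPolynomial (Fin n) ℂ := ∑ m ∈ S, monomial m (I (F (c m)))
  have hR (v : Fin n → ℂ) (f : C(K, ℂ))
      (hf : ∀ k : K, f k = eval (Matrix.mulVec k v) b) : eval v R = I f := by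
    have h1 : f = ∑ m ∈ S, (∏ i, v i ^ m i) • F (c m) := by
      ext k
      rw [hf, hSc]
      simp [F, mul_comm]
    rw [h1, map_sum]
    simp [eval_monomial, Finsupp.prod_fintype, mul_comm]
  have hcb (v : Fin n → ℂ) : Continuous fun k : K ↦ eval (Matrix.mulVec k v) b :=
    (MvPolynomial.continuous_eval b).comp (continuous_subtype_val.matrix_mulVec continuous_const)
  refine ⟨R, fun g hg v ↦ ?_, fun v a hv ↦ ?_⟩
  · have h1 (k) (hk : k ∈ K) : eval (Matrix.mulVec k v) R = eval v R := by
      rw [hR _ ⟨_, hcb (Matrix.mulVec k v)⟩ fun _ ↦ rfl, hR v ⟨_, hcb v⟩ fun _ ↦ rfl]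
      refine hI k hk _ _ fun l l' h ↦ ?_
      change eval _ b = eval _ b
      rw [h, Matrix.mulVec_mulVec]
    have h2 := hKd (orbitPullback v R - C (eval v R)) (fun k hk ↦ by
      rw [map_sub, eval_C, eval_orbitPullback, h1 k hk, sub_self]) g hg
    rwa [map_sub, eval_C, eval_orbitPullback, sub_eq_zero] at h2
  · rw [hR v (a • 1) fun k ↦ by simp [hv k (hKG k.2)], map_smul, hI1, smul_eq_mul, mul_one]

theorem exists_zero_of_ne_top {σ : Type} [Finite σ] {J : Ideal (MvPolynomial σ ℂ)} (hJ : J ≠ ⊤) :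
    ∃ w : σ → ℂ, ∀ p ∈ J, eval w p = 0 := by
  obtain ⟨M, hM, hJM⟩ := J.exists_le_maximal hJ
  obtain ⟨w, rfl⟩ := MvPolynomial.eq_vanishingIdeal_singleton_of_isMaximal ℂ hM
  exact ⟨w, fun p hp ↦ hJM hp w rfl⟩

theorem mem_zclosure_of_mulVec_mem {n : ℕ} {G : Set (Matrix (Fin n) (Fin n) ℂ)}
    (hG : IsMatSubgroup ℂ n G) {u w : Fin n → ℂ} (hw : w ∈ zclosure ℂ n (orbit ℂ n G u))
    {g : Matrix (Fin n) (Fin n) ℂ} (hg : g ∈ G) :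
    Matrix.mulVec g w ∈ zclosure ℂ n (orbit ℂ n G u) := by
  intro p hp
  let q : MvPolynomial (Fin n) ℂ := aeval (fun i ↦ ∑ j, C (g i j) * X j) p
  have hq (x : Fin n → ℂ) : eval x q = eval (Matrix.mulVec g x) p := by
    rw [eval_aeval]
    congr 2
    ext i
    simp [Matrix.mulVec, dotProduct]
  rw [← hq]
  refine hw q ?_
  rintro _ ⟨h, hh, rfl⟩
  change eval (Matrix.mulVec h u) q = 0
  rw [hq, Matrix.mulVec_mulVec]
  exact hp _ ⟨_, hG.2.1 g hg h hh, rfl⟩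

/-- A closed orbit lies in the closure of every orbit in the same fibre of the quotient map. -/
theorem orbit_subset_zclosure_orbit {n : ℕ} {G : Set (Matrix (Fin n) (Fin n) ℂ)}
    (hG : IsReductiveGroup ℂ n G) {u v : Fin n → ℂ} (hv : HasClosedOrbit ℂ n G v)
    (hu : u ∈ piFiber ℂ n G v) : orbit ℂ n G v ⊆ zclosure ℂ n (orbit ℂ n G u) := by
  have hGs := hG.1
  have hJ : vanishingIdeal ℂ n (orbit ℂ n G u) ⊔ vanishingIdeal ℂ n (orbit ℂ n G v) ≠ ⊤ := by
    intro h
    obtain ⟨a, ha, b, hb, hab⟩ := Submodule.mem_sup.1 ((Ideal.eq_top_iff_one _).1 h)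
    obtain ⟨R, hR, hRc⟩ := exists_invariant_average hG b
    have h1 := hRc u 1 fun g hg ↦ by
      have h2 := congrArg (eval (Matrix.mulVec g u)) hab
      rwa [map_add, ha _ ⟨g, hg, rfl⟩, zero_add, map_one] at h2
    have h0 := hRc v 0 fun g hg ↦ hb _ ⟨g, hg, rfl⟩
    exact one_ne_zero (h1.symm.trans ((hu R hR).trans h0))
  obtain ⟨w, hw⟩ := exists_zero_of_ne_top hJ
  obtain ⟨g, hg, rfl⟩ := hv fun p hp ↦ hw p (Submodule.mem_sup_right hp)
  rintro _ ⟨h, hh, rfl⟩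
  have hwu : Matrix.mulVec g v ∈ zclosure ℂ n (orbit ℂ n G u) :=
    fun p hp ↦ hw p (Submodule.mem_sup_left hp)
  have := mem_zclosure_of_mulVec_mem hGs hwu (hGs.2.1 h hh _ (hGs.2.2 g hg).2)
  rwa [Matrix.mulVec_mulVec, Matrix.mul_assoc, Matrix.nonsing_inv_mul _
    ((Matrix.isUnit_iff_isUnit_det _).1 (hGs.2.2 g hg).1), Matrix.mul_one] at this

/-- A linear functional as a polynomial. -/
def linPoly {n : ℕ} (f : (Fin n → ℂ) →ₗ[ℂ] ℂ) : MvPolynomial (Fin n) ℂ :=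
  ∑ k, C (f (Pi.single k 1)) * X k

theorem eval_linPoly {n : ℕ} (f : (Fin n → ℂ) →ₗ[ℂ] ℂ) (x : Fin n → ℂ) :
    eval x (linPoly f) = f x := by
  conv_rhs => rw [pi_eq_sum_univ' x, map_sum]
  simp [linPoly, mul_comm]

theorem finrank_map_le_of_ker_le {E F F' : Type} [AddCommGroup E] [Module ℂ E]
    [FiniteDimensional ℂ E] [AddCommGroup F] [Module ℂ F] [AddCommGroup F'] [Module ℂ F']
    (f : E →ₗ[ℂ] F) (f' : E →ₗ[ℂ] F') (S : Submodule ℂ E)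
    (h : ∀ A ∈ S, f A = 0 → f' A = 0) :
    Module.finrank ℂ (S.map f') ≤ Module.finrank ℂ (S.map f) := by
  have h1 := LinearMap.finrank_range_add_finrank_ker (f.domRestrict S)
  have h2 := LinearMap.finrank_range_add_finrank_ker (f'.domRestrict S)
  have h3 : Module.finrank ℂ (LinearMap.ker (f.domRestrict S)) ≤
      Module.finrank ℂ (LinearMap.ker (f'.domRestrict S)) :=
    Submodule.finrank_mono fun A hA ↦ h A A.2 hA
  rw [LinearMap.range_domRestrict] at h1 h2
  omega

/-- The tangent space of any orbit has dimension at most that of an orbit with a slice on which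
the isotropy Lie algebra acts trivially. -/
theorem finrank_tangent_le {n : ℕ} {G : Set (Matrix (Fin n) (Fin n) ℂ)}
    (hG : IsMatSubgroup ℂ n G) (hGc : IsZClosedInGL ℂ n G) {v : Fin n → ℂ}
    {N : Submodule ℂ (Fin n → ℂ)} (hN : IsSliceComplement ℂ n G v N)
    (hfin : HasFiniteImageOn ℂ n (isotropy ℂ n G v) N) (u : Fin n → ℂ) :
    Module.finrank ℂ ((derivLieAlgebra G).map (applyAt u)) ≤
      Module.finrank ℂ ((derivLieAlgebra G).map (applyAt v)) := by
  by_contra! hlt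
  set s := Module.finrank ℂ ((derivLieAlgebra G).map (applyAt u)) with hs
  let e := Module.finBasis ℂ ((derivLieAlgebra G).map (applyAt u))
  choose A hA hAe using fun i : Fin s ↦ Submodule.mem_map.1 (e i).2
  obtain ⟨ξ, hξ⟩ := LinearMap.exists_extend (p := (derivLieAlgebra G).map (applyAt u))
    e.equivFun.toLinearMap
  have hξe (i : Fin s) : ξ ((A i).mulVec u) = Pi.single i 1 := by
    have h1 := LinearMap.congr_fun hξ (e i)
    rw [LinearMap.comp_apply, Submodule.subtype_apply, ← hAe i] at h1
    refine h1.trans ?_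
    simp [Finsupp.single_eq_pi_single]
  let M : Matrix (Fin s) (Fin s) (MvPolynomial (Fin n) ℂ) :=
    Matrix.of fun i j ↦ linPoly (LinearMap.proj j ∘ₗ ξ ∘ₗ (A i).mulVecLin)
  have hM (x : Fin n → ℂ) :
      eval x M.det = (Matrix.of fun i j ↦ ξ ((A i).mulVec x) j : Matrix (Fin s) (Fin s) ℂ).det := by
    rw [RingHom.map_det]
    congr 1
    ext i j
    simp only [RingHom.mapMatrix_apply, Matrix.map_apply, M, Matrix.of_apply, eval_linPoly]
    rfl
  have hMu : eval u M.det = 1 := by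
    rw [hM]
    convert Matrix.det_one (n := Fin s) (R := ℂ) using 2
    ext i j
    simp [hξe, Matrix.one_apply, Pi.single_apply, eq_comm]
  have hzero : M.det = 0 := by
    refine eq_zero_of_eval_exp_mulVec_add (derivLieAlgebra G) N v LinearMap.id (fun z ↦ ?_) _
      fun B hB x hx ↦ ?_
    · have hz : z ∈ orbitTangent ℂ n G v ⊔ N := hN.1.sup_eq_top ▸ Submodule.mem_top
      rw [orbitTangent_eq hG hGc] at hz
      obtain ⟨_, ⟨B, hB, rfl⟩, x, hx, rfl⟩ := Submodule.mem_sup.1 hz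
      exact ⟨B, hB, x, hx, rfl⟩
    · set g := NormedSpace.exp B with hg
      have hgG : g ∈ G := exp_mem_of_mem_derivLieAlgebra hG hGc hB
      have hle : Module.finrank ℂ ((derivLieAlgebra G).map (applyAt (v + x))) < s := by
        refine (finrank_map_le_of_ker_le _ _ _ fun D hD hDv ↦ ?_).trans_lt hlt
        change D.mulVec (v + x) = 0
        rw [Matrix.mulVec_add, mulVec_eq_zero_of_hasFiniteImageOn hG hGc hfin hD hDv hx, add_zero]
        exact hDv
      let w (i : Fin s) : (derivLieAlgebra G).map (applyAt (v + x)) :=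
        ⟨(g⁻¹ * A i * g).mulVec (v + x),
          ⟨_, conj_mem_derivLieAlgebra hG hGc (hA i) hgG, rfl⟩⟩
      have hdep : ¬ LinearIndependent ℂ w := fun h ↦ by
        have := h.fintype_card_le_finrank
        rw [Fintype.card_fin] at this
        omega
      obtain ⟨a, ha, i, hi⟩ := Fintype.not_linearIndependent_iff.1 hdep
      rw [LinearMap.id_apply, hM]
      refine Matrix.exists_vecMul_eq_zero_iff.1 ⟨a, fun h ↦ hi (congrFun h i), ?_⟩
      have ha' : ∑ i, a i • (g⁻¹ * A i * g).mulVec (v + x) = 0 := by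
        have := congrArg Subtype.val ha
        simpa [w] using this
      have hgA (i) : (A i).mulVec (g.mulVec (v + x)) =
          g.mulVec ((g⁻¹ * A i * g).mulVec (v + x)) := by
        rw [Matrix.mulVec_mulVec, Matrix.mulVec_mulVec, ← Matrix.mul_assoc, ← Matrix.mul_assoc,
          Matrix.mul_nonsing_inv _ ((Matrix.isUnit_iff_isUnit_det _).1 (hG.2.2 g hgG).1),
          Matrix.one_mul]
      have h2 : ξ (g.mulVec (∑ i, a i • (g⁻¹ * A i * g).mulVec (v + x))) = 0 := by
        rw [ha', Matrix.mulVec_zero, map_zero]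
      rw [Matrix.mulVec_sum, map_sum] at h2
      ext j
      have h3 := congrFun h2 j
      simp only [Matrix.mulVec_smul, map_smul, ← hgA, Finset.sum_apply, Pi.smul_apply,
        smul_eq_mul] at h3
      exact h3
  rw [hzero, map_zero] at hMu
  exact zero_ne_one hMu

theorem exists_linearMap_surjOn {V : Type} [AddCommGroup V] [Module ℂ V]
    [FiniteDimensional ℂ V] (S : Submodule ℂ V) {s : ℕ} (hs : s ≤ Module.finrank ℂ S) :
    ∃ ℓ : V →ₗ[ℂ] (Fin s → ℂ), ∀ z, ∃ w ∈ S, ℓ w = z := by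
  obtain ⟨ℓ, hℓ⟩ := LinearMap.exists_extend (p := S)
    (LinearMap.funLeft ℂ ℂ (Fin.castLE hs) ∘ₗ (Module.finBasis ℂ S).equivFun.toLinearMap)
  refine ⟨ℓ, fun z ↦ ?_⟩
  obtain ⟨z', rfl⟩ := LinearMap.funLeft_surjective_of_injective ℂ ℂ _
    (Fin.castLE_injective hs) z
  obtain ⟨w, rfl⟩ := (Module.finBasis ℂ S).equivFun.surjective z'
  exact ⟨w, w.2, LinearMap.congr_fun hℓ w⟩

/-- Divide a nonzero polynomial by the largest possible power of its first variable. -/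
theorem exists_X_zero_pow_mul {s : ℕ} {W : MvPolynomial (Fin (s + 1)) ℂ} (hW : W ≠ 0) :
    ∃ (k : ℕ) (W' : MvPolynomial (Fin (s + 1)) ℂ) (c : MvPolynomial (Fin s) ℂ),
      W = X 0 ^ k * W' ∧ c ≠ 0 ∧
        ∀ t : Fin s → ℂ, eval (Fin.cons 0 t : Fin (s + 1) → ℂ) W' = eval t c := by
  obtain ⟨q, hq, hdvd⟩ := Polynomial.exists_eq_pow_rootMultiplicity_mul_and_not_dvd
    (finSuccEquiv ℂ s W) ((map_ne_zero_iff _ (finSuccEquiv ℂ s).injective).2 hW) 0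
  rw [map_zero, sub_zero] at hq hdvd
  refine ⟨(finSuccEquiv ℂ s W).rootMultiplicity 0, (finSuccEquiv ℂ s).symm q, q.coeff 0,
    (finSuccEquiv ℂ s).injective ?_, ?_, fun t ↦ ?_⟩
  · rw [map_mul, map_pow, finSuccEquiv_X_zero, AlgEquiv.apply_symm_apply]
    exact hq
  · rwa [Ne, ← Polynomial.X_dvd_iff]
  · rw [eval_eq_eval_mv_eval', AlgEquiv.apply_symm_apply, ← Polynomial.coeff_zero_eq_eval_zero,
      Polynomial.coeff_map]

/-- On the part of the orbit of `v` lying over one component of the group, the coordinates `ℓ`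
satisfy a nontrivial relation. -/
theorem exists_relation_of_isPrime {n : ℕ} {G : Set (Matrix (Fin n) (Fin n) ℂ)}
    (hG : IsMatSubgroup ℂ n G) (hGc : IsZClosedInGL ℂ n G) {u v : Fin n → ℂ}
    (hv : HasClosedOrbit ℂ n G v) (huv : u ∉ orbit ℂ n G v) {s : ℕ} (e : Fin s → Fin n → ℂ)
    (he : ∀ A ∈ derivLieAlgebra G, Matrix.mulVec A u ∈ Submodule.span ℂ (Set.range e))
    (ℓ : (Fin n → ℂ) →ₗ[ℂ] (Fin s → ℂ)) (𝔮 : Ideal (MvPolynomial (Fin n × Fin n) ℂ))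
    [𝔮.IsPrime] (h𝔮 : matIdeal G ≤ 𝔮)
    (hdet : (Matrix.of fun i j ↦ X (i, j) :
      Matrix (Fin n) (Fin n) (MvPolynomial (Fin n × Fin n) ℂ)).det ∉ 𝔮) :
    ∃ c : MvPolynomial (Fin s) ℂ, c ≠ 0 ∧ ∀ y ∈ orbit ℂ n G v,
      (∀ p, orbitPullback u p ∈ 𝔮 → eval y p = 0) → eval (ℓ y) c = 0 := by
  obtain ⟨x, hx, hxdet⟩ : ∃ x : Fin n × Fin n → ℂ, (∀ Q ∈ 𝔮, eval x Q = 0) ∧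
      eval x (Matrix.of fun i j ↦ X (i, j) :
        Matrix (Fin n) (Fin n) (MvPolynomial (Fin n × Fin n) ℂ)).det ≠ 0 := by
    by_contra! h
    exact hdet (MvPolynomial.IsPrime.vanishingIdeal_zeroLocus (K := ℂ) 𝔮 ▸ fun x hx ↦ h x hx)
  let g₀ : Matrix (Fin n) (Fin n) ℂ := Matrix.of fun i j ↦ x (i, j)
  have hg₀x : (fun ij : Fin n × Fin n ↦ g₀ ij.1 ij.2) = x := rfl
  have hg₀ : g₀ ∈ G := by
    obtain ⟨P, hP⟩ := hGc
    have h1 : g₀ ∈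
        {g | IsUnit g ∧ ∀ p ∈ P, eval (fun ij : Fin n × Fin n ↦ g ij.1 ij.2) p = 0} := by
      refine ⟨(Matrix.isUnit_iff_isUnit_det _).2 (isUnit_iff_ne_zero.2 ?_),
        fun p hp ↦ hx p (h𝔮 fun g hg ↦ ?_)⟩
      · rw [RingHom.map_det] at hxdet
        convert hxdet using 2
        ext i j
        simp [g₀]
      · rw [hP] at hg
        exact hg.2 p hp
    exact hP.symm ▸ h1
  obtain ⟨b, hb, hbg⟩ : ∃ b ∈ vanishingIdeal ℂ n (orbit ℂ n G v),
      eval (Matrix.mulVec g₀ u) b ≠ 0 := by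
    by_contra! h
    obtain ⟨g, hg, hgv⟩ := hv h
    refine huv ⟨g₀⁻¹ * g, hG.2.1 _ (hG.2.2 _ hg₀).2 _ hg, ?_⟩
    change (g₀⁻¹ * g).mulVec v = u
    rw [← Matrix.mulVec_mulVec]
    change g.mulVec v = _ at hgv
    rw [hgv, Matrix.mulVec_mulVec, Matrix.nonsing_inv_mul _
      ((Matrix.isUnit_iff_isUnit_det _).1 (hG.2.2 g₀ hg₀).1), Matrix.one_mulVec]
  let L := FractionRing (MvPolynomial (Fin n × Fin n) ℂ ⧸ 𝔮)
  let φ : MvPolynomial (Fin n × Fin n) ℂ →ₐ[ℂ] L :=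
    (IsScalarTower.toAlgHom ℂ (MvPolynomial (Fin n × Fin n) ℂ ⧸ 𝔮) L).comp
      (Ideal.Quotient.mkₐ ℂ 𝔮)
  have hφ (Q) : φ Q = 0 ↔ Q ∈ 𝔮 := by
    rw [← Ideal.Quotient.eq_zero_iff_mem]
    exact map_eq_zero_iff _ (IsFractionRing.injective (MvPolynomial (Fin n × Fin n) ℂ ⧸ 𝔮) L)
  let P : Fin (s + 1) → MvPolynomial (Fin n) ℂ :=
    Fin.cons b fun j ↦ linPoly (LinearMap.proj j ∘ₗ ℓ)
  have hdep := not_algebraicIndependent_orbitPullback hG hg₀ φ (fun Q hQ ↦ (hφ Q).2 (h𝔮 hQ))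
    (fun Q hQ ↦ hx Q ((hφ Q).1 hQ)) u e he P
  rw [algebraicIndependent_iff] at hdep
  push Not at hdep
  obtain ⟨W, hW, hW0⟩ := hdep
  obtain ⟨k, W', c, rfl, hc, hWc⟩ := exists_X_zero_pow_mul hW0
  refine ⟨c, hc, fun y hy hyp ↦ ?_⟩
  have hb0 : φ (orbitPullback u b) ≠ 0 := fun h ↦ hbg <| by
    rw [← eval_orbitPullback]
    exact hx _ ((hφ _).1 h)
  rw [map_mul, map_pow, aeval_X] at hW
  have hW' : φ (orbitPullback u (aeval P W')) = 0 := by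
    refine Eq.trans ?_ ((mul_eq_zero.1 hW).resolve_left (pow_ne_zero k hb0))
    rw [← AlgHom.comp_apply, ← AlgHom.comp_apply]
    congr 1
    ext i
    simp
  have h1 := hyp _ ((hφ _).1 hW')
  rw [eval_aeval] at h1
  rw [← hWc]
  refine Eq.trans ?_ h1
  congr 2
  ext i
  refine Fin.cases ?_ (fun j ↦ ?_) i
  · exact (hb y hy).symm
  · exact (eval_linPoly (LinearMap.proj j ∘ₗ ℓ) y).symm

/-- The fibre of the quotient map through an almost principal point is a single orbit. -/
theorem piFiber_subset_orbit {n : ℕ} {G : Set (Matrix (Fin n) (Fin n) ℂ)}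
    (hG : IsReductiveGroup ℂ n G) {v : Fin n → ℂ} (hv : v ∈ aprPoints ℂ n G) :
    piFiber ℂ n G v ⊆ orbit ℂ n G v := by
  intro u hu
  by_contra huv
  have hGs := hG.1
  have hGc := hG.2.1
  obtain ⟨hvc, N, hN, hfin⟩ := hv
  let e := Module.finBasis ℂ ((derivLieAlgebra G).map (applyAt u))
  obtain ⟨ℓ, hℓ⟩ := exists_linearMap_surjOn _ (finrank_tangent_le hGs hGc hN hfin u)
  let δ : MvPolynomial (Fin n × Fin n) ℂ := (Matrix.of fun i j ↦ X (i, j) :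
    Matrix (Fin n) (Fin n) (MvPolynomial (Fin n × Fin n) ℂ)).det
  have hδ (g) (hg : g ∈ G) : eval (fun ij ↦ g ij.1 ij.2) δ ≠ 0 := by
    have h1 : eval (fun ij ↦ g ij.1 ij.2) δ = g.det := by
      rw [RingHom.map_det]
      congr 1
      ext i j
      simp
    rw [h1]
    exact ((Matrix.isUnit_iff_isUnit_det _).1 (hGs.2.2 g hg).1).ne_zero
  have he (A) (hA : A ∈ derivLieAlgebra G) : Matrix.mulVec A u ∈
      Submodule.span ℂ (Set.range fun i ↦ (e i : Fin n → ℂ)) := by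
    have h1 : (⟨A.mulVec u, ⟨A, hA, rfl⟩⟩ : (derivLieAlgebra G).map (applyAt u)) ∈
      Submodule.span ℂ (Set.range e) := e.mem_span _
    have h2 := Submodule.mem_map_of_mem (f := Submodule.subtype _) h1
    rw [Submodule.map_span, ← Set.range_comp] at h2
    exact h2
  have hfinite : {𝔮 ∈ (matIdeal G).minimalPrimes | δ ∉ 𝔮}.Finite :=
    (Ideal.finite_minimalPrimes_of_isNoetherianRing _ _).subset (Set.sep_subset _ _)
  set T := hfinite.toFinset with hT
  have hTmem (𝔮) : 𝔮 ∈ T ↔ 𝔮 ∈ (matIdeal G).minimalPrimes ∧ δ ∉ 𝔮 := by simp [hT]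
  have hrel (𝔮) (h : 𝔮 ∈ T) : ∃ c : MvPolynomial (Fin _) ℂ, c ≠ 0 ∧ ∀ y ∈ orbit ℂ n G v,
      (∀ p, orbitPullback u p ∈ 𝔮 → eval y p = 0) → eval (ℓ y) c = 0 := by
    have := ((hTmem 𝔮).1 h).1.1.1
    exact exists_relation_of_isPrime hGs hGc hvc huv _ he ℓ 𝔮 ((hTmem 𝔮).1 h).1.1.2
      ((hTmem 𝔮).1 h).2
  choose! c hc0 hc using hrel
  refine Finset.prod_ne_zero_iff.2 hc0 (eq_zero_of_eval_exp_mulVec_add (derivLieAlgebra G) ⊥ v ℓ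
    (fun z ↦ ?_) (∏ 𝔮 ∈ T, c 𝔮) fun A hA x hx ↦ ?_)
  · obtain ⟨_, ⟨A, hA, rfl⟩, h⟩ := hℓ z
    exact ⟨A, hA, 0, zero_mem _, by rw [add_zero]; exact h⟩
  · rw [(Submodule.mem_bot ℂ).1 hx, add_zero]
    have hy : (NormedSpace.exp A).mulVec v ∈ orbit ℂ n G v :=
      ⟨_, exp_mem_of_mem_derivLieAlgebra hGs hGc hA, rfl⟩
    set y := (NormedSpace.exp A).mulVec v
    obtain ⟨𝔮, h𝔮, hy𝔮⟩ : ∃ 𝔮 ∈ T, ∀ p, orbitPullback u p ∈ 𝔮 → eval y p = 0 := by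
      by_contra! h
      choose! p hp hpy using h
      refine Finset.prod_ne_zero_iff.2 hpy ?_
      rw [← map_prod]
      refine orbit_subset_zclosure_orbit hG hvc hu hy _ ?_
      rintro _ ⟨g, hg, rfl⟩
      have hrad : orbitPullback u (∏ 𝔮 ∈ T, p 𝔮) * δ ∈ (matIdeal G).radical := by
        rw [← Ideal.sInf_minimalPrimes, Submodule.mem_sInf]
        intro 𝔮 h𝔮
        by_cases hd : δ ∈ 𝔮
        · exact Ideal.mul_mem_left _ _ hd
        · have h1 := (hTmem 𝔮).2 ⟨h𝔮, hd⟩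
          rw [map_prod]
          exact Ideal.mul_mem_right _ _ (Ideal.mem_of_dvd _ (Finset.dvd_prod_of_mem _ h1) (hp 𝔮 h1))
      obtain ⟨k, hk⟩ := hrad
      have h2 := hk g hg
      rw [map_pow, map_mul, eval_orbitPullback] at h2
      exact (mul_eq_zero.1 (eq_zero_of_pow_eq_zero h2)).resolve_right (hδ g hg)
    rw [map_prod]
    exact Finset.prod_eq_zero h𝔮 (hc 𝔮 h𝔮 y hy hy𝔮)

theorem isNoetherianRing_of_faithfullyFlat (A B : Type*) [CommRing A] [CommRing B] [Algebra A B]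
    [Module.FaithfullyFlat A B] [IsNoetherianRing B] : IsNoetherianRing A := by
  refine isNoetherianRing_iff.2 (isNoetherian_iff'.2 ?_)
  have hmono : StrictMono fun I : Ideal A ↦ I.map (algebraMap A B) :=
    Monotone.strictMono_of_injective (fun _ _ h ↦ Ideal.map_mono h)
      Ideal.map_injective_of_faithfullyFlat
  exact hmono.wellFoundedGT

theorem isOpenMap_comap_invariantSubalgebra {n : ℕ} {G : Set (Matrix (Fin n) (Fin n) ℂ)}
    (hcofree : IsCofree ℂ n G) :
    IsOpenMap (PrimeSpectrum.comap
      (algebraMap (invariantSubalgebra ℂ n G) (MvPolynomial (Fin n) ℂ))) := by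
  have : Module.Free (invariantSubalgebra ℂ n G) (MvPolynomial (Fin n) ℂ) := hcofree
  have := isNoetherianRing_of_faithfullyFlat (invariantSubalgebra ℂ n G) (MvPolynomial (Fin n) ℂ)
  have : Algebra.FiniteType (invariantSubalgebra ℂ n G) (MvPolynomial (Fin n) ℂ) :=
    .of_restrictScalars_finiteType ℂ _ _
  have : Algebra.FinitePresentation (invariantSubalgebra ℂ n G) (MvPolynomial (Fin n) ℂ) :=
    Algebra.FinitePresentation.of_finiteType.1 this
  have : Algebra.HasGoingDown (invariantSubalgebra ℂ n G) (MvPolynomial (Fin n) ℂ) := .of_flat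
  exact PrimeSpectrum.isOpenMap_comap_of_hasGoingDown_of_finitePresentation


/-- If `q` does not vanish at `x`, then over all points of `V//G` in a neighbourhood of `π(x)`
there are points at which `q` does not vanish. -/
theorem exists_invariant_forall_exists_mem_piFiber {n : ℕ} {G : Set (Matrix (Fin n) (Fin n) ℂ)}
    (hcofree : IsCofree ℂ n G) {x : Fin n → ℂ} {q : MvPolynomial (Fin n) ℂ} (hq : eval x q ≠ 0) :
    ∃ f, Invariant ℂ n G f ∧ eval x f ≠ 0 ∧
      ∀ y, eval y f ≠ 0 → ∃ z ∈ piFiber ℂ n G y, eval z q ≠ 0 := by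
  let π := PrimeSpectrum.comap (algebraMap (invariantSubalgebra ℂ n G) (MvPolynomial (Fin n) ℂ))
  have hpt (z : Fin n → ℂ) (p : MvPolynomial (Fin n) ℂ) :
      p ∈ (pointToPoint z : PrimeSpectrum (MvPolynomial (Fin n) ℂ)).asIdeal ↔ eval z p = 0 :=
    mem_vanishingIdeal_singleton_iff z p
  have hopen : IsOpen (π '' PrimeSpectrum.basicOpen q) :=
    isOpenMap_comap_invariantSubalgebra hcofree _ (PrimeSpectrum.basicOpen q).isOpen
  have hmem : π (pointToPoint x) ∈ π '' PrimeSpectrum.basicOpen q :=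
    ⟨pointToPoint x, fun h ↦ hq ((hpt x q).1 h), rfl⟩
  obtain ⟨_, ⟨f, rfl⟩, hxf, hf⟩ :=
    PrimeSpectrum.isTopologicalBasis_basic_opens.exists_subset_of_mem_open hmem hopen
  refine ⟨f, f.2, fun h ↦ hxf ((hpt x f).2 h), fun y hy ↦ ?_⟩
  obtain ⟨P, hPq, hP⟩ := hf (a := π (pointToPoint y)) fun h ↦ hy ((hpt y f).1 h)
  obtain ⟨z, hz, hzq⟩ : ∃ z, (∀ p ∈ P.asIdeal, eval z p = 0) ∧ eval z q ≠ 0 := by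
    by_contra! h
    exact hPq (MvPolynomial.IsPrime.vanishingIdeal_zeroLocus (K := ℂ) P.asIdeal ▸
      fun z hz ↦ h z hz)
  refine ⟨z, fun p hp ↦ ?_, hzq⟩
  have hinv : Invariant ℂ n G (p - C (eval y p)) :=
    (invariantSubalgebra ℂ n G).sub_mem hp ((invariantSubalgebra ℂ n G).algebraMap_mem _)
  have h1 : (⟨_, hinv⟩ : invariantSubalgebra ℂ n G) ∈ (π (pointToPoint y)).asIdeal :=
    (hpt y _).2 (by simp)
  rw [← hP] at h1
  have h2 : eval z (p - C (eval y p)) = 0 := hz _ h1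
  rwa [map_sub, eval_C, sub_eq_zero] at h2

/-- **Corollary 3.5.** Let `G` be a complex reductive group and `V = ℂⁿ` a stable cofree
`G`-module.  If `Y ⊆ V` is a `G`-stable algebraic subset such that `Y_apr` is Zariski dense
in `Y`, then `Y` is `G`-saturated. -/
theorem cofree_saturated_of_apr_dense
    (n : ℕ) (G : Set (Matrix (Fin n) (Fin n) ℂ)) (hG : IsReductiveGroup ℂ n G)
    (hstab : IsStableModule ℂ n G) (hcofree : IsCofree ℂ n G)
    (Y : Set (Fin n → ℂ)) (hYalg : IsAlgebraicSet ℂ n Y) (hYstab : Stabilizes ℂ n G Y)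
    (hdense : ZDenseIn ℂ n (Y ∩ aprPoints ℂ n G) Y) :
    IsSaturated ℂ n G Y := by
  obtain ⟨S, rfl⟩ := hYalg
  refine Set.Subset.antisymm (fun y hy ↦ ⟨y, hy, fun _ _ ↦ rfl⟩) ?_
  rintro x ⟨y, hy, hxy⟩ q hq
  by_contra hqx
  obtain ⟨f, hf, hfx, hfq⟩ := exists_invariant_forall_exists_mem_piFiber hcofree hqx
  obtain ⟨a, ⟨haY, ha⟩, hfa⟩ : ∃ a ∈ zeroSet ℂ n S ∩ aprPoints ℂ n G, eval a f ≠ 0 := by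
    by_contra! h
    exact hfx ((hxy f hf).trans (hdense f h y hy))
  obtain ⟨z, hz, hzq⟩ := hfq a hfa
  obtain ⟨g, hg, rfl⟩ := piFiber_subset_orbit hG ha hz
  exact hzq (hYstab g hg a haY q hq)

end ZPaper
end
end
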